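/- Fix ε∈{+,−} and, for every (β,s)∈Δ⁺×ℤ, a decomposition of s defining Ẽ^ε_{β,s}. Then the ordered monomials Ẽ^ε_h := ∏_{(β,s)} Ẽ^{ε,(h(β,s))}_{β,s} (product taken from left to right in increasing order of (β,s)), for h∈H, form a basis of the Lusztig integral form 𝐔_v^>(Lo_{2n}) as a ℤ[v,v^{−1}]-module. -/

import Mathlib

noncomputable section
open scoped BigOperators DirectSum

/-! ### Base field ℚ(v) and quantum numbers -/

/-- the base field `ℚ(v)`. -/
abbrev KK : Type := RatFunc ℚ
/-- the variable `v ∈ ℚ(v)`. -/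
def vv : KK := RatFunc.X
/-- integer powers of `v`. -/
def vpow (m : ℤ) : KK := vv ^ m
/-- the quantum integer `[m]_u = (uᵐ - u⁻ᵐ)/(u - u⁻¹)`. -/
def qInt (u : KK) (m : ℕ) : KK := (u ^ (m : ℤ) - u ^ (-(m : ℤ))) / (u - u⁻¹)
/-- the quantum factorial `[m]_u!`. -/
def qFact (u : KK) (m : ℕ) : KK := ∏ k ∈ Finset.range m, qInt u (k + 1)
/-- the quantum binomial coefficient. -/
def qBinom (u : KK) (m k : ℕ) : KK := qFact u m / (qFact u k * qFact u (m - k))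
/-- `⟨m⟩_v = vᵐ - v⁻ᵐ`. -/
def qBrack (m : ℕ) : KK := vpow (m : ℤ) - vpow (-(m : ℤ))
/-- the sign `ε ∈ {+,-}` as `±1`. -/
def sgn (ε : Bool) : ℤ := if ε then 1 else -1
/-- `l` is an integer power of `v`. -/
def IsVpow (l : KK) : Prop := ∃ m : ℤ, l = vpow m

/-! ### Cartan data of types `C_n` and `D_n` (1-based indices) -/

/-- the Cartan matrix of type `C_n` (1-based indices). -/
def aC (n i j : ℕ) : ℤ :=
  if i = j then 2 else if i + 1 = n ∧ j = n then -2
  else if i + 1 = j ∨ j + 1 = i then -1 else 0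
/-- the symmetrizing integers `d_i` of type `C_n`. -/
def dC (n i : ℕ) : ℕ := if i = n then 2 else 1
/-- the Cartan matrix of type `D_n` (1-based indices). -/
def aD (n i j : ℕ) : ℤ :=
  if i = j then 2
  else if (i + 1 = j ∧ j + 1 ≤ n) ∨ (j + 1 = i ∧ i + 1 ≤ n) then -1
  else if (i + 2 = n ∧ j = n) ∨ (j + 2 = n ∧ i = n) then -1 else 0
/-- the symmetrizing integers `d_i` of type `D_n` (all equal to `1`). -/
def dD (n i : ℕ) : ℕ := 1

/-! ### The positive subalgebra of the quantum loop algebra, for Cartan data `(A, Dd)` -/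

section Ualg
variable (n : ℕ) (A : ℕ → ℕ → ℤ) (Dd : ℕ → ℕ)

/-- the free `ℚ(v)`-algebra on generators `e_{i,r}`, `i ∈ I`, `r ∈ ℤ`. -/
abbrev FA := FreeAlgebra KK (Fin n × ℤ)
/-- the free generator `e_{i,r}`. -/
def fg (i : Fin n) (r : ℤ) : FA n := FreeAlgebra.ι KK (i, r)

/-- the `z^{-r₁}⋯z^{-r_m}w^{-t}`-coefficient of the Serre relation between colors `i ≠ j`. -/
def serreElt (i j : Fin n) (m : ℕ) (r : Fin m → ℤ) (t : ℤ) : FA n :=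
  ∑ σ : Equiv.Perm (Fin m), ∑ k ∈ Finset.range (m + 1),
    ((-1 : KK) ^ k * qBinom (vpow (Dd (i.1 + 1))) m k) •
      (((List.ofFn fun l => fg n i (r (σ l))).take k
        ++ fg n j t :: (List.ofFn fun l => fg n i (r (σ l))).drop k).prod)

/-- the defining relations of `U_v^>(Lg)` in the new Drinfeld realization: the coefficients of
`(z - v_i^{a_ij} w) e_i(z) e_j(w) = (v_i^{a_ij} z - w) e_j(w) e_i(z)` and of the Serre relations. -/
inductive URel : FA n → FA n → Prop
  | loop (i j : Fin n) (r s : ℤ) :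
      URel (fg n i (r + 1) * fg n j s
             - vpow ((Dd (i.1 + 1) : ℤ) * A (i.1 + 1) (j.1 + 1)) • (fg n i r * fg n j (s + 1)))
           (vpow ((Dd (i.1 + 1) : ℤ) * A (i.1 + 1) (j.1 + 1)) • (fg n j s * fg n i (r + 1))
             - fg n j (s + 1) * fg n i r)
  | serre (i j : Fin n) (hij : i ≠ j) (r : Fin (1 - A (i.1 + 1) (j.1 + 1)).toNat → ℤ) (t : ℤ) :
      URel (serreElt n Dd i j _ r t) 0

/-- the positive subalgebra `U_v^>(Lg)` of the quantum loop algebra. -/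
abbrev UA := RingQuot (URel n A Dd)
/-- the generator `e_{i,r}` of `U_v^>(Lg)`. -/
def ug (i : Fin n) (r : ℤ) : UA n A Dd := RingQuot.mkAlgHom KK (URel n A Dd) (fg n i r)
/-- the generator `e_{i,r}` with a 1-based index `1 ≤ i ≤ n` (and junk value `0` otherwise). -/
def g1 (i : ℕ) (r : ℤ) : UA n A Dd := if h : 1 ≤ i ∧ i ≤ n then ug n A Dd ⟨i - 1, by omega⟩ r else 0

end Ualg

/-! ### `q`-brackets, ordered monomials, and ℤ[v,v⁻¹]-forms -/

section Aux
variable {B : Type} [Ring B] [Module KK B]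

/-- the `u`-commutator `[x,y]_u = xy - u · yx`. -/
def qcm (u : KK) (x y : B) : B := x * y - u • (y * x)

/-- the iterated `q`-bracket `[⋯[[g i₁ s₁, g i₂ s₂]_{λ₁}, g i₃ s₃]_{λ₂}, ⋯]_{λ_{ℓ-1}}`. -/
def chainE (g : ℕ → ℤ → B) (w : List ℕ) (ss : List ℤ) (ls : List KK) : B :=
  match w, ss with
  | i :: w', s :: ss' =>
      ((w'.zip ss').zip ls).foldl
        (fun acc p => acc * g p.1.1 p.1.2 - p.2 • (g p.1.1 p.1.2 * acc)) (g i s)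
  | _, _ => 0
end Aux

section Mon
variable {B : Type} [Ring B] {ι : Type} [LinearOrder ι]
/-- the ordered monomial `∏→ (E p)^(h p)`, the product taken in increasing order of `p`. -/
def ordMon (E : ι → B) (h : ι →₀ ℕ) : B := ((h.support.sort (· ≤ ·)).map (fun p => E p ^ h p)).prod
end Mon

/-- the subring `ℤ[v,v⁻¹] ⊆ ℚ(v)`. -/
def Rint : Subring KK := Subring.closure {vv, vv⁻¹}

section Forms
variable {B : Type} [Ring B] [Algebra KK B]
/-- the `ℤ[v,v⁻¹]`-subalgebra of a `ℚ(v)`-algebra generated by a set `X`, realized as the subring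
generated by `X` together with the central scalars `v^{±1}`. -/
def zvForm (X : Set B) : Subring B :=
  Subring.closure ({algebraMap KK B vv, algebraMap KK B vv⁻¹} ∪ X)
end Forms

/-! ### Positive roots of type `D_n` with the fixed convex (lexicographic) order -/

section RootsD
variable (n : ℕ)

/-- Positive roots of type `D_n`, encoded as lexicographically ordered pairs `(i,t)`:
`[i,i+t]` for `i+t<n` or `i=n`; `[i,n]` for `i+t=n`; `[i,n,n-1]` for `i+t=n+1`;
`[i,n,j]` with `j = 2n-i-t` for `i+t ≥ n+2`.  The induced linear order is exactly the
convex order coming from standard Lyndon words. -/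
def IsPosRootD (p : Fin (n + 1) ×ₗ Fin (2 * n + 1)) : Prop :=
  1 ≤ ((ofLex p).1 : ℕ) ∧ (n - 1 ≤ ((ofLex p).1 : ℕ) → ((ofLex p).2 : ℕ) = 0) ∧
    (((ofLex p).2 : ℕ) = 0 ∨ ((ofLex p).2 : ℕ) + 2 * ((ofLex p).1 : ℕ) + 1 ≤ 2 * n)

instance : DecidablePred (IsPosRootD n) := fun p => by unfold IsPosRootD; infer_instance

/-- the set `Δ⁺` of positive roots of type `D_n`, with its convex linear order. -/
abbrev PosRootD := {p : Fin (n + 1) ×ₗ Fin (2 * n + 1) // IsPosRootD n p}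

variable {n}
/-- the first index `i` of a positive root. -/
def riD (β : PosRootD n) : ℕ := ((ofLex β.1).1 : ℕ)
/-- the offset `t` of a positive root within its block. -/
def rtD (β : PosRootD n) : ℕ := ((ofLex β.1).2 : ℕ)

/-- multiplicity of `α_c` (1-based color `c`) in the positive root `β` (type `D_n`). -/
def nuD (β : PosRootD n) (c : ℕ) : ℕ :=
  let i := riD β; let t := rtD β
  if i + t < n ∨ i = n then (if i ≤ c ∧ c ≤ i + t then 1 else 0)
  else if i + t = n then (if (i ≤ c ∧ c ≤ n - 2) ∨ c = n then 1 else 0)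
  else if i + t = n + 1 then (if i ≤ c ∧ c ≤ n then 1 else 0)
  else (if i ≤ c ∧ c < 2 * n - i - t then 1
        else if 2 * n - i - t ≤ c ∧ c ≤ n - 2 then 2
        else if c = n - 1 ∨ c = n then 1 else 0)

/-- standard Lyndon word (list of 1-based simple-root indices) of `β` (type `D_n`). -/
def wordD (β : PosRootD n) : List ℕ :=
  let i := riD β; let t := rtD β
  if i + t < n ∨ i = n then List.range' i (t + 1)
  else if i + t = n then List.range' i (n - 1 - i) ++ [n]
  else if i + t = n + 1 then List.range' i (n - 1 - i) ++ [n, n - 1]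
  else List.range' i (n - 1 - i) ++ [n] ++ (List.range' (2 * n - i - t) (n - (2 * n - i - t))).reverse

/-- the height `|β|` of a positive root (type `D_n`). -/
def heightD (β : PosRootD n) : ℕ := (wordD β).length

/-- `β` is a root of the form `[i,n,j]` with `i < j ≤ n-2`. -/
def isSpecD (β : PosRootD n) : Prop := n + 2 ≤ riD β + rtD β
instance (β : PosRootD n) : Decidable (isSpecD β) := by unfold isSpecD; infer_instance
end RootsD

/-! ### General quantum root vectors of type `D_n` -/

section RVD
variable (n : ℕ)

/-- the positive subalgebra `U_v^>(Lo_{2n})`. -/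
abbrev UD := UA n (aD n) (dD n)
/-- generators of `U_v^>(Lo_{2n})` with 1-based indices. -/
def genD : ℕ → ℤ → UD n := g1 n (aD n) (dD n)

variable {n}
/-- `E` is a quantum root vector `E_{β,s}` of type `D_n` for some choice of the parameters
`λ_k ∈ v^ℤ` and of a decomposition of `s`: an iterated `q`-bracket along the standard Lyndon
word of `β`. -/
def IsRVD (β : PosRootD n) (s : ℤ) (E : UD n) : Prop :=
  ∃ (ss : List ℤ) (ls : List KK),
    ss.length = (wordD β).length ∧ ls.length + 1 = (wordD β).length ∧ ss.sum = s ∧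
    (∀ l ∈ ls, IsVpow l) ∧ E = chainE (genD n) (wordD β) ss ls
end RVD

/-! ### The specific quantum root vectors `Ẽ^ε_{β,s}` of type `D_n` -/

section TildeD
variable {n : ℕ}

/-- the specific quantum root vector `Ẽ^ε_{β,s}` of type `D_n`, determined by the sign `ε`
and the decomposition data `t` (assigning `s_ℓ` to each 1-based index `ℓ`); all `q`-bracket
parameters equal `v^{±1}`. -/
def tildeED (ε : Bool) (β : PosRootD n) (t : ℕ → ℤ) : UD n :=
  chainE (genD (n := n)) (wordD β) ((wordD β).map t)
    (List.replicate ((wordD β).length - 1) (vpow (sgn ε)))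

/-- the value `s` represented by the decomposition data `t` for the root `β` (type `D_n`). -/
def sOfD (β : PosRootD n) (t : ℕ → ℤ) : ℤ := ((wordD β).map t).sum

/-- the normalized divided power `Ẽ^{ε,(k)}_{β,s} = (Ẽ^ε_{β,s})^k/[k]_v!` of type `D_n`. -/
def tildeEPowD (ε : Bool) (β : PosRootD n) (t : ℕ → ℤ) (k : ℕ) : UD n :=
  (qFact vv k)⁻¹ • (tildeED ε β t) ^ k

/-- the normalized quantum root vector `𝓔̃^ε_{β,s} = ⟨1⟩_v · Ẽ^ε_{β,s}` of type `D_n`. -/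
def rttED (ε : Bool) (β : PosRootD n) (t : ℕ → ℤ) : UD n := qBrack 1 • tildeED ε β t

/-- the Lusztig integral form `𝐔_v^>(Lo_{2n})`: the `ℤ[v,v⁻¹]`-subalgebra generated by the
divided powers `e_{i,r}^k/[k]_v!`. -/
def LusFormD (n : ℕ) : Subring (UD n) :=
  zvForm {x | ∃ (i : Fin n) (r : ℤ) (k : ℕ),
    x = (qFact vv k)⁻¹ • (ug n (aD n) (dD n) i r) ^ k}

/-- the RTT integral form `𝓤_v^>(Lo_{2n})` attached to a sign `ε` and a choice `T` of
decompositions. -/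
def RttFormD (ε : Bool) (T : PosRootD n × ℤ → (ℕ → ℤ)) : Subring (UD n) :=
  zvForm {x | ∃ p : PosRootD n × ℤ, x = rttED ε p.1 (T p)}

end TildeD

/-- the ordered monomial `Ẽ^ε_h = ∏→ Ẽ^{ε,(h(β,s))}_{β,s}` of normalized divided powers,
for a choice `T` of decompositions. -/
def lusMonD {n : ℕ} (ε : Bool) (T : PosRootD n × ℤ → (ℕ → ℤ))
    (h : Lex (PosRootD n × ℤ) →₀ ℕ) : UD n :=
  ((h.support.sort (· ≤ ·)).map
    (fun p => tildeEPowD ε (ofLex p).1 (T (ofLex p)) (h p))).prod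

theorem vv_ne_zero : vv ≠ 0 := RatFunc.X_ne_zero

theorem vv_pow_ne_one {k : ℕ} (hk : k ≠ 0) : vv ^ k ≠ 1 := by
  intro h
  have h' : (algebraMap (Polynomial ℚ) KK) (Polynomial.X ^ k) = algebraMap _ _ 1 := by
    simpa [vv, RatFunc.algebraMap_X] using h
  have h2 := RatFunc.algebraMap_injective ℚ h'
  have := congrArg Polynomial.natDegree h2
  simp at this
  exact hk this

theorem vpow_add (a b : ℤ) : vpow (a + b) = vpow a * vpow b := zpow_add₀ vv_ne_zero a b
theorem vpow_ne_zero (a : ℤ) : vpow a ≠ 0 := zpow_ne_zero _ vv_ne_zero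
theorem vpow_neg (a : ℤ) : vpow (-a) = (vpow a)⁻¹ := zpow_neg _ _
theorem vpow_one : vpow 1 = vv := zpow_one _
theorem vpow_neg_one : vpow (-1) = vv⁻¹ := zpow_neg_one _
theorem vpow_ne_one {a : ℤ} (ha : a ≠ 0) : vpow a ≠ 1 := by
  intro h
  rcases Int.natAbs_eq a with h1 | h1
  · rw [h1] at h
    simp only [vpow, zpow_natCast] at h
    exact vv_pow_ne_one (by omega) h
  · rw [h1, vpow_neg, inv_eq_one] at h
    simp only [vpow, zpow_natCast] at h
    exact vv_pow_ne_one (by omega) h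

theorem vv_sub_inv_ne_zero : vv - vv⁻¹ ≠ 0 := by
  intro h
  have h2 : vv * vv = 1 := by
    have := sub_eq_zero.1 h
    nth_rewrite 1 [this]
    exact inv_mul_cancel₀ vv_ne_zero
  exact vv_pow_ne_one (k := 2) (by norm_num) (by rw [pow_two]; exact h2)

theorem qInt_succ_ne_zero (m : ℕ) : qInt vv (m + 1) ≠ 0 := by
  unfold qInt
  refine div_ne_zero ?_ vv_sub_inv_ne_zero
  intro h
  have h1 := sub_eq_zero.1 h
  have h2 : vpow (((m + 1 : ℕ) : ℤ) + ((m + 1 : ℕ) : ℤ)) = 1 := by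
    rw [vpow_add]
    unfold vpow
    nth_rewrite 1 [h1]
    rw [← zpow_add₀ vv_ne_zero]
    simp
  exact vpow_ne_one (by positivity) h2

theorem qFact_ne_zero (m : ℕ) : qFact vv m ≠ 0 :=
  Finset.prod_ne_zero_iff.2 fun k _ => qInt_succ_ne_zero k

theorem qInt_one : qInt vv 1 = 1 := by
  simp [qInt, div_self vv_sub_inv_ne_zero]

theorem qInt_zero : qInt vv 0 = 0 := by
  simp [qInt]

theorem qInt_two : qInt vv 2 = vv + vv⁻¹ := by
  unfold qInt
  rw [div_eq_iff vv_sub_inv_ne_zero]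
  have := vv_ne_zero
  simp only [Nat.cast_ofNat, zpow_neg]
  norm_cast
  field_simp
  ring

theorem vv_add_inv_ne_zero : vv + vv⁻¹ ≠ 0 := by
  rw [← qInt_two]; exact qInt_succ_ne_zero 1

theorem vpow_add_inv (m : ℤ) (hm : m = 1 ∨ m = -1) : vpow m + (vpow m)⁻¹ = vv + vv⁻¹ := by
  rcases hm with rfl | rfl
  · rw [vpow_one]
  · rw [vpow_neg_one, inv_inv, add_comm]

theorem qFact_succ (u : KK) (m : ℕ) : qFact u (m + 1) = qFact u m * qInt u (m + 1) := by
  simp [qFact, Finset.prod_range_succ]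

theorem qFact_zero (u : KK) : qFact u 0 = 1 := by simp [qFact]
theorem qFact_one : qFact vv 1 = 1 := by simp [qFact_succ, qFact_zero, qInt_one]
theorem qFact_two : qFact vv 2 = vv + vv⁻¹ := by
  rw [qFact_succ, qFact_one, one_mul]; exact qInt_two

theorem qBinom_zero (m : ℕ) : qBinom vv m 0 = 1 := by
  simp [qBinom, qFact_zero, qFact_ne_zero]
theorem qBinom_self (m : ℕ) : qBinom vv m m = 1 := by
  simp [qBinom, qFact_zero, qFact_ne_zero]
theorem qBinom_two_one : qBinom vv 2 1 = vv + vv⁻¹ := by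
  simp [qBinom, qFact_one, qFact_two]

theorem aD_symm (n i j : ℕ) : aD n i j = aD n j i := by
  unfold aD; split_ifs <;> first | rfl | omega

theorem aD_self (n i : ℕ) : aD n i i = 2 := by simp [aD]

theorem aD_cases {n i j : ℕ} (h : i ≠ j) : aD n i j = 0 ∨ aD n i j = -1 := by
  unfold aD; simp only [h, if_false]; split_ifs <;> simp

/-- The defining relations of `U_v^>(Lo_{2n})` for a family `e i r`, with colors in `ℕ`. -/
structure LoopRel {K : Type} [Field K] (v : K) (n : ℕ) {B : Type} [Ring B] [Algebra K B]
    (e : ℕ → ℤ → B) : Prop where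
  loop : ∀ i j r s, e i (r + 1) * e j s - v ^ aD n i j • (e i r * e j (s + 1)) =
    v ^ aD n i j • (e j s * e i (r + 1)) - e j (s + 1) * e i r
  comm : ∀ i j r s, i ≠ j → aD n i j = 0 → e i r * e j s = e j s * e i r
  serre : ∀ i j r s t, aD n i j = -1 →
    (e i r * e i s + e i s * e i r) * e j t
      - (v + v⁻¹) • (e i r * e j t * e i s + e i s * e j t * e i r)
      + e j t * (e i r * e i s + e i s * e i r) = 0
  zero : ∀ i r, ¬ (1 ≤ i ∧ i ≤ n) → e i r = 0

theorem g1_fin (n : ℕ) (A : ℕ → ℕ → ℤ) (D : ℕ → ℕ) (i : Fin n) (r : ℤ) :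
    g1 n A D (i.1 + 1) r = ug n A D i r := by
  have : 1 ≤ i.1 + 1 ∧ i.1 + 1 ≤ n := ⟨by omega, i.2⟩
  simp [g1, this]

theorem g1_zero (n : ℕ) (A : ℕ → ℕ → ℤ) (D : ℕ → ℕ) (i : ℕ) (r : ℤ) (h : ¬ (1 ≤ i ∧ i ≤ n)) :
    g1 n A D i r = 0 := by
  simp only [g1]; rw [dif_neg h]

theorem serreElt_one (n : ℕ) (i j : Fin n) (r : Fin 1 → ℤ) (t : ℤ) :
    serreElt n (dD n) i j 1 r t = fg n j t * fg n i (r 0) - fg n i (r 0) * fg n j t := by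
  simp [serreElt, Finset.sum_range_succ, dD, vpow_one, qBinom_zero, qBinom_self, sub_eq_add_neg]

theorem univ_perm_two : (Finset.univ : Finset (Equiv.Perm (Fin 2))) = {1, Equiv.swap 0 1} := by
  decide

theorem neg_smul_rearrange {K B : Type} [Field K] [AddCommGroup B] [Module K B] (q : K)
    (a b c d f g : B) :
    a + (-q + -q⁻¹) • b + c + (d + (-q + -q⁻¹) • f + g) =
      c + g - ((q + q⁻¹) • b + (q + q⁻¹) • f) + (a + d) := by
  module

theorem serreElt_two (n : ℕ) (i j : Fin n) (r : Fin 2 → ℤ) (t : ℤ) :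
    serreElt n (dD n) i j 2 r t =
      (fg n i (r 0) * fg n i (r 1) + fg n i (r 1) * fg n i (r 0)) * fg n j t
      - (vv + vv⁻¹) • (fg n i (r 0) * fg n j t * fg n i (r 1) +
          fg n i (r 1) * fg n j t * fg n i (r 0))
      + fg n j t * (fg n i (r 0) * fg n i (r 1) + fg n i (r 1) * fg n i (r 0)) := by
  have hne : (1 : Equiv.Perm (Fin 2)) ≠ Equiv.swap 0 1 := by decide
  simp only [serreElt, univ_perm_two, Finset.sum_range_succ, dD]
  rw [Finset.sum_pair hne]
  simp [vpow_one, qBinom_zero, qBinom_self, qBinom_two_one, mul_assoc, mul_add, add_mul, -nsmul_eq_mul]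
  exact neg_smul_rearrange _ _ _ _ _ _ _

theorem mk_serreElt (n m : ℕ) (i j : Fin n) (hij : i ≠ j)
    (hm : (1 - aD n (i.1 + 1) (j.1 + 1)).toNat = m) (r : Fin m → ℤ) (t : ℤ) :
    RingQuot.mkAlgHom KK (URel n (aD n) (dD n)) (serreElt n (dD n) i j m r t) = 0 := by
  subst hm
  rw [RingQuot.mkAlgHom_rel KK (URel.serre i j hij r t), map_zero]

theorem exists_fin_of_range {n i : ℕ} (hi : 1 ≤ i ∧ i ≤ n) : ∃ k : Fin n, i = k.1 + 1 :=
  ⟨⟨i - 1, by omega⟩, by simp; omega⟩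

theorem genD_rel (n : ℕ) : LoopRel vv n (genD n) where
  zero := fun i r h => g1_zero n _ _ i r h
  loop := by
    intro i j r s
    by_cases hi : 1 ≤ i ∧ i ≤ n
    swap
    · simp [genD, g1_zero n _ _ i _ hi]
    by_cases hj : 1 ≤ j ∧ j ≤ n
    swap
    · simp [genD, g1_zero n _ _ j _ hj]
    obtain ⟨i, rfl⟩ := exists_fin_of_range hi
    obtain ⟨j, rfl⟩ := exists_fin_of_range hj
    simp only [genD, g1_fin]
    have := RingQuot.mkAlgHom_rel KK (URel.loop (n := n) (A := aD n) (Dd := dD n) i j r s)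
    simpa [ug, dD, vpow] using this
  comm := by
    intro i j r s hij ha
    by_cases hi : 1 ≤ i ∧ i ≤ n
    swap
    · simp [genD, g1_zero n _ _ i _ hi]
    by_cases hj : 1 ≤ j ∧ j ≤ n
    swap
    · simp [genD, g1_zero n _ _ j _ hj]
    obtain ⟨i, rfl⟩ := exists_fin_of_range hi
    obtain ⟨j, rfl⟩ := exists_fin_of_range hj
    have := mk_serreElt n 1 i j (by rintro rfl; exact hij rfl) (by rw [ha]; rfl) (fun _ => r) s
    rw [serreElt_one, map_sub, map_mul, map_mul, sub_eq_zero] at this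
    simp only [genD, g1_fin]
    exact this.symm
  serre := by
    intro i j r s t ha
    by_cases hi : 1 ≤ i ∧ i ≤ n
    swap
    · simp [genD, g1_zero n _ _ i _ hi]
    by_cases hj : 1 ≤ j ∧ j ≤ n
    swap
    · simp [genD, g1_zero n _ _ j _ hj]
    obtain ⟨i, rfl⟩ := exists_fin_of_range hi
    obtain ⟨j, rfl⟩ := exists_fin_of_range hj
    have := mk_serreElt n 2 i j (by rintro rfl; rw [aD_self] at ha; omega) (by rw [ha]; rfl)
      ![r, s] t
    rw [serreElt_two] at this
    simp only [genD, g1_fin]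
    simpa [ug] using this

/-- The algebra map out of `U_v^>(Lo_{2n})` defined by a family satisfying the relations. -/
theorem exists_lift {n : ℕ} {B : Type} [Ring B] [Algebra KK B] {e : ℕ → ℤ → B}
    (h : LoopRel vv n e) : ∃ f : UD n →ₐ[KK] B, ∀ i r, f (genD n i r) = e i r := by
  let φ : FA n →ₐ[KK] B := FreeAlgebra.lift KK fun p => e (p.1.1 + 1) p.2
  have hφ : ∀ i r, φ (fg n i r) = e (i.1 + 1) r := fun i r => by simp [φ, fg]
  have hrel : ∀ ⦃x y⦄, URel n (aD n) (dD n) x y → φ x = φ y := by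
    intro x y hxy
    cases hxy with
    | loop i j r s =>
      simpa [hφ, dD, vpow] using h.loop (i.1 + 1) (j.1 + 1) r s
    | serre i j hij r t =>
      rw [map_zero]
      have hij' : i.1 + 1 ≠ j.1 + 1 := fun h => hij (Fin.ext (by omega))
      have key : ∀ m, (1 - aD n (i.1 + 1) (j.1 + 1)).toNat = m → ∀ r : Fin m → ℤ,
          φ (serreElt n (dD n) i j m r t) = 0 := by
        intro m hm r
        rcases aD_cases (n := n) hij' with ha | ha
        · rw [ha] at hm
          obtain rfl : 1 = m := hm
          rw [serreElt_one]
          simp [hφ, h.comm _ _ _ _ hij' ha]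
        · rw [ha] at hm
          obtain rfl : 2 = m := hm
          rw [serreElt_two]
          simpa [hφ] using h.serre _ _ (r 0) (r 1) t ha
      exact key _ rfl r
  refine ⟨RingQuot.liftAlgHom KK ⟨φ, hrel⟩, fun i r => ?_⟩
  by_cases hi : 1 ≤ i ∧ i ≤ n
  · obtain ⟨i, rfl⟩ := exists_fin_of_range hi
    simp only [genD, g1_fin, ug]
    rw [RingQuot.liftAlgHom_mkAlgHom_apply]
    exact hφ i r
  · rw [h.zero i r hi, (genD_rel n).zero i r hi, map_zero]

section FiniteSerre
variable {K : Type} [Field K] {B : Type} [Ring B] [Algebra K B]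

/-- The `u`-commutator over a general field. -/
def qb (u : K) (x y : B) : B := x * y - u • (y * x)

/-- The quantum Serre relation `x²y - [2]xyx + yx² = 0`, cleared of denominators. -/
def Ser (u : K) (x y : B) : Prop :=
  u • (x * (x * y) + y * (x * x)) = (u * u + 1) • (x * (y * x))

theorem qb_serre_comm {u : K} {a b : B} (h : Ser u a b) :
    u • (a * qb u a b) = qb u a b * a := by
  simp only [Ser, qb, mul_sub, sub_mul, mul_assoc, smul_mul_assoc, mul_smul_comm] at h ⊢
  linear_combination (norm := module) h

theorem qb_serre_comm' {u : K} {a b : B} (h : Ser u b a) :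
    u • (qb u a b * b) = b * qb u a b := by
  simp only [Ser, qb, mul_sub, sub_mul, mul_assoc, smul_mul_assoc, mul_smul_comm] at h ⊢
  linear_combination (norm := module) h

theorem serre_of_qb_comm {u : K} {x c : B} (h : u • (x * qb u x c) = qb u x c * x) :
    Ser u x c := by
  simp only [Ser, qb, mul_sub, sub_mul, mul_assoc, smul_mul_assoc, mul_smul_comm] at h ⊢
  linear_combination (norm := module) h

theorem commute_qb {u : K} {x y z : B} (hy : Commute x y) (hz : Commute x z) :
    Commute x (qb u y z) := by
  unfold qb
  exact (hy.mul_right hz).sub_right ((hz.mul_right hy).smul_right u)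

theorem qb_swap_last {u : K} {a b c : B} (hbc : Commute b c) :
    qb u (qb u a b) c = qb u (qb u a c) b := by
  have h1 := congrArg (a * ·) hbc.eq
  have h2 := congrArg (· * a) hbc.eq
  simp only [mul_assoc] at h1 h2
  simp only [qb, mul_sub, sub_mul, mul_assoc, smul_mul_assoc, mul_smul_comm]
  linear_combination (norm := module) h1 - (u * u) • h2

/-- If `a`, `c` commute and both satisfy the Serre relation with `b`, then `[[a,b],c]`
commutes with `b`. -/
theorem commute_qb_qb {u : K} (hu : u * u + 1 ≠ 0) {a b c : B} (hac : Commute a c)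
    (ha : Ser u b a) (hc : Ser u b c) : Commute b (qb u (qb u a b) c) := by
  have e1 := congrArg (a * ·) hc
  have e2 := congrArg (· * c) ha
  have e3 := congrArg (c * ·) ha
  have e4 := congrArg (· * a) hc
  have k1 := congrArg (b * ·) (congrArg (b * ·) hac.eq)
  have k2 := congrArg (b * ·) (congrArg (· * b) hac.eq)
  have k3 := congrArg (· * b) (congrArg (· * b) hac.eq)
  refine smul_right_injective B hu (?_ : (u * u + 1) • (b * _) = (u * u + 1) • (_ * b))
  simp only [Ser, qb, mul_sub, sub_mul, mul_add, add_mul, mul_assoc, smul_mul_assoc,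
    mul_smul_comm] at *
  linear_combination (norm := module) e1 - e2 + (u*u) • e3 - (u*u) • e4 - (u*u*u) • k1
    + (u*(u*u+1)) • k2 - u • k3

theorem serre_qb {u : K} (hu : u * u + 1 ≠ 0) {a b c : B} (hac : Commute a c)
    (hab : Ser u a b) (hba : Ser u b a) (hbc : Ser u b c) (hcb : Ser u c b) :
    Ser u (qb u a b) c ∧ Ser u c (qb u a b) := by
  constructor
  · apply serre_of_qb_comm
    set x := qb u a b with hx
    set z := qb u x c with hz
    have hbz : Commute b z := commute_qb_qb hu hac hba hbc
    have hax : u • (a * x) = x * a := qb_serre_comm hab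
    have haz : u • (a * z) = z * a := by
      have h1 := congrArg (· * c) hax
      have h2 := congrArg (c * ·) hax
      have h3 := congrArg (· * x) hac.eq
      have h4 := congrArg (x * ·) hac.eq
      simp only [hz, qb, mul_sub, sub_mul, mul_assoc, smul_mul_assoc, mul_smul_comm] at h1 h2 h3 h4 ⊢
      linear_combination (norm := module) h1 - u • h2 + h4 - (u * u) • h3
    have h1 := congrArg (· * b) haz
    have h2 := congrArg (b * ·) haz
    have h3 := congrArg (a * ·) hbz.eq
    have h4 := congrArg (· * a) hbz.eq
    clear_value z
    simp only [hx, qb, mul_sub, sub_mul, mul_assoc, smul_mul_assoc, mul_smul_comm] at h1 h2 h3 h4 ⊢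
    linear_combination (norm := module) h1 - u • h2 + u • h3 - u • h4
  · have h1 := congrArg (a * ·) hcb
    have h2 := congrArg (· * a) hcb
    have k1 := congrArg (c * ·) (congrArg (· * b) hac.eq)
    have k4 := congrArg (· * (c * b)) hac.eq
    have k5 := congrArg (b * ·) (congrArg (· * c) hac.eq)
    have k6 := congrArg ((b * c) * ·) hac.eq
    have k7 := congrArg (c * ·) (congrArg (b * ·) hac.eq)
    have k8 := congrArg (· * (b * c)) hac.eq
    simp only [Ser, qb, mul_sub, sub_mul, mul_add, add_mul, mul_assoc, smul_mul_assoc,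
      mul_smul_comm] at *
    linear_combination (norm := module) h1 - u • h2 - u • k1 - u • k4 - (u * u) • k5
      - (u * u) • k6 + (u * u + 1) • k8 + (u * (u * u + 1)) • k7
end FiniteSerre

section DividedPowers
variable {K : Type} [Field K] {B : Type} [Ring B] [Algebra K B]

/-- The divided power `x^k / [k]!` with respect to a sequence `br` of quantum integers. -/
def dpow (br : ℕ → K) (x : B) (k : ℕ) : B := (∏ i ∈ Finset.range k, br (i + 1))⁻¹ • x ^ k

/-- The sequence `br` consists of quantum integers with parameter `u`. -/
structure IsQuantumInt (u : K) (br : ℕ → K) : Prop where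
  zero : br 0 = 0
  one : br 1 = 1
  add : ∀ r s, br (r + s) = u ^ r * br s + (u⁻¹) ^ s * br r
  ne_zero : ∀ k, br (k + 1) ≠ 0

variable {u : K} {br : ℕ → K}

theorem dpow_zero (x : B) : dpow br x 0 = 1 := by simp [dpow]

theorem dpow_mul_self (h : IsQuantumInt u br) (x : B) (k : ℕ) :
    dpow br x k * x = br (k + 1) • dpow br x (k + 1) := by
  have := h.ne_zero k
  simp only [dpow, smul_mul_assoc, ← pow_succ, smul_smul, Finset.prod_range_succ, mul_inv]
  congr 1
  field_simp

theorem self_mul_dpow (h : IsQuantumInt u br) (x : B) (k : ℕ) :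
    x * dpow br x k = br (k + 1) • dpow br x (k + 1) := by
  rw [← dpow_mul_self h]
  simp only [dpow, smul_mul_assoc, mul_smul_comm, ← pow_succ, ← pow_succ']

theorem dpow_mul_of_skew {x z : B} {c : K} (h : x * z = c • (z * x)) (k : ℕ) :
    dpow br x k * z = c ^ k • (z * dpow br x k) := by
  have key : ∀ k : ℕ, x ^ k * z = c ^ k • (z * x ^ k) := by
    intro k
    induction k with
    | zero => simp
    | succ k ih =>
      rw [pow_succ, mul_assoc, h, mul_smul_comm, ← mul_assoc, ih, smul_mul_assoc, smul_smul,
        mul_assoc, ← pow_succ']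
  simp only [dpow, smul_mul_assoc, mul_smul_comm, key, smul_smul, mul_comm]

theorem dpow_mul_qb (h : IsQuantumInt u br) (hu : u ≠ 0) {x y : B}
    (hxz : u • (x * qb u x y) = qb u x y * x) (k : ℕ) :
    dpow br x (k + 1) * y = u ^ (k + 1) • (y * dpow br x (k + 1)) + qb u x y * dpow br x k := by
  set z := qb u x y with hz
  have hxy : x * y = u • (y * x) + z := by rw [hz, qb]; abel
  have hxz' : x * z = u⁻¹ • (z * x) := by rw [← hxz, smul_smul, inv_mul_cancel₀ hu, one_smul]
  induction k with
  | zero => simp [dpow, h.one, hxy]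
  | succ k ih =>
    have hk := h.ne_zero (k + 1)
    apply smul_right_injective B hk
    simp only
    rw [← smul_mul_assoc, ← self_mul_dpow h, mul_assoc, ih, mul_add, mul_smul_comm, ← mul_assoc,
      hxy, ← mul_assoc, hxz', add_mul, smul_mul_assoc, mul_assoc, self_mul_dpow h, smul_mul_assoc,
      mul_assoc, self_mul_dpow h, smul_add, smul_add, mul_smul_comm, h.add (k + 1) 1, h.one]
    simp only [mul_smul_comm]
    module

theorem sum_antidiagonal_skew (h : IsQuantumInt u br) (hu : u ≠ 0) (X y : B) (c : K) (m : ℕ) :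
    br (m + 1) • ∑ p ∈ Finset.HasAntidiagonal.antidiagonal (m + 1),
        (-c) ^ p.1 • (dpow br y p.1 * X * dpow br y p.2) =
      (∑ p ∈ Finset.HasAntidiagonal.antidiagonal m, (-(c * u)) ^ p.1 • (dpow br y p.1 * X * dpow br y p.2)) * y
      - (c * (u⁻¹) ^ m) • (y * ∑ p ∈ Finset.HasAntidiagonal.antidiagonal m,
          (-(c * u)) ^ p.1 • (dpow br y p.1 * X * dpow br y p.2)) := by
  have e : ∀ p ∈ Finset.HasAntidiagonal.antidiagonal (m + 1),
      br (m + 1) • (-c) ^ p.1 • (dpow br y p.1 * X * dpow br y p.2) =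
      ((-(c * u)) ^ p.1 * br p.2) • (dpow br y p.1 * X * dpow br y p.2) +
      ((-c) ^ p.1 * (u⁻¹) ^ p.2 * br p.1) • (dpow br y p.1 * X * dpow br y p.2) := by
    rintro ⟨r, s⟩ hp
    rw [Finset.HasAntidiagonal.mem_antidiagonal] at hp
    simp only at hp ⊢
    rw [← hp, h.add, show -(c * u) = -c * u by ring, mul_pow]
    module
  rw [Finset.smul_sum, Finset.sum_congr rfl e, Finset.sum_add_distrib,
    Finset.Nat.sum_antidiagonal_succ', Finset.Nat.sum_antidiagonal_succ (n := m)]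
  simp only [h.zero, mul_zero, zero_smul, zero_add]
  rw [sub_eq_add_neg, Finset.sum_mul, Finset.mul_sum, Finset.smul_sum, ← Finset.sum_neg_distrib]
  congr 1
  · refine Finset.sum_congr rfl fun p _ => ?_
    rw [smul_mul_assoc, mul_assoc _ _ y, dpow_mul_self h, mul_smul_comm, smul_smul]
  · refine Finset.sum_congr rfl fun p hp => ?_
    rw [Finset.HasAntidiagonal.mem_antidiagonal] at hp
    rw [mul_smul_comm, mul_assoc (dpow br y p.1) X, ← mul_assoc y (dpow br y p.1), self_mul_dpow h, smul_mul_assoc, ← mul_assoc,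
      smul_smul, smul_smul, ← neg_smul, ← hp]
    congr 1
    rw [neg_pow (c * u), neg_pow c, pow_succ, pow_succ, mul_pow, pow_add]
    have : u ^ p.1 * (u⁻¹) ^ p.1 = 1 := by rw [← mul_pow, mul_inv_cancel₀ hu, one_pow]
    linear_combination ((-1) ^ p.1 * c * c ^ p.1 * (u⁻¹) ^ p.2 * br (p.1 + 1)) * this

theorem dpow_qb_mul_dpow (h : IsQuantumInt u br) (hu : u ≠ 0) {x y : B}
    (hxy : Ser u x y) (hyx : Ser u y x) (l m : ℕ) :
    dpow br (qb u x y) m * dpow br x l = ∑ p ∈ Finset.HasAntidiagonal.antidiagonal m,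
      (-(u ^ (l + 1))) ^ p.1 • (dpow br y p.1 * dpow br x (l + m) * dpow br y p.2) := by
  have hxz := qb_serre_comm hxy
  have hzy : qb u x y * y = u⁻¹ • (y * qb u x y) := by
    rw [← qb_serre_comm' hyx, smul_smul, inv_mul_cancel₀ hu, one_smul]
  induction m generalizing l with
  | zero => simp [dpow_zero]
  | succ m ih =>
    apply smul_right_injective B (h.ne_zero m)
    simp only
    have hs := sum_antidiagonal_skew h hu (dpow br x (l + 1 + m)) y (u ^ (l + 1)) m
    rw [show u ^ (l + 1) * u = u ^ (l + 1 + 1) from (pow_succ _ _).symm] at hs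
    rw [show l + (m + 1) = l + 1 + m by ring, hs, ← ih, mul_assoc, dpow_mul_qb h hu hxz, mul_add,
      ← mul_assoc, dpow_mul_self h, smul_mul_assoc, mul_smul_comm, ← mul_assoc,
      dpow_mul_of_skew hzy, smul_mul_assoc, mul_assoc]
    module

theorem dpow_qb_mem (h : IsQuantumInt u br) (hu : u ≠ 0) {x y : B}
    (hxy : Ser u x y) (hyx : Ser u y x) {L : Subring B} (hL : ∀ b ∈ L, u • b ∈ L) (k : ℕ)
    (hx : ∀ k, dpow br x k ∈ L) (hy : ∀ k, dpow br y k ∈ L) : dpow br (qb u x y) k ∈ L := by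
  have := dpow_qb_mul_dpow h hu hxy hyx 0 k
  rw [dpow_zero, mul_one] at this
  rw [this]
  refine L.sum_mem fun p _ => ?_
  have hpow : ∀ (j : ℕ) (b : B), b ∈ L → (-(u ^ (0 + 1))) ^ j • b ∈ L := by
    intro j
    induction j with
    | zero => intro b hb; simpa using hb
    | succ j ih =>
      intro b hb
      rw [pow_succ, mul_smul]
      apply ih
      rw [neg_smul, zero_add, pow_one]
      exact L.neg_mem (hL b hb)
  exact hpow _ _ (L.mul_mem (L.mul_mem (hy _) (hx _)) (hy _))

end DividedPowers

/-- `α_c` is adjacent to `α_a` in the Dynkin diagram. -/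
def Adj (n i j : ℕ) : Prop := (i + 1 = j ∧ j + 1 ≤ n) ∨
    (j + 1 = i ∧ i + 1 ≤ n) ∨ (i + 2 = n ∧ j = n) ∨ (j + 2 = n ∧ i = n)

theorem aD_eq_neg_one_iff (n i j : ℕ) : aD n i j = -1 ↔ Adj n i j := by
  unfold Adj aD; split_ifs <;> simp <;> omega

theorem aD_eq_zero_iff (n i j : ℕ) : aD n i j = 0 ↔ i ≠ j ∧ ¬ Adj n i j := by
  unfold Adj aD; split_ifs <;> simp <;> omega

/-- The standard Lyndon word of the `t`-th root in block `i`. -/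
def wordN (n i t : ℕ) : List ℕ :=
  if i + t < n ∨ i = n then List.range' i (t + 1)
  else if i + t = n then List.range' i (n - 1 - i) ++ [n]
  else if i + t = n + 1 then List.range' i (n - 1 - i) ++ [n, n - 1]
  else List.range' i (n - 1 - i) ++ [n] ++ (List.range' (2 * n - i - t) (n - (2 * n - i - t))).reverse

theorem wordD_eq_wordN {n : ℕ} (β : PosRootD n) : wordD β = wordN n (riD β) (rtD β) := rfl

/-- `(i,t)` encodes a positive root. -/
def RootIdx (n i t : ℕ) : Prop :=
  1 ≤ i ∧ i ≤ n ∧ (t = 0 ∨ i + 2 ≤ n ∧ t + 2 * i + 1 ≤ 2 * n)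

/-- Adding the simple root `α_c` to the root `t` of block `i` gives the root `t'`. -/
def Up (n i t c t' : ℕ) : Prop :=
  i + 2 ≤ n ∧ t' + 2 * i + 1 ≤ 2 * n ∧
    ((i + t + 1 < n ∧ c = i + t + 1 ∧ t' = t + 1) ∨ (i + t + 2 = n ∧ c = n ∧ t' = t + 2) ∨
      (i + t + 1 = n ∧ c = n ∧ t' = t + 2) ∨ (n ≤ i + t ∧ c + i + t + 1 = 2 * n ∧ t' = t + 1))

/-- The edges of the tree of standard Lyndon words. -/
def Edge (n i t c t' : ℕ) : Prop := Up n i t c t' ∧ i + t + 1 ≠ n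

theorem exists_edge {n i t : ℕ} (h : RootIdx n i t) (ht : t ≠ 0) : ∃ t0 c, Edge n i t0 c t := by
  unfold RootIdx at h
  rcases lt_trichotomy (i + t) n with h1 | h1 | h1
  · exact ⟨t - 1, i + t, by unfold Edge Up; omega⟩
  · exact ⟨t - 2, n, by unfold Edge Up; omega⟩
  · exact ⟨t - 1, 2 * n - i - t, by unfold Edge Up; omega⟩

theorem Up.lt {n i t c t' : ℕ} (h : Up n i t c t') : t < t' := by unfold Up at h; omega

theorem Up.color {n i t c t' : ℕ} (h : Up n i t c t') : i < c ∧ c ≤ n := by unfold Up at h; omega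

theorem Up.rootIdx {n i t c t' : ℕ} (h : Up n i t c t') (hi : 1 ≤ i) : RootIdx n i t := by
  unfold Up at h; unfold RootIdx; omega

theorem Up.rootIdx' {n i t c t' : ℕ} (h : Up n i t c t') (hi : 1 ≤ i) : RootIdx n i t' := by
  unfold Up at h; unfold RootIdx; omega

theorem wordN_edge {n i t c t' : ℕ} (h : Edge n i t c t') :
    wordN n i t' = wordN n i t ++ [c] := by
  obtain ⟨⟨hi, ht, h⟩, hne⟩ := h
  have hin : i ≠ n := by omega
  rcases h with ⟨h1, rfl, rfl⟩ | ⟨h1, rfl, rfl⟩ | ⟨h1, _⟩ | ⟨h1, h2, rfl⟩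
  · simp only [wordN, hin, or_false]
    rw [if_pos (by omega), if_pos (by omega), List.range'_concat]
    simp [add_assoc]
  · simp only [wordN, hin, or_false]
    rw [if_neg (by omega), if_pos (by omega), if_pos (by omega)]
    rw [show c - 1 - i = t + 1 by omega]
  · omega
  · rcases h1.eq_or_lt with h3 | h3
    · simp only [wordN, hin, or_false]
      rw [if_neg (by omega), if_neg (by omega), if_pos (by omega), if_neg (by omega),
        if_pos (by omega)]
      simp; omega
    · simp only [wordN, hin, or_false]
      rw [if_neg (by omega), if_neg (by omega), if_neg (by omega), if_neg (by omega),
        if_neg (by omega)]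
      split_ifs with h4
      · obtain ⟨m, rfl⟩ : ∃ m, n = m + 2 := ⟨n - 2, by omega⟩
        rw [show 2 * (m + 2) - i - (t + 1) = m by omega, show m + 2 - m = 2 by omega]
        simp [List.range'_succ]; omega
      · rw [show 2 * n - i - (t + 1) = c by omega, show 2 * n - i - t = c + 1 by omega,
          show n - c = (n - (c + 1)) + 1 by omega, List.range'_succ]
        simp

theorem wordN_zero {n i : ℕ} (h : i ≤ n) : wordN n i 0 = [i] := by
  simp [wordN]; omega

theorem wordN_ne_nil {n i t : ℕ} (h : RootIdx n i t) : wordN n i t ≠ [] := by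
  by_cases ht : t = 0
  · subst ht; rw [wordN_zero h.2.1]; simp
  · obtain ⟨t0, c, he⟩ := exists_edge h ht
    rw [wordN_edge he]; simp

section Combinatorics
variable {n i t0 t c a t' : ℕ}

theorem edge_comm_up (he : Edge n i t0 a t) (hca : c ≠ a) (hadj : ¬ Adj n c a)
    (h3 : ∀ t', ¬ Up n i t c t') : ¬ Up n i t0 c t' := by
  intro h
  unfold Adj at hadj
  obtain ⟨⟨h1, h2, he⟩, h5⟩ := he
  obtain ⟨_, h6, h⟩ := h
  by_cases hc : c = n
  · refine h3 (t + 2) ⟨h1, ?_, ?_⟩ <;>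
    rcases he with he | he | he | he <;> rcases h with h | h | h | h <;> omega
  · refine h3 (t + 1) ⟨h1, ?_, ?_⟩ <;>
    rcases he with he | he | he | he <;> rcases h with h | h | h | h <;> omega

theorem edge_comm_down (he : Edge n i t0 a t) (hadj : ¬ Adj n c a)
    (h4 : ∀ t', ¬ Up n i t' c t) : ¬ Up n i t' c t0 := by
  intro h
  have h41 := h4 (t - 2)
  clear h4
  unfold Adj at hadj
  unfold Up at h41
  obtain ⟨⟨_, _, he⟩, _⟩ := he
  obtain ⟨_, _, h⟩ := h
  rcases he with he | he | he | he <;> rcases h with h | h | h | h <;> omega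

theorem edge_adj_down (he : Edge n i t0 a t) (hadj : Adj n c a) (hc : i < c)
    (h3 : ∀ t', ¬ Up n i t c t') : ∃ t1, Up n i t1 c t0 := by
  by_contra hcon
  rw [not_exists] at hcon
  obtain ⟨⟨h1, h2, he⟩, h5⟩ := he
  have h31 : ¬ (t + 1 + 2 * i + 1 ≤ 2 * n ∧ (i + t + 1 < n ∧ c = i + t + 1 ∨
      n ≤ i + t ∧ c + i + t + 1 = 2 * n)) := fun h => h3 (t + 1) ⟨h1, h.1, by omega⟩
  have h32 : ¬ (t + 2 + 2 * i + 1 ≤ 2 * n ∧ (i + t + 2 = n ∨ i + t + 1 = n) ∧ c = n) :=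
    fun h => h3 (t + 2) ⟨h1, h.1, by omega⟩
  have h41 : ¬ (1 ≤ t0 ∧ (i + t0 < n ∧ c = i + t0 ∨ n + 1 ≤ i + t0 ∧ c + i + t0 = 2 * n)) :=
    fun h => hcon (t0 - 1) ⟨h1, by omega, by omega⟩
  have h42 : ¬ (2 ≤ t0 ∧ (i + t0 = n ∨ i + t0 = n + 1) ∧ c = n) :=
    fun h => hcon (t0 - 2) ⟨h1, by omega, by omega⟩
  clear h3 hcon
  unfold Adj at hadj
  rcases he with he | he | he | he <;> rcases hadj with h | h | h | h <;> omega

theorem path_not_up (he : Edge n i t0 a t) (hup : Up n i t' c t0) (hadj : Adj n c a) (t2 : ℕ) :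
    ¬ Up n i t' a t2 := by
  intro h
  unfold Adj at hadj
  obtain ⟨⟨_, _, he⟩, _⟩ := he
  obtain ⟨_, _, hup⟩ := hup
  obtain ⟨_, _, h⟩ := h
  rcases he with he | he | he | he <;> rcases hup with hup | hup | hup | hup <;>
    rcases h with h | h | h | h <;> omega

theorem path_not_down (he : Edge n i t0 a t) (hup : Up n i t' c t0) (t2 : ℕ) :
    ¬ Up n i t2 a t' := by
  intro h
  obtain ⟨⟨_, _, he⟩, _⟩ := he
  obtain ⟨_, _, hup⟩ := hup
  obtain ⟨_, _, h⟩ := h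
  rcases he with he | he | he | he <;> rcases hup with hup | hup | hup | hup <;>
    rcases h with h | h | h | h <;> omega

theorem path_not_up' (he : Edge n i t0 a t) (hup : Up n i t c t') (hadj : Adj n a c) (t2 : ℕ) :
    ¬ Up n i t0 c t2 := by
  intro h
  unfold Adj at hadj
  obtain ⟨⟨_, _, he⟩, _⟩ := he
  obtain ⟨_, _, hup⟩ := hup
  obtain ⟨_, _, h⟩ := h
  rcases he with he | he | he | he <;> rcases hup with hup | hup | hup | hup <;>
    rcases h with h | h | h | h <;> omega

theorem path_not_down' (he : Edge n i t0 a t) (hup : Up n i t c t') (t2 : ℕ) :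
    ¬ Up n i t2 c t0 := by
  intro h
  obtain ⟨⟨_, _, he⟩, _⟩ := he
  obtain ⟨_, _, hup⟩ := hup
  obtain ⟨_, _, h⟩ := h
  rcases he with he | he | he | he <;> rcases hup with hup | hup | hup | hup <;>
    rcases h with h | h | h | h <;> omega

theorem path_ne (he : Edge n i t0 a t) (hup : Up n i t c t') : a ≠ c := by
  obtain ⟨⟨_, _, he⟩, _⟩ := he
  obtain ⟨_, _, hup⟩ := hup
  rcases he with he | he | he | he <;> rcases hup with hup | hup | hup | hup <;> omega

theorem path_branch (he : Edge n i t0 a t) (hup : Up n i t c t') (hadj : ¬ Adj n a c) :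
    ∃ t2, Up n i t0 c t2 := by
  have hne := path_ne he hup
  unfold Adj at hadj
  obtain ⟨⟨_, _, he⟩, _⟩ := he
  obtain ⟨_, _, hup⟩ := hup
  by_cases hc : c = n
  · refine ⟨t0 + 2, ?_⟩
    unfold Up
    rcases he with he | he | he | he <;> rcases hup with hup | hup | hup | hup <;> omega
  · refine ⟨t0 + 1, ?_⟩
    unfold Up
    rcases he with he | he | he | he <;> rcases hup with hup | hup | hup | hup <;> omega

end Combinatorics

section RootVec
variable {K : Type} [Field K] {B : Type} [Ring B] [Algebra K B]

/-- The iterated `u`-commutator of the family `y` along the Lyndon word of the root `(i,t)`. -/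
def rootVec (u : K) (y : ℕ → B) (n i t : ℕ) : B :=
  ((wordN n i t).tail.map y).foldl (qb u) (y i)

theorem rootVec_zero (u : K) (y : ℕ → B) {n i : ℕ} (h : i ≤ n) : rootVec u y n i 0 = y i := by
  simp [rootVec, wordN_zero h]

theorem rootVec_edge (u : K) (y : ℕ → B) {n i t c t' : ℕ} (hi : 1 ≤ i) (h : Edge n i t c t') :
    rootVec u y n i t' = qb u (rootVec u y n i t) (y c) := by
  unfold rootVec
  rw [wordN_edge h, List.tail_append_of_ne_nil (wordN_ne_nil (h.1.rootIdx hi)), List.map_append,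
    List.foldl_append]
  simp

/-- The finite type `D_n` quantum Serre relations for a family `y`. -/
structure FinRel (u : K) (n : ℕ) (y : ℕ → B) : Prop where
  comm : ∀ i j, aD n i j = 0 → Commute (y i) (y j)
  serre : ∀ i j, aD n i j = -1 → Ser u (y i) (y j)

theorem Ser.symm_param {u : K} (hu : u ≠ 0) {x y : B} (h : Ser u x y) : Ser u⁻¹ x y := by
  unfold Ser at h ⊢
  apply smul_right_injective B (mul_ne_zero hu hu)
  simp only [smul_smul]
  rw [mul_assoc, mul_inv_cancel₀ hu, mul_one, h]
  congr 1
  field_simp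
  ring

theorem Ser.smul_left {u : K} {x y : B} (h : Ser u x y) (c : K) : Ser u (c • x) y := by
  have := congrArg ((c * c) • ·) h
  simp only [Ser, smul_add, smul_mul_assoc, mul_smul_comm] at this ⊢
  linear_combination (norm := module) this

theorem Ser.smul_right {u : K} {x y : B} (h : Ser u x y) (c : K) : Ser u x (c • y) := by
  have := congrArg (c • ·) h
  simp only [Ser, smul_add, smul_mul_assoc, mul_smul_comm] at this ⊢
  linear_combination (norm := module) this

theorem qb_flip {u : K} (hu : u ≠ 0) (x y : B) : qb u x y = (-u) • qb u⁻¹ y x := by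
  simp only [qb, smul_sub, smul_smul, neg_mul, mul_inv_cancel₀ hu]
  module

theorem serre_qb' {u : K} (hu0 : u ≠ 0) (hu : u * u + 1 ≠ 0) {a b c : B} (hac : Commute a c)
    (hab : Ser u a b) (hba : Ser u b a) (hbc : Ser u b c) (hcb : Ser u c b) :
    Ser u (qb u b a) c ∧ Ser u c (qb u b a) := by
  have hu' : u⁻¹ * u⁻¹ + 1 ≠ 0 := by
    intro h
    apply hu
    have : (u * u) * (u⁻¹ * u⁻¹ + 1) = 0 := by rw [h, mul_zero]
    field_simp at this
    linear_combination this
  have := serre_qb hu' hac (hab.symm_param hu0) (hba.symm_param hu0) (hbc.symm_param hu0)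
    (hcb.symm_param hu0)
  rw [qb_flip hu0]
  have h1 := this.1.symm_param (inv_ne_zero hu0)
  have h2 := this.2.symm_param (inv_ne_zero hu0)
  rw [inv_inv] at h1 h2
  exact ⟨h1.smul_left _, h2.smul_right _⟩

variable {u : K} {y : ℕ → B} {n : ℕ}

theorem rootVec_up (hy : FinRel u n y) {i t c t' : ℕ} (hi : 1 ≤ i) (h : Up n i t c t') :
    rootVec u y n i t' = qb u (rootVec u y n i t) (y c) := by
  by_cases hne : i + t + 1 = n
  · obtain ⟨s, rfl⟩ : ∃ s, t = s + 1 := ⟨t - 1, by unfold Up at h; omega⟩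
    have e1 : Edge n i s (n - 1) (s + 1) := by unfold Edge Up at *; omega
    have e2 : Edge n i s n (s + 2) := by unfold Edge Up at *; omega
    have e3 : Edge n i (s + 2) (n - 1) (s + 3) := by unfold Edge Up at *; omega
    obtain ⟨rfl, rfl⟩ : t' = s + 3 ∧ c = n := by unfold Up at h; omega
    rw [rootVec_edge u y hi e3, rootVec_edge u y hi e2, rootVec_edge u y hi e1]
    apply qb_swap_last
    exact hy.comm _ _ (by rw [aD_eq_zero_iff]; unfold Adj; unfold Up at h; omega)
  · exact rootVec_edge u y hi ⟨h, hne⟩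

theorem rootVec_finite (hu0 : u ≠ 0) (hu : u * u + 1 ≠ 0) (hy : FinRel u n y) {i : ℕ}
    (hi : 1 ≤ i) (t : ℕ) (ht : RootIdx n i t) :
    (∀ c, i < c → c ≤ n → (∀ t', ¬ Up n i t c t') → (∀ t', ¬ Up n i t' c t) →
      Commute (y c) (rootVec u y n i t)) ∧
    (∀ c t', Up n i t c t' → Ser u (rootVec u y n i t) (y c) ∧
      Ser u (y c) (rootVec u y n i t)) := by
  induction t using Nat.strong_induction_on with
  | _ t ih =>
  by_cases ht0 : t = 0
  · subst ht0
    rw [rootVec_zero _ _ ht.2.1]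
    constructor
    · intro c h1 h2 h3 h4
      apply hy.comm
      rw [aD_eq_zero_iff]
      have a1 := h3 1
      have a2 := h3 2
      clear h3 h4
      unfold Adj
      unfold Up at a1 a2; omega
    · intro c t' h
      have hadj : Adj n i c := by
        clear ih
        unfold Adj; unfold Up at h; omega
      exact ⟨hy.serre _ _ ((aD_eq_neg_one_iff _ _ _).2 hadj),
        hy.serre _ _ (by rw [aD_symm]; exact (aD_eq_neg_one_iff _ _ _).2 hadj)⟩
  obtain ⟨t0, a, he⟩ := exists_edge ht ht0
  have hF := rootVec_edge u y hi he
  obtain ⟨ih1, ih2⟩ := ih t0 he.1.lt (he.1.rootIdx hi)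
  constructor
  · intro c h1 h2 h3 h4
    have hca : c ≠ a := by rintro rfl; exact h4 _ he.1
    by_cases hadj : Adj n c a
    · -- the letter `c` was attached just before `a`, possibly along the second branch
      obtain ⟨t1, hup⟩ := edge_adj_down he hadj h1 h3
      obtain ⟨ih3, ih4⟩ := ih t1 (hup.lt.trans he.1.lt) (hup.rootIdx hi)
      rw [hF, rootVec_up hy hi hup]
      exact commute_qb_qb hu (ih3 a he.1.color.1 he.1.color.2 (path_not_up he hup hadj)
        (path_not_down he hup)).symm (ih4 c t0 hup).2
        (hy.serre _ _ ((aD_eq_neg_one_iff _ _ _).2 hadj))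
    · rw [hF]
      exact commute_qb (ih1 c h1 h2 (fun _ => edge_comm_up he hca hadj h3)
        (fun _ => edge_comm_down he hadj h4))
        (hy.comm _ _ ((aD_eq_zero_iff _ _ _).2 ⟨hca, hadj⟩))
  · intro c t' hup
    obtain ⟨ih5, ih6⟩ := ih2 a t he.1
    rw [hF]
    by_cases hadj : Adj n a c
    · have h0 := (aD_eq_neg_one_iff _ _ _).2 hadj
      exact serre_qb hu (ih1 c hup.color.1 hup.color.2 (path_not_up' he hup hadj)
        (path_not_down' he hup)).symm ih5 ih6 (hy.serre _ _ h0)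
        (hy.serre _ _ (by rwa [aD_symm]))
    · obtain ⟨t2, hup'⟩ := path_branch he hup hadj
      obtain ⟨ih7, ih8⟩ := ih2 c t2 hup'
      exact serre_qb' hu0 hu
        (hy.comm _ _ ((aD_eq_zero_iff _ _ _).2 ⟨path_ne he hup, hadj⟩)) ih6 ih5 ih7 ih8
end RootVec

/-- The strict partial order on the roots of block `i`: all `t' < t`, except that the two middle
roots `[i,n-1]` and `[i,n]` are incomparable. -/
def Pre (n i t' t : ℕ) : Prop := t' < t ∧ ¬ (t' + i + 1 = n ∧ t + i = n)

/-- The reflexive version of `Pre`. -/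
def PreEq (n i t' t : ℕ) : Prop := t' = t ∨ Pre n i t' t

section Combinatorics
variable {n i t0 t c a t' t1 t2 t3 : ℕ}

theorem Pre.trans (h : Pre n i t1 t2) (h' : Pre n i t2 t3) : Pre n i t1 t3 := by
  unfold Pre at *; omega

theorem PreEq.trans_pre (h : PreEq n i t1 t2) (h' : Pre n i t2 t3) : Pre n i t1 t3 := by
  rcases h with rfl | h
  · exact h'
  · exact h.trans h'

theorem PreEq.trans (h : PreEq n i t1 t2) (h' : PreEq n i t2 t3) : PreEq n i t1 t3 := by
  rcases h' with rfl | h'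
  · exact h
  · exact Or.inr (h.trans_pre h')

theorem Up.pre (h : Up n i t c t') : Pre n i t t' := by
  obtain ⟨_, _, h⟩ := h
  unfold Pre
  rcases h with h | h | h | h <;> omega

theorem zero_pre (h : Up n i t c t') : Pre n i 0 t' := by
  obtain ⟨_, _, h⟩ := h
  unfold Pre
  rcases h with h | h | h | h <;> omega

theorem up_mono_up (h : Pre n i t' t) (h1 : Up n i t' c t3) (h2 : Up n i t c t1) :
    Pre n i t3 t1 := by
  obtain ⟨_, _, h1⟩ := h1
  obtain ⟨_, _, h2⟩ := h2
  unfold Pre at *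
  rcases h1 with h1 | h1 | h1 | h1 <;> rcases h2 with h2 | h2 | h2 | h2 <;> omega

theorem up_mono_stop (h : Pre n i t' t) (h1 : Up n i t' c t3)
    (h2 : ∀ t1, ¬ Up n i t c t1) : PreEq n i t3 t := by
  obtain ⟨h3, _, h1⟩ := h1
  have h4 : ¬ (c = n ∧ i + t + 1 = n) := fun h => h2 (t + 2) ⟨h3, by omega, by omega⟩
  have h5 : ¬ (c + 1 = n ∧ i + t = n) := fun h => h2 (t + 1) ⟨h3, by omega, by omega⟩
  unfold PreEq Pre at *
  clear h2
  rcases h1 with h1 | h1 | h1 | h1 <;> omega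

theorem edge_not_up_same (h : Up n i t0 a t) : ¬ Up n i t a t' := by
  intro h'
  obtain ⟨_, _, h⟩ := h
  obtain ⟨_, _, h'⟩ := h'
  rcases h with h | h | h | h <;> rcases h' with h' | h' | h' | h' <;> omega

theorem adj_not_up (he : Edge n i t0 a t) (hadj : Adj n c a) : ¬ Up n i t0 c t2 := by
  intro h
  unfold Adj at hadj
  obtain ⟨⟨_, _, he⟩, _⟩ := he
  obtain ⟨_, _, h⟩ := h
  rcases he with he | he | he | he <;> rcases h with h | h | h | h <;> omega

theorem adj_not_down (he : Edge n i t0 a t) (hadj : Adj n c a) : ¬ Up n i t2 c t := by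
  intro h
  unfold Adj at hadj
  obtain ⟨⟨_, _, he⟩, _⟩ := he
  obtain ⟨_, _, h⟩ := h
  rcases he with he | he | he | he <;> rcases h with h | h | h | h <;> omega

theorem branch_up (he : Edge n i t0 a t) (hup : Up n i t c t') (hadj : ¬ Adj n a c) :
    ∃ t2, Up n i t0 c t2 ∧ Up n i t2 a t' := by
  have hne := path_ne he hup
  unfold Adj at hadj
  obtain ⟨⟨_, _, he⟩, _⟩ := he
  obtain ⟨_, _, hup⟩ := hup
  by_cases hc : c = n
  · refine ⟨t0 + 2, ?_⟩
    unfold Up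
    rcases he with he | he | he | he <;> rcases hup with hup | hup | hup | hup <;> omega
  · refine ⟨t0 + 1, ?_⟩
    unfold Up
    rcases he with he | he | he | he <;> rcases hup with hup | hup | hup | hup <;> omega

theorem up_lt_of_edge (he : Edge n i t0 a t) (h : t' < t0) (h' : Up n i t' a t3) : t3 < t := by
  obtain ⟨⟨_, _, he⟩, _⟩ := he
  obtain ⟨_, _, h'⟩ := h'
  rcases he with he | he | he | he <;> rcases h' with h' | h' | h' | h' <;> omega

theorem up_pre_of_path (he0 : Edge n i t0 a t) (he : Edge n i t c t1) (hadj : Adj n a c)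
    (h : Pre n i t' t1) (h' : Up n i t' a t3) : Pre n i t3 t1 := by
  unfold Adj at hadj
  unfold Pre at *
  obtain ⟨⟨_, _, he⟩, _⟩ := he
  obtain ⟨⟨_, _, he0⟩, _⟩ := he0
  obtain ⟨_, _, h'⟩ := h'
  rcases he0 with he0 | he0 | he0 | he0 <;> rcases he with he | he | he | he <;>
    rcases h' with h' | h' | h' | h' <;> omega

end Combinatorics

section Ideals
variable {K : Type} [Field K] {B : Type} [Ring B] [Algebra K B]

/-- The right ideal generated by a set, as a subspace. -/
def rightIdeal (K : Type) [Field K] {B : Type} [Ring B] [Algebra K B] (S : Set B) :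
    Submodule K B := Submodule.span K {x | ∃ g ∈ S, ∃ b, x = g * b}

theorem mem_rightIdeal {S : Set B} {g : B} (h : g ∈ S) (b : B) : g * b ∈ rightIdeal K S :=
  Submodule.subset_span ⟨g, h, b, rfl⟩

theorem mul_mem_rightIdeal {S : Set B} {x : B} (h : x ∈ rightIdeal K S) (b : B) :
    x * b ∈ rightIdeal K S := by
  induction h using Submodule.span_induction with
  | mem x hx =>
    obtain ⟨g, hg, c, rfl⟩ := hx
    rw [mul_assoc]
    exact mem_rightIdeal hg _
  | zero => rw [zero_mul]; exact Submodule.zero_mem _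
  | add x y _ _ hx hy => rw [add_mul]; exact Submodule.add_mem _ hx hy
  | smul a x _ hx => rw [smul_mul_assoc]; exact Submodule.smul_mem _ _ hx

theorem left_mul_rightIdeal {S S' : Set B} {z : B} (h : ∀ g ∈ S, z * g ∈ rightIdeal K S') {x : B}
    (hx : x ∈ rightIdeal K S) : z * x ∈ rightIdeal K S' := by
  induction hx using Submodule.span_induction with
  | mem x hx =>
    obtain ⟨g, hg, c, rfl⟩ := hx
    rw [← mul_assoc]
    exact mul_mem_rightIdeal (h g hg) _
  | zero => rw [mul_zero]; exact Submodule.zero_mem _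
  | add x y _ _ hx hy => rw [mul_add]; exact Submodule.add_mem _ hx hy
  | smul a x _ hx => rw [mul_smul_comm]; exact Submodule.smul_mem _ _ hx

theorem rightIdeal_mono {S S' : Set B} (h : S ⊆ S') : rightIdeal K S ≤ rightIdeal K S' :=
  Submodule.span_mono fun _ ⟨g, hg, b, hx⟩ => ⟨g, h hg, b, hx⟩

theorem shift_sub_mem {M : Type} [AddCommGroup M] [Module K M] (J : Submodule K M) {p : K}
    (hp : p ≠ 0) {x : ℤ → ℤ → M} (h : ∀ r s, x (r + 1) s - p • x r (s + 1) ∈ J) (r s : ℤ) :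
    x r s - p ^ r • x 0 (s + r) ∈ J := by
  induction r using Int.induction_on generalizing s with
  | zero => simp
  | succ k ih =>
    have h1 := J.add_mem (h k s) (J.smul_mem p (ih (s + 1)))
    have e : s + 1 + (k : ℤ) = s + (k + 1) := by ring
    rw [smul_sub, smul_smul, sub_add_sub_cancel, e, ← zpow_one_add₀ hp, add_comm (1 : ℤ)] at h1
    exact h1
  | pred k ih =>
    have h1 := h (-(k : ℤ) - 1) (s - 1)
    rw [sub_add_cancel, sub_add_cancel] at h1
    have h2 := J.smul_mem p⁻¹ (J.sub_mem (ih (s - 1)) h1)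
    have e : s - 1 + -(k : ℤ) = s + (-k - 1) := by ring
    rw [e, sub_sub_sub_cancel_left, smul_sub, smul_smul, smul_smul, inv_mul_cancel₀ hp, one_smul,
      mul_comm, ← zpow_sub_one₀ hp] at h2
    exact h2

theorem shift_mem {M : Type} [AddCommGroup M] [Module K M] (J J' : Submodule K M) (hJ : J ≤ J')
    {p : K} (hp : p ≠ 0) {x : ℤ → ℤ → M} (h : ∀ r s, x (r + 1) s - p • x r (s + 1) ∈ J)
    (h0 : ∀ s, x 0 s ∈ J') (r s : ℤ) : x r s ∈ J' := by
  have := J'.add_mem (hJ (shift_sub_mem J hp h r s)) (J'.smul_mem (p ^ r) (h0 (s + r)))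
  rwa [sub_add_cancel] at this

/-- If `q` is antisymmetric modulo `J` and depends on `s + t` only, then it vanishes modulo `J`. -/
theorem antisymm_mem {M : Type} [AddCommGroup M] [Module K M] (J : Submodule K M)
    (h2 : (2 : K) ≠ 0) {q : ℤ → ℤ → M} (h : ∀ s t, q s t + q t s ∈ J)
    (h' : ∀ s t, q (s + 1) t - q s (t + 1) ∈ J) (s t : ℤ) : q s t ∈ J := by
  have key := fun r s => shift_sub_mem J (one_ne_zero (α := K)) (x := fun a b => q a b)
    (by simpa using h') r s
  simp only [one_zpow, one_smul] at key
  have k1 := key s t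
  have k2 := key t s
  have h3 := h s t
  rw [add_comm s t] at k2
  have k3 := J.add_mem (J.sub_mem k1 k2) h3
  have : (2 : K) • q s t ∈ J := by
    convert k3 using 1
    module
  exact (J.smul_mem_iff h2).1 this

end Ideals

section LoopVec
variable {K : Type} [Field K] {B : Type} [Ring B] [Algebra K B]

/-- Genericity assumptions on the parameters. -/
structure Generic (v u : K) : Prop where
  v0 : v ≠ 0
  u0 : u ≠ 0
  two : (2 : K) ≠ 0
  usq : u * u + 1 ≠ 0
  sum : u + u⁻¹ = v + v⁻¹

theorem Generic.vsq {v u : K} (h : Generic v u) : v * v + 1 ≠ 0 := by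
  intro h'
  have h1 := h.sum
  have hu := h.u0
  have hv := h.v0
  field_simp at h1
  apply h.usq
  have : (u * u + 1) * v = 0 := by linear_combination h1 + u * h'
  exact (mul_eq_zero.1 this).resolve_right hv

/-- The iterated `u`-commutator along the Lyndon word of `(i,t)`, with first letter replaced
by `x`. -/
def vecFrom (u : K) (y : ℕ → B) (n i t : ℕ) (x : B) : B :=
  ((wordN n i t).tail.map y).foldl (qb u) x

theorem vecFrom_zero (u : K) (y : ℕ → B) {n i : ℕ} (h : i ≤ n) (x : B) :
    vecFrom u y n i 0 x = x := by
  simp [vecFrom, wordN_zero h]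

theorem vecFrom_edge (u : K) (y : ℕ → B) {n i t c t' : ℕ} (hi : 1 ≤ i) (h : Edge n i t c t')
    (x : B) : vecFrom u y n i t' x = qb u (vecFrom u y n i t x) (y c) := by
  unfold vecFrom
  rw [wordN_edge h, List.tail_append_of_ne_nil (wordN_ne_nil (h.1.rootIdx hi)), List.map_append,
    List.foldl_append]
  simp

theorem foldl_qb_add (u : K) (l : List B) (x x' : B) :
    l.foldl (qb u) (x + x') = l.foldl (qb u) x + l.foldl (qb u) x' := by
  induction l generalizing x x' with
  | nil => rfl
  | cons a l ih =>
    rw [List.foldl_cons, List.foldl_cons, List.foldl_cons, ← ih]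
    congr 1
    simp only [qb, add_mul, mul_add, smul_add]
    abel

theorem vecFrom_add (u : K) (y : ℕ → B) (n i t : ℕ) (x x' : B) :
    vecFrom u y n i t (x + x') = vecFrom u y n i t x + vecFrom u y n i t x' :=
  foldl_qb_add u _ x x'

theorem edge_induction {n i : ℕ} (hi : 1 ≤ i) {P : ℕ → Prop} (h0 : P 0)
    (h : ∀ t0 c t, Edge n i t0 c t → P t0 → P t) (t : ℕ) (ht : RootIdx n i t) : P t := by
  induction t using Nat.strong_induction_on with
  | _ t ih =>
    by_cases ht0 : t = 0
    · exact ht0 ▸ h0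
    · obtain ⟨t0, a, he⟩ := exists_edge ht ht0
      exact h _ _ _ he (ih t0 he.1.lt (he.1.rootIdx hi))

theorem lt_of_mem_tail {n i : ℕ} (hi : 1 ≤ i) (hin : i ≤ n) (t : ℕ) (ht : RootIdx n i t) :
    ∀ c ∈ (wordN n i t).tail, i < c := by
  refine edge_induction hi (P := fun t => ∀ c ∈ (wordN n i t).tail, i < c) ?_ ?_ t ht
  · simp [wordN_zero hin]
  · intro t0 c t he ih d hd
    rw [wordN_edge he, List.tail_append_of_ne_nil (wordN_ne_nil (he.1.rootIdx hi)),
      List.mem_append, List.mem_singleton] at hd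
    rcases hd with hd | rfl
    · exact ih d hd
    · exact he.1.color.1

theorem vecFrom_congr (u : K) {y y' : ℕ → B} {n i t : ℕ}
    (h : ∀ c ∈ (wordN n i t).tail, y c = y' c) (x : B) :
    vecFrom u y n i t x = vecFrom u y' n i t x := by
  unfold vecFrom
  rw [List.map_congr_left h]

theorem rootVec_update (u : K) (y : ℕ → B) {n i t : ℕ} (hi : 1 ≤ i) (ht : RootIdx n i t) (x : B) :
    rootVec u (Function.update y i x) n i t = vecFrom u y n i t x := by
  show vecFrom u (Function.update y i x) n i t (Function.update y i x i) = _
  rw [Function.update_self]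
  apply vecFrom_congr
  intro c hc
  exact Function.update_of_ne (lt_of_mem_tail hi ht.2.1 t ht c hc).ne' _ _

variable {v u : K} {n : ℕ} {e : ℕ → ℤ → B}

/-- Each `y c` being a combination of the `e c r`, the family `y` satisfies the finite type
relations. -/
theorem finRel_of_mem_span (h : LoopRel v n e) (hg : Generic v u) {y : ℕ → B}
    (hy : ∀ c, y c ∈ Submodule.span K (Set.range (e c))) : FinRel u n y where
  comm i j hij := by
    obtain ⟨hne, _⟩ := (aD_eq_zero_iff _ _ _).1 hij
    have h1 : ∀ r, ∀ x ∈ Submodule.span K (Set.range (e j)), Commute (e i r) x := by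
      intro r x hx
      induction hx using Submodule.span_induction with
      | mem x hx => obtain ⟨s, rfl⟩ := hx; exact h.comm i j r s hne hij
      | zero => exact Commute.zero_right _
      | add x x' _ _ hx hx' => exact hx.add_right hx'
      | smul a x _ hx => exact hx.smul_right a
    have h2 : ∀ x ∈ Submodule.span K (Set.range (e i)), Commute x (y j) := by
      intro x hx
      induction hx using Submodule.span_induction with
      | mem x hx => obtain ⟨s, rfl⟩ := hx; exact h1 s _ (hy j)
      | zero => exact Commute.zero_left _
      | add x x' _ _ hx hx' => exact hx.add_left hx'
      | smul a x _ hx => exact hx.smul_left a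
    exact h2 _ (hy i)
  serre i j hij := by
    let P : B → B → B → Prop := fun a b x =>
      (a * b + b * a) * x - (v + v⁻¹) • (a * x * b + b * x * a) + x * (a * b + b * a) = 0
    have h1 : ∀ x ∈ Submodule.span K (Set.range (e j)), ∀ r s, P (e i r) (e i s) x := by
      intro x hx r s
      induction hx using Submodule.span_induction with
      | mem x hx => obtain ⟨t, rfl⟩ := hx; exact h.serre i j r s t hij
      | zero => simp [P]
      | add x x' _ _ hx hx' =>
        simp only [P, mul_add, add_mul, smul_add] at hx hx' ⊢
        linear_combination (norm := module) hx + hx'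
      | smul a x _ hx =>
        simp only [P, mul_add, add_mul, smul_add, smul_mul_assoc, mul_smul_comm] at hx ⊢
        linear_combination (norm := module) a • hx
    have h2 : ∀ b ∈ Submodule.span K (Set.range (e i)), ∀ r, P (e i r) b (y j) := by
      intro x hx r
      induction hx using Submodule.span_induction with
      | mem x hx => obtain ⟨t, rfl⟩ := hx; exact h1 _ (hy j) _ _
      | zero => simp [P]
      | add x x' _ _ hx hx' =>
        simp only [P, mul_add, add_mul, smul_add] at hx hx' ⊢
        linear_combination (norm := module) hx + hx'
      | smul a x _ hx =>
        simp only [P, mul_add, add_mul, smul_add, smul_mul_assoc, mul_smul_comm] at hx ⊢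
        linear_combination (norm := module) a • hx
    have h3 : ∀ a ∈ Submodule.span K (Set.range (e i)), P a (y i) (y j) := by
      intro x hx
      induction hx using Submodule.span_induction with
      | mem x hx => obtain ⟨t, rfl⟩ := hx; exact h2 _ (hy i) _
      | zero => simp [P]
      | add x x' _ _ hx hx' =>
        simp only [P, mul_add, add_mul, smul_add] at hx hx' ⊢
        linear_combination (norm := module) hx + hx'
      | smul a x _ hx =>
        simp only [P, mul_add, add_mul, smul_add, smul_mul_assoc, mul_smul_comm] at hx ⊢
        linear_combination (norm := module) a • hx
    have h4 := h3 _ (hy i)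
    have hsum : u * (v + v⁻¹) = u * u + 1 := by
      rw [← hg.sum, mul_add, mul_inv_cancel₀ hg.u0]
    apply smul_right_injective B hg.two
    simp only [P, mul_add, add_mul, smul_add, mul_assoc] at h4 ⊢
    rw [← hsum]
    linear_combination (norm := module) u • h4

/-- The root vector with loop degree `s` carried by its first letter. -/
def loopVec (u : K) (e : ℕ → ℤ → B) (n i t : ℕ) (s : ℤ) : B :=
  vecFrom u (fun c => e c 0) n i t (e i s)

theorem finRel_update (h : LoopRel v n e) (hg : Generic v u) {i : ℕ} {x : B}
    (hx : x ∈ Submodule.span K (Set.range (e i))) {y : ℕ → B}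
    (hy : ∀ c, y c ∈ Submodule.span K (Set.range (e c))) :
    FinRel u n (Function.update y i x) := by
  apply finRel_of_mem_span h hg
  intro c
  by_cases hc : c = i
  · subst hc; rwa [Function.update_self]
  · rw [Function.update_of_ne hc]
    exact hy c

theorem mem_span_range (e : ℕ → ℤ → B) (c : ℕ) (r : ℤ) :
    e c r ∈ Submodule.span K (Set.range (e c)) := Submodule.subset_span ⟨r, rfl⟩

/-- The right ideal generated by the root vectors of block `i` whose index satisfies `P`. -/
def blockIdeal (u : K) (e : ℕ → ℤ → B) (n i : ℕ) (P : ℕ → Prop) : Submodule K B :=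
  rightIdeal K {x | ∃ t s, P t ∧ RootIdx n i t ∧ x = loopVec u e n i t s}

theorem blockIdeal_mono {i : ℕ} {P Q : ℕ → Prop} (h : ∀ t, RootIdx n i t → P t → Q t) :
    blockIdeal u e n i P ≤ blockIdeal u e n i Q := by
  refine rightIdeal_mono ?_
  rintro _ ⟨t, s, h1, h2, rfl⟩
  exact ⟨t, s, h t h2 h1, h2, rfl⟩

theorem loopVec_mul_mem {i t : ℕ} {P : ℕ → Prop} (ht : RootIdx n i t) (hP : P t) (s : ℤ) (b : B) :
    loopVec u e n i t s * b ∈ blockIdeal u e n i P :=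
  mem_rightIdeal (S := {x | ∃ t s, P t ∧ RootIdx n i t ∧ x = loopVec u e n i t s})
    ⟨t, s, hP, ht, rfl⟩ b

theorem loopVec_mem {i t : ℕ} {P : ℕ → Prop} (ht : RootIdx n i t) (hP : P t) (s : ℤ) :
    loopVec u e n i t s ∈ blockIdeal u e n i P := by
  simpa using loopVec_mul_mem (u := u) (e := e) (P := P) ht hP s 1

theorem blockIdeal_mul_mem {i : ℕ} {P : ℕ → Prop} {x : B} (h : x ∈ blockIdeal u e n i P) (b : B) :
    x * b ∈ blockIdeal u e n i P := mul_mem_rightIdeal h b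

variable {i : ℕ}

theorem loopVec_up (h : LoopRel v n e) (hg : Generic v u) (hi : 1 ≤ i) {t c t1 : ℕ}
    (hup : Up n i t c t1) (s : ℤ) :
    loopVec u e n i t1 s = qb u (loopVec u e n i t s) (e c 0) := by
  unfold loopVec
  have hy : FinRel u n (Function.update (fun c => e c 0) i (e i s)) :=
    finRel_update h hg (mem_span_range e i s) fun c => mem_span_range e c 0
  rw [← rootVec_update u _ hi (hup.rootIdx hi), ← rootVec_update u _ hi (hup.rootIdx' hi),
    rootVec_up hy hi hup, Function.update_of_ne hup.color.1.ne']

theorem loopVec_commute (h : LoopRel v n e) (hg : Generic v u) (hi : 1 ≤ i) {t c : ℕ}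
    (ht : RootIdx n i t) (hc : i < c) (hc' : c ≤ n) (h1 : ∀ t', ¬ Up n i t c t')
    (h2 : ∀ t', ¬ Up n i t' c t) (s : ℤ) : Commute (e c 0) (loopVec u e n i t s) := by
  unfold loopVec
  have hy : FinRel u n (Function.update (fun c => e c 0) i (e i s)) :=
    finRel_update h hg (mem_span_range e i s) fun c => mem_span_range e c 0
  have := (rootVec_finite hg.u0 hg.usq hy hi t ht).1 c hc hc' h1 h2
  rwa [rootVec_update u _ hi ht, Function.update_of_ne hc.ne'] at this

theorem vecFrom_ser (h : LoopRel v n e) (hg : Generic v u) (hi : 1 ≤ i) {t c t1 : ℕ}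
    (hup : Up n i t c t1) {y : ℕ → B} (hy : ∀ c, y c ∈ Submodule.span K (Set.range (e c)))
    {x : B} (hx : x ∈ Submodule.span K (Set.range (e i))) :
    Ser u (vecFrom u y n i t x) (y c) ∧ Ser u (y c) (vecFrom u y n i t x) := by
  have := (rootVec_finite hg.u0 hg.usq (finRel_update h hg hx hy) hi t (hup.rootIdx hi)).2 c t1 hup
  rwa [rootVec_update u _ hi (hup.rootIdx hi), Function.update_of_ne hup.color.1.ne'] at this

theorem up_mem (h : LoopRel v n e) (hg : Generic v u) (hi : 1 ≤ i) {t c t1 : ℕ}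
    (hup : Up n i t c t1) (s : ℤ) :
    e c 0 * loopVec u e n i t s ∈ blockIdeal u e n i (PreEq n i · t1) := by
  have h1 := loopVec_up h hg hi hup s
  have h2 : loopVec u e n i t1 s ∈ blockIdeal u e n i (PreEq n i · t1) :=
    loopVec_mem (hup.rootIdx' hi) (Or.inl rfl) s
  have h3 : loopVec u e n i t s * e c 0 ∈ blockIdeal u e n i (PreEq n i · t1) :=
    loopVec_mul_mem (hup.rootIdx hi) (Or.inr hup.pre) s _
  rw [← Submodule.smul_mem_iff _ hg.u0]
  have := Submodule.sub_mem _ h3 h2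
  rwa [h1, qb, sub_sub_cancel] at this

/-- How left multiplication by the `e c r` acts on the root vector `(i,t)`. -/
def LeftAct (u : K) (e : ℕ → ℤ → B) (n i t : ℕ) : Prop :=
  ∀ c, i < c → c ≤ n →
    ((∀ t1, ¬ Up n i t c t1) → ∀ r s,
      e c r * loopVec u e n i t s ∈ blockIdeal u e n i (PreEq n i · t)) ∧
    (∀ t1, Up n i t c t1 →
      (∀ r s, e c r * loopVec u e n i t s ∈ blockIdeal u e n i (PreEq n i · t1)) ∧
      ∃ p : K, p ≠ 0 ∧ ∀ r s, e c (r + 1) * loopVec u e n i t s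
        - p • (e c r * loopVec u e n i t (s + 1)) ∈ blockIdeal u e n i (Pre n i · t1))

theorem LeftAct.mul_mem {P Q : ℕ → Prop} {c : ℕ} (hc : i < c) (hc' : c ≤ n)
    (h : ∀ t, RootIdx n i t → P t → LeftAct u e n i t ∧
      (∀ t1, Up n i t c t1 → ∀ t2, PreEq n i t2 t1 → Q t2) ∧
      ((∀ t1, ¬ Up n i t c t1) → ∀ t2, PreEq n i t2 t → Q t2)) (r : ℤ) {x : B}
    (hx : x ∈ blockIdeal u e n i P) : e c r * x ∈ blockIdeal u e n i Q := by
  refine left_mul_rightIdeal ?_ hx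
  rintro _ ⟨t, s, hP, ht, rfl⟩
  obtain ⟨h1, h2, h3⟩ := h t ht hP
  by_cases hup : ∃ t1, Up n i t c t1
  · obtain ⟨t1, hup⟩ := hup
    exact blockIdeal_mono (fun t2 _ => h2 t1 hup t2) (((h1 c hc hc').2 t1 hup).1 r s)
  · rw [not_exists] at hup
    exact blockIdeal_mono (fun t2 _ => h3 hup t2) ((h1 c hc hc').1 hup r s)

theorem mul_mem_of_up {t c t1 : ℕ} (hup : Up n i t c t1)
    (h : ∀ t', RootIdx n i t' → Pre n i t' t → LeftAct u e n i t') (r : ℤ) {x : B}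
    (hx : x ∈ blockIdeal u e n i (Pre n i · t)) :
    e c r * x ∈ blockIdeal u e n i (Pre n i · t1) := by
  refine LeftAct.mul_mem hup.color.1 hup.color.2 (fun t' ht' hP => ⟨h t' ht' hP, ?_, ?_⟩) r hx
  · intro t3 h3 t2 h2
    exact h2.trans_pre (up_mono_up hP h3 hup)
  · intro _ t2 h2
    exact (h2.trans_pre hP).trans hup.pre

theorem mul_mem_of_up' {t c t1 : ℕ} (hup : Up n i t c t1)
    (h : ∀ t', RootIdx n i t' → PreEq n i t' t → LeftAct u e n i t') (r : ℤ) {x : B}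
    (hx : x ∈ blockIdeal u e n i (PreEq n i · t)) :
    e c r * x ∈ blockIdeal u e n i (PreEq n i · t1) := by
  refine LeftAct.mul_mem hup.color.1 hup.color.2 (fun t' ht' hP => ⟨h t' ht' hP, ?_, ?_⟩) r hx
  · intro t3 h3 t2 h2
    rcases hP with rfl | hP
    · have : t3 = t1 := by unfold Up at h3 hup; omega
      exact this ▸ h2
    · exact Or.inr (h2.trans_pre (up_mono_up hP h3 hup))
  · intro _ t2 h2
    exact Or.inr ((h2.trans hP).trans_pre hup.pre)

theorem mul_mem_of_stop {t c : ℕ} (hc : i < c) (hc' : c ≤ n)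
    (hst : ∀ t1, ¬ Up n i t c t1)
    (h : ∀ t', RootIdx n i t' → Pre n i t' t → LeftAct u e n i t') (r : ℤ) {x : B}
    (hx : x ∈ blockIdeal u e n i (Pre n i · t)) :
    e c r * x ∈ blockIdeal u e n i (PreEq n i · t) := by
  refine LeftAct.mul_mem hc hc' (fun t' ht' hP => ⟨h t' ht' hP, ?_, ?_⟩) r hx
  · intro t3 h3 t2 h2
    exact h2.trans (up_mono_stop hP h3 hst)
  · intro _ t2 h2
    exact Or.inr (h2.trans_pre hP)

theorem mul_mem_of_stop' {t c : ℕ} (hc : i < c) (hc' : c ≤ n)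
    (hst : ∀ t1, ¬ Up n i t c t1)
    (h : ∀ t', RootIdx n i t' → PreEq n i t' t → LeftAct u e n i t') (r : ℤ) {x : B}
    (hx : x ∈ blockIdeal u e n i (PreEq n i · t)) :
    e c r * x ∈ blockIdeal u e n i (PreEq n i · t) := by
  refine LeftAct.mul_mem hc hc' (fun t' ht' hP => ⟨h t' ht' hP, ?_, ?_⟩) r hx
  · intro t3 h3 t2 h2
    rcases hP with rfl | hP
    · exact absurd h3 (hst t3)
    · exact h2.trans (up_mono_stop hP h3 hst)
  · intro _ t2 h2
    exact h2.trans hP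

end LoopVec

section LeftAction
variable {K : Type} [Field K] {B : Type} [Ring B] [Algebra K B]
variable {v u : K} {n : ℕ} {e : ℕ → ℤ → B} {i : ℕ}

theorem mem_iff_mkQ {M : Type} [AddCommGroup M] [Module K M] (J : Submodule K M) (x : M) :
    x ∈ J ↔ J.mkQ x = 0 := by simp

theorem pre_le_preEq {t : ℕ} :
    blockIdeal u e n i (Pre n i · t) ≤ blockIdeal u e n i (PreEq n i · t) :=
  blockIdeal_mono fun _ _ h => Or.inr h

theorem preEq_le_pre {t t1 : ℕ} (h : Pre n i t t1) :
    blockIdeal u e n i (PreEq n i · t) ≤ blockIdeal u e n i (Pre n i · t1) :=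
  blockIdeal_mono fun _ _ h' => h'.trans_pre h

theorem pre_le_pre {t t1 : ℕ} (h : Pre n i t t1) :
    blockIdeal u e n i (Pre n i · t) ≤ blockIdeal u e n i (Pre n i · t1) :=
  blockIdeal_mono fun _ _ h' => h'.trans h

theorem leftAct_zero (h : LoopRel v n e) (hg : Generic v u) (hi : 1 ≤ i) (hin : i ≤ n) :
    LeftAct u e n i 0 := by
  have h00 : RootIdx n i 0 := ⟨hi, hin, Or.inl rfl⟩
  have hE : ∀ s, loopVec u e n i 0 s = e i s := fun s => vecFrom_zero _ _ hin _
  intro c hc hc'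
  constructor
  · intro hst r s
    have a1 := hst 1
    have a2 := hst 2
    rw [hE, h.comm c i r s hc.ne' ((aD_eq_zero_iff _ _ _).2 ⟨hc.ne', by
      unfold Adj; unfold Up at a1 a2; omega⟩), ← hE]
    exact loopVec_mul_mem h00 (Or.inl rfl) s _
  · intro t1 hup
    have hadj : aD n c i = -1 := by
      rw [aD_eq_neg_one_iff]; unfold Adj; unfold Up at hup; omega
    have hd : ∀ r s, e c (r + 1) * loopVec u e n i 0 s
        - v⁻¹ • (e c r * loopVec u e n i 0 (s + 1)) ∈ blockIdeal u e n i (Pre n i · t1) := by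
      intro r s
      have := h.loop c i r s
      rw [hadj, zpow_neg_one] at this
      rw [hE, hE, this, ← hE, ← hE]
      have hm := fun s b => loopVec_mul_mem (u := u) (e := e) (P := (Pre n i · t1)) h00
        (zero_pre hup) s b
      exact Submodule.sub_mem _ (Submodule.smul_mem _ _ (hm _ _)) (hm _ _)
    exact ⟨shift_mem _ _ pre_le_preEq (inv_ne_zero hg.v0) hd (up_mem h hg hi hup), _,
      inv_ne_zero hg.v0, hd⟩

theorem mul_mem_same (h : LoopRel v n e) (hg : Generic v u) (hi : 1 ≤ i) {t0 a t : ℕ}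
    (he : Edge n i t0 a t) (hV : ∀ t', t' < t → RootIdx n i t' → LeftAct u e n i t') (r s : ℤ) :
    e a r * loopVec u e n i t s ∈ blockIdeal u e n i (PreEq n i · t) := by
  obtain ⟨hc, hc'⟩ := he.1.color
  have ht0 := he.1.rootIdx hi
  obtain ⟨hm, p, hp, hd⟩ := (hV t0 he.1.lt ht0 a hc hc').2 t he.1
  set J := blockIdeal u e n i (PreEq n i · t) with hJ
  set F := loopVec u e n i t0 with hF
  have hFJ : ∀ s b, F s * b ∈ J := fun s b => loopVec_mul_mem ht0 (Or.inr he.1.pre) s b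
  have kst : ∀ r, ∀ x ∈ blockIdeal u e n i (Pre n i · t), e a r * x ∈ J := fun r x hx =>
    mul_mem_of_stop hc hc' (fun t1 => edge_not_up_same he.1) (fun t' ht' hP => hV t' hP.1 ht') r hx
  have h0 : ∀ s, e a 0 * (e a 0 * F s) ∈ J := by
    intro s
    have hs := congrArg J.mkQ (vecFrom_ser h hg hi he.1 (fun c => mem_span_range e c 0)
      (mem_span_range e i s)).2
    have k1 := (mem_iff_mkQ J _).1 (hFJ s (e a 0 * e a 0))
    have k2 := (mem_iff_mkQ J _).1 (blockIdeal_mul_mem (hm 0 s) (e a 0))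
    change J.mkQ (u • (e a 0 * (e a 0 * F s) + F s * (e a 0 * e a 0))) =
      J.mkQ ((u * u + 1) • (e a 0 * (F s * e a 0))) at hs
    rw [← J.smul_mem_iff hg.u0, mem_iff_mkQ]
    simp only [map_smul, map_add, mul_assoc] at hs k1 k2 ⊢
    linear_combination (norm := module) hs - u • k1 + (u * u + 1) • k2
  have hsh := shift_sub_mem _ hp (x := fun r s => e a r * F s) hd
  have rel : ∀ r s, e a (r + 1) * (e a 0 * F s) - (v ^ (2 : ℤ) * p) • (e a r * (e a 0 * F (s + 1)))
      + p ^ r • (e a 1 * (e a 0 * F (s + r))) ∈ J := by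
    intro r s
    have hl := congrArg J.mkQ (congrArg (· * F s) (h.loop a a r 0))
    have a1 := (mem_iff_mkQ J _).1 (kst r _ (hd 0 s))
    have a2 := (mem_iff_mkQ J _).1 (kst 0 _ (hsh (r + 1) s))
    have a3 := (mem_iff_mkQ J _).1 (h0 (s + (r + 1)))
    have a4 := (mem_iff_mkQ J _).1 (kst 1 _ (hsh r s))
    rw [mem_iff_mkQ]
    simp only [aD_self, zero_add, sub_mul, mul_sub, mul_assoc, smul_mul_assoc, mul_smul_comm,
      map_sub, map_add, map_smul] at hl a1 a2 a3 a4 ⊢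
    linear_combination (norm := module) hl + (v ^ (2 : ℤ)) • a1 + (v ^ (2 : ℤ)) • a2
      + (v ^ (2 : ℤ) * p ^ (r + 1)) • a3 - a4
  have h1 : ∀ s, e a 1 * (e a 0 * F s) ∈ J := by
    intro s
    have k1 := (mem_iff_mkQ J _).1 (rel 0 s)
    have k2 := (mem_iff_mkQ J _).1 (h0 (s + 1))
    rw [← J.smul_mem_iff hg.two, mem_iff_mkQ]
    simp only [zero_add, add_zero, zpow_zero, map_sub, map_add, map_smul] at k1 k2 ⊢
    linear_combination (norm := module) k1 + (v ^ (2 : ℤ) * p) • k2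
  have hx := shift_mem J J le_rfl (mul_ne_zero (zpow_ne_zero 2 hg.v0) hp)
    (x := fun r s => e a r * (e a 0 * F s))
    (fun r s => by
      have := J.sub_mem (rel r s) (J.smul_mem (p ^ r) (h1 (s + r)))
      rwa [add_sub_cancel_right] at this) h0 r s
  have hE : loopVec u e n i t s = qb u (F s) (e a 0) := loopVec_up h hg hi he.1 s
  rw [hE, qb, mul_sub, mul_smul_comm, ← mul_assoc]
  exact J.sub_mem (blockIdeal_mul_mem (hm r s) _) (J.smul_mem _ hx)

theorem branch_lt {t0 c a t t2 t1 t' : ℕ} (he : Edge n i t0 a t) (h1 : Up n i t0 c t2)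
    (h2 : Up n i t2 a t1) (h : Pre n i t' t2) : t' < t := by
  unfold Pre at h
  obtain ⟨⟨_, _, he⟩, _⟩ := he
  obtain ⟨_, _, h1⟩ := h1
  obtain ⟨_, _, h2⟩ := h2
  rcases he with he | he | he | he <;> rcases h1 with h1 | h1 | h1 | h1 <;>
    rcases h2 with h2 | h2 | h2 | h2 <;> omega

theorem leftAct (h : LoopRel v n e) (hg : Generic v u) (hi : 1 ≤ i) (t : ℕ)
    (ht : RootIdx n i t) : LeftAct u e n i t := by
  induction t using Nat.strong_induction_on with
  | _ t ih =>
  by_cases ht0 : t = 0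
  · subst ht0; exact leftAct_zero h hg hi ht.2.1
  obtain ⟨t0, a, he⟩ := exists_edge ht ht0
  have hr0 := he.1.rootIdx hi
  have hV0 := ih t0 he.1.lt hr0
  obtain ⟨ha, ha'⟩ := he.1.color
  have hE : ∀ s, loopVec u e n i t s = qb u (loopVec u e n i t0 s) (e a 0) :=
    loopVec_up h hg hi he.1
  set F := loopVec u e n i t0 with hF
  intro c hc hc'
  by_cases hca : c = a
  · subst hca
    exact ⟨fun _ => mul_mem_same h hg hi he ih, fun t1 hup => absurd hup (edge_not_up_same he.1)⟩
  by_cases hadj : Adj n c a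
  · have hst0 : ∀ t2, ¬ Up n i t0 c t2 := fun t2 => adj_not_up he hadj
    have hcF := (hV0 c hc hc').1 hst0
    obtain ⟨hm, p, hp, hd⟩ := (hV0 a ha ha').2 t he.1
    have haD : aD n c a = -1 := (aD_eq_neg_one_iff _ _ _).2 hadj
    have key : ∀ J : Submodule K B, blockIdeal u e n i (PreEq n i · t) ≤ J →
        (∀ r, ∀ x ∈ blockIdeal u e n i (Pre n i · t), e c r * x ∈ J) → ∀ r s,
        e c (r + 1) * loopVec u e n i t s
          - (v⁻¹ * p) • (e c r * loopVec u e n i t (s + 1)) ∈ J := by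
      intro J hJ hJ' r s
      have hl := congrArg J.mkQ (congrArg (· * F s) (h.loop c a r 0))
      have b1 : ∀ r s, J.mkQ (e c r * F s * e a 0) = 0 := fun r s => (mem_iff_mkQ J _).1
        (hJ (pre_le_preEq (blockIdeal_mul_mem (preEq_le_pre he.1.pre (hcF r s)) _)))
      have b2 : ∀ q r s, J.mkQ (e a q * (e c r * F s)) = 0 := fun q r s => (mem_iff_mkQ J _).1
        (hJ (mul_mem_of_up' he.1 (fun t' ht' hP => by
          rcases hP with rfl | hP
          · exact hV0
          · exact ih t' (hP.1.trans he.1.lt) ht') q (hcF r s)))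
      have b3 := (mem_iff_mkQ J _).1 (hJ' r _ (hd 0 s))
      have c1 := b1 (r + 1) s
      have c2 := b1 r (s + 1)
      have c3 := b2 0 (r + 1) s
      have c4 := b2 1 r s
      rw [mem_iff_mkQ, hE, hE]
      simp only [haD, qb, zero_add, sub_mul, mul_sub, mul_assoc, smul_mul_assoc, mul_smul_comm,
        map_sub, map_smul, zpow_neg_one] at hl b3 c1 c2 c3 c4 ⊢
      linear_combination (norm := module) -u • hl + c1 - (v⁻¹ * p) • c2 - (u * v⁻¹) • c3 + u • c4
        - (u * v⁻¹) • b3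
    constructor
    · intro hst r s
      refine shift_mem _ _ le_rfl (mul_ne_zero (inv_ne_zero hg.v0) hp)
        (x := fun r s => e c r * loopVec u e n i t s) (key _ le_rfl ?_) ?_ r s
      · exact fun r x hx => mul_mem_of_stop hc hc' hst (fun t' ht' hP => ih t' hP.1 ht') r hx
      · intro s
        rw [(loopVec_commute h hg hi ht hc hc' hst (fun t' => adj_not_down he hadj) s).eq]
        exact loopVec_mul_mem ht (Or.inl rfl) s _
    · intro t1 hup
      have hd' := key (blockIdeal u e n i (Pre n i · t1)) (preEq_le_pre hup.pre)
        (fun r x hx => mul_mem_of_up hup (fun t' ht' hP => ih t' hP.1 ht') r hx)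
      exact ⟨shift_mem _ _ pre_le_preEq (mul_ne_zero (inv_ne_zero hg.v0) hp) hd'
        (up_mem h hg hi hup), _, mul_ne_zero (inv_ne_zero hg.v0) hp, hd'⟩
  have hcomm : ∀ r, e c r * e a 0 = e a 0 * e c r := fun r =>
    h.comm c a r 0 hca ((aD_eq_zero_iff _ _ _).2 ⟨hca, hadj⟩)
  have hcE : ∀ r s, e c r * loopVec u e n i t s
      = e c r * F s * e a 0 - u • (e a 0 * (e c r * F s)) := by
    intro r s
    rw [hE, qb, mul_sub, mul_smul_comm, ← mul_assoc, ← mul_assoc (e c r), hcomm, mul_assoc (e a 0)]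
  constructor
  · intro hst r s
    have hst0 : ∀ t2, ¬ Up n i t0 c t2 := fun t2 => edge_comm_up he hca hadj hst
    have hcF := (hV0 c hc hc').1 hst0 r s
    rw [hcE]
    refine Submodule.sub_mem _ (pre_le_preEq (blockIdeal_mul_mem (preEq_le_pre he.1.pre hcF) _))
      (Submodule.smul_mem _ _ (mul_mem_of_up' he.1 (fun t' ht' hP => ?_) 0 hcF))
    rcases hP with rfl | hP
    · exact hV0
    · exact ih t' (hP.1.trans he.1.lt) ht'
  · intro t1 hup
    obtain ⟨t2, hup0, hup2⟩ := branch_up he hup fun h' => hadj (by unfold Adj at *; omega)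
    obtain ⟨hm, p, hp, hd⟩ := (hV0 c hc hc').2 t2 hup0
    have hd' : ∀ r s, e c (r + 1) * loopVec u e n i t s
        - p • (e c r * loopVec u e n i t (s + 1)) ∈ blockIdeal u e n i (Pre n i · t1) := by
      intro r s
      have e1 : e c (r + 1) * loopVec u e n i t s - p • (e c r * loopVec u e n i t (s + 1))
          = (e c (r + 1) * F s - p • (e c r * F (s + 1))) * e a 0
            - u • (e a 0 * (e c (r + 1) * F s - p • (e c r * F (s + 1)))) := by
        rw [hcE, hcE]
        simp only [sub_mul, mul_sub, smul_mul_assoc, mul_smul_comm]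
        module
      rw [e1]
      exact Submodule.sub_mem _ (blockIdeal_mul_mem (pre_le_pre hup2.pre (hd r s)) _)
        (Submodule.smul_mem _ _ (mul_mem_of_up hup2
          (fun t' ht' hP => ih t' (branch_lt he hup0 hup2 hP) ht') 0 (hd r s)))
    exact ⟨shift_mem _ _ pre_le_preEq hp hd' (up_mem h hg hi hup), p, hp, hd'⟩

end LeftAction

section Products
variable {K : Type} [Field K] {B : Type} [Ring B] [Algebra K B]
variable {v u : K} {n : ℕ} {e : ℕ → ℤ → B} {i : ℕ}

theorem mul_congr_of_edge (h : LoopRel v n e) (hg : Generic v u) (hi : 1 ≤ i) {t0 a t : ℕ}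
    (he : Edge n i t0 a t)
    (hA : ∀ s s', e a 0 * (loopVec u e n i t0 s * loopVec u e n i t0 s')
      ∈ blockIdeal u e n i (Pre n i · t)) (s s' : ℤ) :
    loopVec u e n i t s * loopVec u e n i t s' - (u * u * u / (u * u + 1)) •
      (e a 0 * (e a 0 * (loopVec u e n i t0 s * loopVec u e n i t0 s')))
      ∈ blockIdeal u e n i (Pre n i · t) := by
  set J := blockIdeal u e n i (Pre n i · t) with hJ
  have hE : ∀ s, loopVec u e n i t s = qb u (loopVec u e n i t0 s) (e a 0) :=
    loopVec_up h hg hi he.1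
  have hFJ : ∀ b, loopVec u e n i t0 s * b ∈ J := fun b =>
    loopVec_mul_mem (he.1.rootIdx hi) he.1.pre s b
  have hs := congrArg J.mkQ (congrArg (· * loopVec u e n i t0 s')
    (vecFrom_ser h hg hi he.1 (fun c => mem_span_range e c 0) (mem_span_range e i s)).2)
  change J.mkQ (u • (e a 0 * (e a 0 * loopVec u e n i t0 s) +
    loopVec u e n i t0 s * (e a 0 * e a 0)) * loopVec u e n i t0 s') =
      J.mkQ ((u * u + 1) • (e a 0 * (loopVec u e n i t0 s * e a 0)) * loopVec u e n i t0 s') at hs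
  set F := loopVec u e n i t0 s
  set G := loopVec u e n i t0 s'
  have c1 := (mem_iff_mkQ J _).1 (hFJ (e a 0 * (G * e a 0)))
  have c2 := (mem_iff_mkQ J _).1 (hFJ (e a 0 * (e a 0 * G)))
  have c3 := (mem_iff_mkQ J _).1 (blockIdeal_mul_mem (hA s s') (e a 0))
  rw [← J.smul_mem_iff hg.usq, mem_iff_mkQ, smul_sub, smul_smul, mul_div_cancel₀ _ hg.usq, hE, hE]
  simp only [qb, sub_mul, mul_sub, add_mul, mul_assoc, smul_mul_assoc, mul_smul_comm, map_sub,
    map_smul, map_add] at hs c1 c2 c3 ⊢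
  linear_combination (norm := module) -(u * u) • hs + (u * u + 1) • c1 - u • c2
    - (u * (u * u + 1)) • c3

theorem edge_cases_of_not_adj {t0 a t c t1 : ℕ} (he0 : Edge n i t0 a t) (he : Edge n i t c t1)
    (hadj : ¬ Adj n a c) :
    i + t0 + 2 = n ∧ a = n ∧ t = t0 + 2 ∧ c + 1 = n ∧ t1 = t0 + 3 := by
  unfold Adj at hadj
  obtain ⟨⟨_, _, he0⟩, _⟩ := he0
  obtain ⟨⟨_, _, he⟩, _⟩ := he
  rcases he0 with he0 | he0 | he0 | he0 <;> rcases he with he | he | he | he <;> omega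

theorem mul_sq_mem (h : LoopRel v n e) (hg : Generic v u) (hi : 1 ≤ i) (t0 : ℕ) :
    ∀ a t, Edge n i t0 a t → ∀ r s s',
    e a r * (loopVec u e n i t0 s * loopVec u e n i t0 s')
      ∈ blockIdeal u e n i (Pre n i · t) := by
  induction t0 using Nat.strong_induction_on with
  | _ t ih =>
  intro c t1 he r s s'
  have ht := he.1.rootIdx hi
  obtain ⟨hc, hc'⟩ := he.1.color
  have hV := fun t ht => leftAct (u := u) h hg hi t ht
  obtain ⟨hm, p, hp, hd⟩ := (hV t ht c hc hc').2 t1 he.1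
  set J := blockIdeal u e n i (Pre n i · t1) with hJ
  suffices h0 : ∀ s, e c 0 * (loopVec u e n i t s * loopVec u e n i t s') ∈ J by
    refine shift_mem J J le_rfl hp
      (x := fun r s => e c r * (loopVec u e n i t s * loopVec u e n i t s')) ?_ h0 r s
    intro r s
    have := blockIdeal_mul_mem (hd r s) (loopVec u e n i t s')
    simpa only [sub_mul, smul_mul_assoc, mul_assoc] using this
  intro s
  by_cases ht0 : t = 0
  · subst ht0
    have hE : ∀ s, loopVec u e n i 0 s = e i s := fun s => vecFrom_zero _ _ ht.2.1 _
    have hEJ : ∀ s b, e i s * b ∈ J := fun s b => by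
      rw [← hE]; exact loopVec_mul_mem ht he.1.pre s b
    have hadj : aD n i c = -1 := by
      rw [aD_eq_neg_one_iff]
      have := he.1
      unfold Adj; unfold Up at this; omega
    rw [hE, hE]
    have hv : v ^ (2 : ℤ) = v * v := by rw [zpow_ofNat]; ring
    refine antisymm_mem J hg.two (q := fun s s' => e c 0 * (e i s * e i s')) ?_ ?_ s s'
    · intro s s'
      have hs := congrArg J.mkQ (h.serre i c s s' 0 hadj)
      have c1 := (mem_iff_mkQ J _).1 (hEJ s (e i s' * e c 0))
      have c2 := (mem_iff_mkQ J _).1 (hEJ s' (e i s * e c 0))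
      have c3 := (mem_iff_mkQ J _).1 (hEJ s (e c 0 * e i s'))
      have c4 := (mem_iff_mkQ J _).1 (hEJ s' (e c 0 * e i s))
      rw [mem_iff_mkQ]
      simp only [mul_add, add_mul, smul_add, mul_assoc, map_add, map_sub, map_smul, map_zero] at *
      linear_combination (norm := module) hs - c1 - c2 + (v + v⁻¹) • c3 + (v + v⁻¹) • c4
    · intro s s'
      have hl := congrArg J.mkQ (congrArg (e c 0 * ·) (h.loop i i s s'))
      have hl0 := congrArg J.mkQ (h.serre i c (s + 1) s' 0 hadj)
      have hl1 := congrArg J.mkQ (h.serre i c s (s' + 1) 0 hadj)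
      have c1 := (mem_iff_mkQ J _).1 (hEJ s (e i (s' + 1) * e c 0))
      have c2 := (mem_iff_mkQ J _).1 (hEJ (s' + 1) (e i s * e c 0))
      have c3 := (mem_iff_mkQ J _).1 (hEJ s (e c 0 * e i (s' + 1)))
      have c4 := (mem_iff_mkQ J _).1 (hEJ (s' + 1) (e c 0 * e i s))
      have d1 := (mem_iff_mkQ J _).1 (hEJ (s + 1) (e i s' * e c 0))
      have d2 := (mem_iff_mkQ J _).1 (hEJ s' (e i (s + 1) * e c 0))
      have d3 := (mem_iff_mkQ J _).1 (hEJ (s + 1) (e c 0 * e i s'))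
      have d4 := (mem_iff_mkQ J _).1 (hEJ s' (e c 0 * e i (s + 1)))
      rw [← J.smul_mem_iff hg.vsq, mem_iff_mkQ]
      simp only [aD_self, hv, mul_add, add_mul, mul_sub, smul_add, mul_assoc, mul_smul_comm, map_add,
        map_sub, map_smul, map_zero] at *
      linear_combination (norm := module) hl + (v * v) • (hl0 - d1 - d2 + (v + v⁻¹) • d3
        + (v + v⁻¹) • d4) - (hl1 - c1 - c2 + (v + v⁻¹) • c3 + (v + v⁻¹) • c4)
  obtain ⟨t0, a, he0⟩ := exists_edge ht ht0
  obtain ⟨ha, ha'⟩ := he0.1.color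
  have ht00 := he0.1.rootIdx hi
  have hA := ih t0 he0.1.lt
  have h1 := mul_congr_of_edge h hg hi he0 (hA a t he0 0) s s'
  have h2 := mul_mem_of_up he.1 (fun t' ht' _ => hV t' ht') 0 h1
  set F := loopVec u e n i t0 s
  set G := loopVec u e n i t0 s'
  suffices h3 : e c 0 * (e a 0 * (e a 0 * (F * G))) ∈ J by
    rw [mul_sub, mul_smul_comm] at h2
    have := J.add_mem h2 (J.smul_mem (u * u * u / (u * u + 1)) h3)
    rwa [sub_add_cancel] at this
  by_cases hadj : Adj n a c
  · have kJ : ∀ x ∈ J, e a 0 * x ∈ J := fun x hx =>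
      LeftAct.mul_mem ha ha' (fun t' ht' hP => ⟨hV t' ht',
        fun t3 h3 t2 h2 => h2.trans_pre (up_pre_of_path he0 he hadj hP h3),
        fun _ t2 h2 => h2.trans_pre hP⟩) 0 hx
    have k1 : e c 0 * F ∈ blockIdeal u e n i (PreEq n i · t0) :=
      (hV t0 ht00 c hc hc').1 (path_not_up' he0 he.1 hadj) 0 s
    have k2 : e a 0 * (e c 0 * F * G) ∈ J := preEq_le_pre he.1.pre
      (mul_mem_of_up' he0.1 (fun t' ht' _ => hV t' ht') 0 (blockIdeal_mul_mem k1 G))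
    have k3 := kJ _ k2
    have k4 := kJ _ (mul_mem_of_up he.1 (fun t' ht' _ => hV t' ht') 0 (hA a t he0 0 s s'))
    have hs := congrArg (· * (F * G)) ((finRel_of_mem_span h hg
      (fun c => mem_span_range e c 0)).serre a c ((aD_eq_neg_one_iff _ _ _).2 hadj))
    rw [← J.smul_mem_iff hg.u0]
    have e1 : u • (e c 0 * (e a 0 * (e a 0 * (F * G)))) =
        (u * u + 1) • (e a 0 * (e c 0 * (e a 0 * (F * G)))) - u • (e a 0 * (e a 0 * (e c 0 * F * G))) := by
      simp only [mul_assoc, add_mul, smul_mul_assoc] at hs ⊢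
      linear_combination (norm := module) hs
    rw [e1]
    exact J.sub_mem (J.smul_mem _ k4) (J.smul_mem _ k3)
  · obtain ⟨q1, q2, q3, q4, q5⟩ := edge_cases_of_not_adj he0 he hadj
    have hca : e c 0 * e a 0 = e a 0 * e c 0 := h.comm c a 0 0 (path_ne he0 he.1).symm
      ((aD_eq_zero_iff _ _ _).2 ⟨(path_ne he0 he.1).symm, fun h' => hadj (by unfold Adj at *; omega)⟩)
    have e0 : Edge n i t0 c (t0 + 1) := by
      have := he0.1
      unfold Edge Up at *; omega
    have k1 : e c 0 * (F * G) ∈ blockIdeal u e n i (PreEq n i · t0) :=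
      blockIdeal_mono (fun t' _ hP => by unfold Pre at hP; unfold PreEq Pre; omega)
        (hA c (t0 + 1) e0 0 s s')
    have k2 := mul_mem_of_up' he0.1 (fun t' ht' _ => hV t' ht') 0 k1
    have k3 := mul_mem_of_stop' ha ha' (fun t1 => edge_not_up_same he0.1)
      (fun t' ht' _ => hV t' ht') 0 k2
    have e1 : e c 0 * (e a 0 * (e a 0 * (F * G))) = e a 0 * (e a 0 * (e c 0 * (F * G))) := by
      rw [← mul_assoc, hca, mul_assoc, ← mul_assoc (e c 0), hca, mul_assoc]
    rw [e1]
    exact preEq_le_pre he.1.pre k3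

/-- The quadratic relation of the root vector `(i,t)`. -/
theorem quad_rel_mem (h : LoopRel v n e) (hg : Generic v u) (hi : 1 ≤ i) (t : ℕ)
    (ht : RootIdx n i t) : ∀ s s',
    loopVec u e n i t (s + 1) * loopVec u e n i t s'
      - (v * v) • (loopVec u e n i t s * loopVec u e n i t (s' + 1))
      - (v * v) • (loopVec u e n i t s' * loopVec u e n i t (s + 1))
      + loopVec u e n i t (s' + 1) * loopVec u e n i t s
      ∈ blockIdeal u e n i (Pre n i · t) := by
  refine edge_induction hi (P := fun t => ∀ s s', loopVec u e n i t (s + 1) * loopVec u e n i t s'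
      - (v * v) • (loopVec u e n i t s * loopVec u e n i t (s' + 1))
      - (v * v) • (loopVec u e n i t s' * loopVec u e n i t (s + 1))
      + loopVec u e n i t (s' + 1) * loopVec u e n i t s
      ∈ blockIdeal u e n i (Pre n i · t)) ?_ ?_ t ht
  · intro s s'
    have hE : ∀ s, loopVec u e n i 0 s = e i s := fun s => vecFrom_zero _ _ ht.2.1 _
    have hl := h.loop i i s s'
    rw [aD_self, zpow_ofNat, pow_two] at hl
    simp only [hE]
    convert Submodule.zero_mem _ using 1
    linear_combination (norm := module) hl
  · intro t0 a t he ih s s'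
    obtain ⟨ha, ha'⟩ := he.1.color
    have hV := fun t ht => leftAct (u := u) h hg hi t ht
    have hc := mul_congr_of_edge h hg hi he (mul_sq_mem h hg hi t0 a t he 0)
    have k1 : ∀ x ∈ blockIdeal u e n i (Pre n i · t0),
        e a 0 * (e a 0 * x) ∈ blockIdeal u e n i (Pre n i · t) := by
      intro x hx
      rw [← mul_assoc]
      refine left_mul_rightIdeal ?_ hx
      rintro _ ⟨t', r, hP, ht', rfl⟩
      rw [mul_assoc]
      by_cases hup : ∃ t3, Up n i t' a t3
      · obtain ⟨t3, hup⟩ := hup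
        refine preEq_le_pre (up_mono_up hP hup he.1) (mul_mem_of_stop' ha ha'
          (fun t1 => edge_not_up_same hup) (fun t' ht' _ => hV t' ht') 0
          (((hV t' ht') a ha ha').2 t3 hup |>.1 0 r))
      · rw [not_exists] at hup
        exact preEq_le_pre (hP.trans he.1.pre) (mul_mem_of_stop' ha ha' hup
          (fun t' ht' _ => hV t' ht') 0 (((hV t' ht') a ha ha').1 hup 0 r))
    have h0 := (mem_iff_mkQ _ _).1 (k1 _ (ih s s'))
    have h1 := (mem_iff_mkQ _ _).1 (hc (s + 1) s')
    have h2 := (mem_iff_mkQ _ _).1 (hc s (s' + 1))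
    have h3 := (mem_iff_mkQ _ _).1 (hc s' (s + 1))
    have h4 := (mem_iff_mkQ _ _).1 (hc (s' + 1) s)
    rw [mem_iff_mkQ]
    simp only [mul_add, mul_sub, mul_smul_comm, map_add, map_sub, map_smul] at h0 h1 h2 h3 h4 ⊢
    linear_combination (norm := module) h1 - (v * v) • h2 - (v * v) • h3 + h4
      + (u * u * u / (u * u + 1)) • h0

end Products

section Convexity
variable {K : Type} [Field K] {B : Type} [Ring B] [Algebra K B]
variable {v u : K} {n : ℕ} {e : ℕ → ℤ → B} {i : ℕ}

theorem Ser.polarize {x x' y : B} (h : Ser u x y) (h' : Ser u x' y) (h2 : Ser u (x + x') y) :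
    u • (x * (x' * y) + x' * (x * y) + y * (x * x') + y * (x' * x)) =
      (u * u + 1) • (x * (y * x') + x' * (y * x)) := by
  simp only [Ser, mul_add, add_mul, smul_add] at *
  linear_combination (norm := module) h2 - h - h'

theorem le_of_preEq {t t' : ℕ} (h : PreEq n i t t') : t ≤ t' := by
  unfold PreEq Pre at h; omega

theorem preEq_le_lt {t t1 : ℕ} (h : t < t1) :
    blockIdeal u e n i (PreEq n i · t) ≤ blockIdeal u e n i (· < t1) :=
  blockIdeal_mono fun _ _ h' => (le_of_preEq h').trans_lt h

theorem pre_le_lt {t : ℕ} :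
    blockIdeal u e n i (Pre n i · t) ≤ blockIdeal u e n i (· < t) :=
  blockIdeal_mono fun _ _ h' => h'.1

theorem mul_branch_mem (h : LoopRel v n e) (hg : Generic v u) (hi : 1 ≤ i) {t0 : ℕ}
    (h1 : 1 ≤ n - (i + t0)) (hn : i + t0 + 2 = n)
    (hP : ∀ t', RootIdx n i t' → t' < t0 → ∀ s s',
      loopVec u e n i t0 s * loopVec u e n i t' s' ∈ blockIdeal u e n i (· < t0))
    (s r s' : ℤ) :
    e n 0 * (loopVec u e n i t0 s * (e (n - 1) r * loopVec u e n i t0 s'))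
      ∈ blockIdeal u e n i (· < t0 + 2) := by
  have hV := fun t ht => leftAct (u := u) h hg hi t ht
  have he : Edge n i t0 n (t0 + 2) := by unfold Edge Up; omega
  have he' : Edge n i t0 (n - 1) (t0 + 1) := by unfold Edge Up; omega
  have ht0 := he.1.rootIdx hi
  obtain ⟨hc, hc'⟩ := he'.1.color
  obtain ⟨hm, p, hp, hd⟩ := (hV t0 ht0 (n - 1) hc hc').2 _ he'.1
  set J := blockIdeal u e n i (· < t0 + 2) with hJ
  set F := loopVec u e n i t0 with hF
  have hsq : ∀ s s', e n 0 * (F s * F s') ∈ blockIdeal u e n i (Pre n i · (t0 + 2)) :=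
    mul_sq_mem h hg hi t0 n _ he 0
  have hleft : ∀ s, ∀ x ∈ blockIdeal u e n i (Pre n i · (t0 + 1)), e n 0 * (F s * x) ∈ J := by
    intro s x hx
    rw [← mul_assoc]
    refine left_mul_rightIdeal ?_ hx
    rintro _ ⟨t', q, hlt, ht', rfl⟩
    rw [mul_assoc]
    rcases (Nat.lt_succ_iff.1 hlt.1).eq_or_lt with rfl | hlt'
    · exact pre_le_lt (hsq s q)
    · refine LeftAct.mul_mem (P := (· < t0)) he.1.color.1 he.1.color.2 (fun t1 ht1 hP1 =>
        ⟨hV t1 ht1, ?_, ?_⟩) 0 (hP t' ht' hlt' s q)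
      · intro t2 hup
        exfalso
        unfold Up at hup; omega
      · intro _ t2 h2
        exact lt_of_le_of_lt (le_of_preEq h2) (by omega)
  have hdiff : ∀ s r s', e n 0 * (F s * (e (n - 1) (r + 1) * F s'))
      - p • (e n 0 * (F s * (e (n - 1) r * F (s' + 1)))) ∈ J := by
    intro s r s'
    have := hleft s _ (hd r s')
    simpa only [mul_sub, mul_smul_comm] using this
  have hsh := fun s r s' => shift_sub_mem J hp
    (x := fun r s' => e n 0 * (F s * (e (n - 1) r * F s'))) (hdiff s) r s'
  have hanti : ∀ r s s', e n 0 * (F s * (e (n - 1) r * F s'))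
      + e n 0 * (F s' * (e (n - 1) r * F s)) ∈ J := by
    intro r s s'
    let y := Function.update (fun c => e c 0) (n - 1) (e (n - 1) r)
    have hy : ∀ c, y c ∈ Submodule.span K (Set.range (e c)) := by
      intro c
      by_cases hcn : c = n - 1
      · subst hcn; simp only [y, Function.update_self]; exact mem_span_range e _ r
      · simp only [y, Function.update_of_ne hcn]; exact mem_span_range e _ 0
    have hFy : ∀ x, vecFrom u y n i t0 x = vecFrom u (fun c => e c 0) n i t0 x := by
      intro x
      apply vecFrom_congr
      intro c hcw
      refine Function.update_of_ne ?_ _ _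
      have := List.mem_of_mem_tail hcw
      rw [wordN, if_pos (by omega), List.mem_range'] at this
      omega
    have hyn : y (n - 1) = e (n - 1) r := Function.update_self ..
    have s1 := fun x hx => (vecFrom_ser h hg hi he'.1 hy (x := x) hx).1
    have s2 := s1 (e i s) (mem_span_range e i s)
    have s3 := s1 (e i s') (mem_span_range e i s')
    have s4 := s1 (e i s + e i s') (Submodule.add_mem _ (mem_span_range e i s)
      (mem_span_range e i s'))
    rw [hFy, hyn] at s2 s3 s4
    rw [vecFrom_add] at s4
    have s5 := congrArg J.mkQ (congrArg (e n 0 * ·) (s2.polarize s3 s4))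
    change J.mkQ (e n 0 * u • (F s * (F s' * e (n - 1) r) + F s' * (F s * e (n - 1) r) +
      e (n - 1) r * (F s * F s') + e (n - 1) r * (F s' * F s))) =
      J.mkQ (e n 0 * (u * u + 1) • (F s * (e (n - 1) r * F s') + F s' * (e (n - 1) r * F s))) at s5
    have k1 : ∀ s s', J.mkQ (e n 0 * (F s * F s') * e (n - 1) r) = 0 := fun s s' =>
      (mem_iff_mkQ J _).1 (blockIdeal_mul_mem (pre_le_lt (hsq s s')) _)
    have hcomm : e n 0 * e (n - 1) r = e (n - 1) r * e n 0 :=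
      h.comm _ _ _ _ (by omega) ((aD_eq_zero_iff _ _ _).2 ⟨by omega, by unfold Adj; omega⟩)
    have k2 : ∀ s s', J.mkQ (e n 0 * (e (n - 1) r * (F s * F s'))) = 0 := fun s s' => by
      rw [← mul_assoc, hcomm, mul_assoc, ← mem_iff_mkQ]
      refine preEq_le_lt (Nat.lt_succ_self _) (mul_mem_of_up' he'.1 (fun t' ht' _ => hV t' ht') r
        (blockIdeal_mono (fun t' _ hP => ?_) (hsq s s')))
      unfold Pre at hP; unfold PreEq Pre; omega
    have c1 := k1 s s'
    have c2 := k1 s' s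
    have c3 := k2 s s'
    have c4 := k2 s' s
    rw [← J.smul_mem_iff hg.usq, mem_iff_mkQ]
    simp only [mul_add, mul_assoc, smul_add, mul_smul_comm, map_add, map_smul] at s5 c1 c2 c3 c4 ⊢
    linear_combination (norm := module) -s5 + u • (c1 + c2 + c3 + c4)
  have h0 : ∀ s s', e n 0 * (F s * (e (n - 1) 0 * F s')) ∈ J := by
    refine antisymm_mem J hg.two (fun s s' => hanti 0 s s') ?_
    intro s s'
    have a1 := (mem_iff_mkQ J _).1 (hanti 1 s s')
    have a2 := (mem_iff_mkQ J _).1 (hsh s 1 s')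
    have a3 := (mem_iff_mkQ J _).1 (hsh s' 1 s)
    have a4 := (mem_iff_mkQ J _).1 (hanti 0 (s + 1) s')
    rw [← J.smul_mem_iff hp, mem_iff_mkQ]
    simp only [smul_sub, map_add, map_sub, map_smul, zpow_one] at a1 a2 a3 a4 ⊢
    linear_combination (norm := module) -a1 + a2 + a3 + p • a4
  have := J.add_mem (hsh s r s') (J.smul_mem (p ^ r) (h0 s (s' + r)))
  rwa [sub_add_cancel] at this

/-- Products of root vectors of the same block in the wrong order. -/
theorem mul_mem_lt (h : LoopRel v n e) (hg : Generic v u) (hi : 1 ≤ i) (t : ℕ) :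
    RootIdx n i t → ∀ t', RootIdx n i t' → t' < t → ∀ s s',
      loopVec u e n i t s * loopVec u e n i t' s' ∈ blockIdeal u e n i (· < t) := by
  induction t using Nat.strong_induction_on with
  | _ t ih =>
  intro ht t' ht' hlt s s'
  have hV := fun t ht => leftAct (u := u) h hg hi t ht
  obtain ⟨t0, a, he⟩ := exists_edge ht (by omega : t ≠ 0)
  have ht0 := he.1.rootIdx hi
  rw [loopVec_up h hg hi he.1, qb, sub_mul, smul_mul_assoc, mul_assoc, mul_assoc]
  refine Submodule.sub_mem _ (loopVec_mul_mem ht0 he.1.lt s _) (Submodule.smul_mem _ _ ?_)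
  rcases lt_trichotomy t' t0 with h1 | rfl | h1
  · refine LeftAct.mul_mem (P := (· < t0)) he.1.color.1 he.1.color.2 (fun t1 ht1 hP1 =>
      ⟨hV t1 ht1, ?_, ?_⟩) 0 (ih t0 he.1.lt ht0 t' ht' h1 s s')
    · intro t2 hup t3 h3
      exact (le_of_preEq h3).trans_lt (up_lt_of_edge he hP1 hup)
    · intro _ t2 h2
      exact ((le_of_preEq h2).trans_lt hP1).trans he.1.lt
  · exact pre_le_lt (mul_sq_mem h hg hi t' a t he 0 s s')
  · obtain ⟨rfl, rfl, rfl, hn⟩ : a = n ∧ t = t0 + 2 ∧ t' = t0 + 1 ∧ i + t0 + 2 = n := by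
      obtain ⟨⟨_, _, he⟩, _⟩ := he
      rcases he with he | he | he | he <;> omega
    have he' : Edge a i t0 (a - 1) (t0 + 1) := by
      have := he.1
      unfold Edge Up at *; omega
    rw [loopVec_up h hg hi he'.1, qb, mul_sub, mul_sub, mul_smul_comm, mul_smul_comm]
    refine Submodule.sub_mem _ ?_ (Submodule.smul_mem _ _ ?_)
    · have := blockIdeal_mul_mem (pre_le_lt (mul_sq_mem h hg hi t0 a _ he 0 s s')) (e (a - 1) 0)
      simpa only [mul_assoc] using this
    · exact mul_branch_mem h hg hi (by omega) hn (fun t' ht' h' => ih t0 he.1.lt ht0 t' ht' h') s 0 s'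

/-- The subalgebra of elements stabilizing a subspace under left multiplication. -/
def leftStab (J : Submodule K B) : Subalgebra K B where
  carrier := {x | ∀ z ∈ J, x * z ∈ J}
  mul_mem' {x y} hx hy z hz := by rw [mul_assoc]; exact hx _ (hy _ hz)
  add_mem' {x y} hx hy z hz := by rw [add_mul]; exact J.add_mem (hx _ hz) (hy _ hz)
  algebraMap_mem' a z hz := by rw [← Algebra.smul_def]; exact J.smul_mem a hz

theorem foldl_qb_mem (u : K) (S : Subalgebra K B) (l : List B) (hl : ∀ y ∈ l, y ∈ S) {x : B}
    (hx : x ∈ S) : l.foldl (qb u) x ∈ S := by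
  induction l generalizing x with
  | nil => exact hx
  | cons y l ih =>
    rw [List.foldl_cons]
    have hy := hl y (by simp)
    exact ih (fun z hz => hl z (by simp [hz]))
      (S.sub_mem (S.mul_mem hx hy) (S.smul_mem (S.mul_mem hy hx) u))

theorem vecFrom_mem (u : K) (S : Subalgebra K B) {y : ℕ → B} {t : ℕ} (hi : 1 ≤ i) (hin : i ≤ n)
    (ht : RootIdx n i t) (hS : ∀ c, i < c → y c ∈ S) {x : B} (hx : x ∈ S) :
    vecFrom u y n i t x ∈ S := by
  refine foldl_qb_mem u S _ ?_ hx
  intro z hz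
  obtain ⟨c, hc, rfl⟩ := List.mem_map.1 hz
  exact hS c (lt_of_mem_tail hi hin t ht c hc)

/-- Root vectors of later blocks preserve the right ideals of earlier blocks. -/
theorem loopVec_mul_mem_block (h : LoopRel v n e) (hg : Generic v u) (hi : 1 ≤ i) {i' t : ℕ}
    (hii : i < i') (ht : RootIdx n i' t) (s : ℤ) {x : B}
    (hx : x ∈ blockIdeal u e n i fun _ => True) :
    loopVec u e n i' t s * x ∈ blockIdeal u e n i fun _ => True := by
  have key : ∀ c, i < c → ∀ r, e c r ∈ leftStab (blockIdeal u e n i fun _ => True) := by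
    intro c hc r z hz
    by_cases hcn : c ≤ n
    · exact LeftAct.mul_mem hc hcn (fun t' ht' _ => ⟨leftAct h hg hi t' ht', fun _ _ _ _ => trivial,
        fun _ _ _ => trivial⟩) r hz
    · rw [h.zero c r (by omega), zero_mul]
      exact Submodule.zero_mem _
  exact vecFrom_mem u _ (by omega) ht.2.1 ht (fun c hc => key c (by omega) 0) (key i' hii s) x hx

/-- A root vector with an arbitrary distribution of its loop degree. -/
theorem vecFrom_transfer (h : LoopRel v n e) (hg : Generic v u) (hi : 1 ≤ i) (T : ℕ → ℤ) (t : ℕ)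
    (ht : RootIdx n i t) : ∃ μ : K, μ ≠ 0 ∧
      vecFrom u (fun c => e c (T c)) n i t (e i (T i))
        - μ • loopVec u e n i t ((wordN n i t).map T).sum ∈ blockIdeal u e n i (Pre n i · t) := by
  refine edge_induction hi (P := fun t => ∃ μ : K, μ ≠ 0 ∧
      vecFrom u (fun c => e c (T c)) n i t (e i (T i))
        - μ • loopVec u e n i t ((wordN n i t).map T).sum ∈ blockIdeal u e n i (Pre n i · t))
    ?_ ?_ t ht
  · refine ⟨1, one_ne_zero, ?_⟩
    simp [vecFrom_zero _ _ ht.2.1, loopVec, wordN_zero ht.2.1]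
  · rintro t0 a t he ⟨μ, hμ, ih⟩
    have hV := fun t ht => leftAct (u := u) h hg hi t ht
    have ht0 := he.1.rootIdx hi
    obtain ⟨hm, p, hp, hd⟩ := (hV t0 ht0 a he.1.color.1 he.1.color.2).2 t he.1
    refine ⟨μ * p ^ T a, mul_ne_zero hμ (zpow_ne_zero _ hp), ?_⟩
    set J := blockIdeal u e n i (Pre n i · t)
    rw [vecFrom_edge u _ hi he, wordN_edge he, List.map_append, List.sum_append]
    set X := vecFrom u (fun c => e c (T c)) n i t0 (e i (T i))
    set s := ((wordN n i t0).map T).sum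
    have k0 := mul_mem_of_up he.1 (fun t' ht' _ => hV t' ht') (T a) ih
    have k1 : X ∈ blockIdeal u e n i (PreEq n i · t0) := by
      have := Submodule.add_mem _ (pre_le_preEq ih)
        (Submodule.smul_mem _ μ (loopVec_mem (u := u) (e := e) (P := (PreEq n i · t0)) ht0
          (Or.inl rfl) s))
      rwa [sub_add_cancel] at this
    have k2 := preEq_le_pre he.1.pre (blockIdeal_mul_mem k1 (e a (T a)))
    have k3 := shift_sub_mem J hp (x := fun r s => e a r * loopVec u e n i t0 s) hd (T a) s
    have k4 : loopVec u e n i t0 (s + T a) * e a 0 ∈ J := loopVec_mul_mem ht0 he.1.pre _ _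
    have c0 := (mem_iff_mkQ J _).1 k0
    have c2 := (mem_iff_mkQ J _).1 k2
    have c3 := (mem_iff_mkQ J _).1 k3
    have c4 := (mem_iff_mkQ J _).1 k4
    rw [mem_iff_mkQ]
    simp only [List.map_cons, List.map_nil, List.sum_cons, List.sum_nil, add_zero]
    rw [loopVec_up h hg hi he.1]
    simp only [qb, mul_sub, smul_sub, mul_smul_comm, map_sub, map_smul] at c0 c2 c3 c4 ⊢
    linear_combination (norm := module) -u • c0 + c2 - (u * μ) • c3 - (μ * p ^ T a) • c4

end Convexity

section ModeSort

/-- The total size of the descents `∑_{i<j} max (0, s_i - s_j)` of a list of integers. -/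
def disorder : List ℤ → ℕ
  | [] => 0
  | a :: l => (l.map fun b => (a - b).toNat).sum + disorder l

theorem disorder_lt {a b a' b' : ℤ} (h1 : ∀ c : ℤ, (c - a').toNat + (c - b').toNat ≤ (c - a).toNat + (c - b).toNat)
    (h2 : ∀ c : ℤ, (a' - c).toNat + (b' - c).toNat ≤ (a - c).toNat + (b - c).toNat)
    (h3 : (a' - b').toNat < (a - b).toNat) (l₁ l₂ : List ℤ) :
    disorder (l₁ ++ a' :: b' :: l₂) < disorder (l₁ ++ a :: b :: l₂) := by
  induction l₁ with
  | nil =>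
    have : (l₂.map fun c => (a' - c).toNat).sum + (l₂.map fun c => (b' - c).toNat).sum ≤
        (l₂.map fun c => (a - c).toNat).sum + (l₂.map fun c => (b - c).toNat).sum := by
      induction l₂ with
      | nil => simp
      | cons c l ih => have := h2 c; simp only [List.map_cons, List.sum_cons]; omega
    simp only [List.nil_append, disorder, List.map_cons, List.sum_cons]
    omega
  | cons c l ih =>
    have := h1 c
    simp only [List.cons_append, disorder, List.map_append, List.map_cons, List.sum_append,
      List.sum_cons]
    omega

theorem pairwise_or_descent (l : List ℤ) :
    l.Pairwise (· ≤ ·) ∨ ∃ l₁ a b l₂, l = l₁ ++ a :: b :: l₂ ∧ b < a := by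
  induction l with
  | nil => exact Or.inl List.Pairwise.nil
  | cons a l ih =>
    rcases ih with ih | ⟨l₁, x, y, l₂, rfl, h⟩
    · cases l with
      | nil => exact Or.inl (List.pairwise_singleton _ _)
      | cons b l =>
        rcases lt_or_ge b a with h | h
        · exact Or.inr ⟨[], a, b, l, rfl, h⟩
        · refine Or.inl (List.pairwise_cons.2 ⟨fun c hc => ?_, ih⟩)
          rcases List.mem_cons.1 hc with rfl | hc
          · exact h
          · exact h.trans (List.rel_of_pairwise_cons ih hc)
    · exact Or.inr ⟨a :: l₁, x, y, l₂, rfl, h⟩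

variable {K : Type} [Field K] {B : Type} [Ring B] [Algebra K B]

theorem list_prod_mul_mem {ι : Type} {J : Submodule K B} {f : ι → B} (hl : ∀ s, ∀ x ∈ J, f s * x ∈ J)
    (l : List ι) {x : B} (hx : x ∈ J) : (l.map f).prod * x ∈ J := by
  induction l with
  | nil => simpa using hx
  | cons a l ih => simpa [mul_assoc] using hl a _ ih

theorem modeSort {J : Submodule K B} {f : ℤ → B} {q : K} (h2 : (2 : K) ≠ 0)
    (hr : ∀ x ∈ J, ∀ b, x * b ∈ J) (hl : ∀ s, ∀ x ∈ J, f s * x ∈ J)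
    (hq : ∀ a b, f (a + 1) * f b - q • (f a * f (b + 1)) - q • (f b * f (a + 1)) +
      f (b + 1) * f a ∈ J) (l : List ℤ) :
    (l.map f).prod ∈ J ⊔ Submodule.span K
      {x | ∃ l' : List ℤ, l'.Pairwise (· ≤ ·) ∧ l'.length = l.length ∧ x = (l'.map f).prod} := by
  induction h : disorder l using Nat.strong_induction_on generalizing l with
  | _ m ih =>
    subst h
    rcases pairwise_or_descent l with hs | ⟨l₁, a, b, l₂, rfl, hab⟩
    · exact Submodule.mem_sup_right (Submodule.subset_span ⟨l, hs, rfl, rfl⟩)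
    set S := J ⊔ Submodule.span K {x | ∃ l' : List ℤ, l'.Pairwise (· ≤ ·) ∧
      l'.length = (l₁ ++ a :: b :: l₂).length ∧ x = (l'.map f).prod} with hS
    have hJ : ∀ x ∈ J, (l₁.map f).prod * x * (l₂.map f).prod ∈ S := fun x hx =>
      Submodule.mem_sup_left (hr _ (list_prod_mul_mem hl l₁ hx) _)
    have key : ∀ a' b' : ℤ, disorder (l₁ ++ a' :: b' :: l₂) < disorder (l₁ ++ a :: b :: l₂) →
        (l₁.map f).prod * (f a' * f b') * (l₂.map f).prod ∈ S := by
      intro a' b' hlt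
      have := ih _ hlt (l₁ ++ a' :: b' :: l₂) rfl
      simpa [mul_assoc, hS] using this
    have e0 : ((l₁ ++ a :: b :: l₂).map f).prod =
        (l₁.map f).prod * (f a * f b) * (l₂.map f).prod := by simp [mul_assoc]
    rw [e0]
    have hswap := key b a (disorder_lt (by omega) (by omega) (by omega) _ _)
    have hrel := hJ _ (hq (a - 1) b)
    rw [sub_add_cancel] at hrel
    rcases eq_or_lt_of_le (show b + 1 ≤ a by omega) with rfl | hlt
    · rw [add_sub_cancel_right] at hrel
      have : (l₁.map f).prod * (f (b + 1) * f b) * (l₂.map f).prod = (2 : K)⁻¹ •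
          ((l₁.map f).prod * (f (b + 1) * f b - q • (f b * f (b + 1)) - q • (f b * f (b + 1)) +
            f (b + 1) * f b) * (l₂.map f).prod) +
          q • ((l₁.map f).prod * (f b * f (b + 1)) * (l₂.map f).prod) := by
        simp only [mul_sub, sub_mul, mul_add, add_mul, mul_assoc, smul_mul_assoc, mul_smul_comm]
        match_scalars <;> field_simp <;> ring
      rw [this]
      exact S.add_mem (S.smul_mem _ hrel) (S.smul_mem _ hswap)
    · have h3 := key (a - 1) (b + 1) (disorder_lt (by omega) (by omega) (by omega) _ _)
      have h4 := key (b + 1) (a - 1) (disorder_lt (by omega) (by omega) (by omega) _ _)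
      have : (l₁.map f).prod * (f a * f b) * (l₂.map f).prod =
          ((l₁.map f).prod * (f a * f b - q • (f (a - 1) * f (b + 1)) - q • (f b * f a) +
            f (b + 1) * f (a - 1)) * (l₂.map f).prod) +
          q • ((l₁.map f).prod * (f b * f a) * (l₂.map f).prod) +
          q • ((l₁.map f).prod * (f (a - 1) * f (b + 1)) * (l₂.map f).prod) -
          ((l₁.map f).prod * (f (b + 1) * f (a - 1)) * (l₂.map f).prod) := by
        simp only [mul_sub, sub_mul, mul_add, add_mul, mul_assoc, smul_mul_assoc, mul_smul_comm]
        module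
      rw [this]
      exact S.sub_mem (S.add_mem (S.add_mem hrel (S.smul_mem _ hswap)) (S.smul_mem _ h3)) h4

end ModeSort

section SortedSpan
variable {K : Type} [Field K] {B : Type} [Ring B] [Algebra K B]

/-- The right ideal generated by the root vectors of smaller roots. -/
def lowIdeal (K : Type) [Field K] {B : Type} [Ring B] [Algebra K B] {ι : Type} [LinearOrder ι]
    (E : ι → ℤ → B) (β : ι) : Submodule K B :=
  rightIdeal K {x | ∃ δ, δ < β ∧ ∃ s, x = E δ s}

/-- The span of the ordered products of the vectors `F` of total height `k`. -/
def ordSpan (K : Type) [Field K] {B : Type} [Ring B] [Algebra K B] {ι : Type} [LinearOrder ι]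
    (F : ι ×ₗ ℤ → B) (ht : ι → ℕ) (k : ℕ) : Submodule K B :=
  Submodule.span K {x | ∃ l : List (ι ×ₗ ℤ), l.Pairwise (· ≤ ·) ∧
    (l.map fun p => ht (ofLex p).1).sum = k ∧ x = (l.map F).prod}

/-- Root vectors `E`, with variants `F`, satisfying straightening relations. -/
structure Straightening {ι : Type} [LinearOrder ι] (E : ι → ℤ → B) (F : ι ×ₗ ℤ → B) (ht : ι → ℕ)
    (M : Submodule K B) (π : ℕ → B →ₗ[K] B) (q : K) : Prop where
  two : (2 : K) ≠ 0
  pos : ∀ β, 1 ≤ ht β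
  memE : ∀ β s, E β s ∈ M ^ ht β
  memF : ∀ p, F p ∈ M ^ ht (ofLex p).1
  proj_mul : ∀ h k x b, x ∈ M ^ h → π (h + k) (x * b) = x * π k b
  proj_zero : ∀ h k x b, x ∈ M ^ h → k < h → π k (x * b) = 0
  proj_mem : ∀ k b, π k b ∈ M ^ k
  proj_self : ∀ k x, x ∈ M ^ k → π k x = x
  gen : M ≤ Submodule.span K {x | ∃ β s, x = E β s ∧ ht β = 1}
  conv : ∀ β γ s s', γ < β → E β s * E γ s' ∈ lowIdeal K E β
  quad : ∀ β a b, E β (a + 1) * E β b - q • (E β a * E β (b + 1)) - q • (E β b * E β (a + 1)) +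
      E β (b + 1) * E β a ∈ lowIdeal K E β
  transfer : ∀ β s, ∃ μ : K, μ ≠ 0 ∧ F (toLex (β, s)) - μ • E β s ∈ lowIdeal K E β

variable {ι : Type} [LinearOrder ι] {E : ι → ℤ → B} {F : ι ×ₗ ℤ → B} {ht : ι → ℕ}
  {M : Submodule K B} {π : ℕ → B →ₗ[K] B} {q : K}

theorem lowIdeal_mono {γ β : ι} (h : γ ≤ β) : lowIdeal K E γ ≤ lowIdeal K E β := by
  refine rightIdeal_mono ?_
  rintro x ⟨δ, hδ, s, rfl⟩
  exact ⟨δ, hδ.trans_le h, s, rfl⟩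

namespace Straightening

theorem mul_low (H : Straightening E F ht M π q) {β : ι} (s : ℤ) {x : B} (hx : x ∈ lowIdeal K E β) :
    E β s * x ∈ lowIdeal K E β := by
  refine left_mul_rightIdeal ?_ hx
  rintro g ⟨δ, hδ, s', rfl⟩
  exact H.conv β δ s s' hδ

theorem mul_F (H : Straightening E F ht M π q) {γ β : ι} (h : γ < β) (s s' : ℤ) (b : B) :
    E β s * (F (toLex (γ, s')) * b) ∈ lowIdeal K E β := by
  obtain ⟨μ, -, hm⟩ := H.transfer γ s'
  have h1 := mul_mem_rightIdeal (H.mul_low s (lowIdeal_mono h.le hm)) b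
  have h2 := mul_mem_rightIdeal (H.conv β γ s s' h) b
  have : E β s * (F (toLex (γ, s')) * b) = E β s * (F (toLex (γ, s')) - μ • E γ s') * b +
      μ • (E β s * E γ s' * b) := by
    simp only [mul_sub, sub_mul, mul_assoc, smul_mul_assoc, mul_smul_comm]; module
  rw [this]
  exact Submodule.add_mem _ h1 (Submodule.smul_mem _ _ h2)

theorem prod_transfer (H : Straightening E F ht M π q) (β : ι) (l : List ℤ) : ∃ μ : K, μ ≠ 0 ∧
    (l.map fun s => F (toLex (β, s))).prod - μ • (l.map (E β)).prod ∈ lowIdeal K E β := by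
  induction l with
  | nil => exact ⟨1, one_ne_zero, by simp⟩
  | cons a l ih =>
    obtain ⟨c, hc, h1⟩ := ih
    obtain ⟨μ, hμ, h2⟩ := H.transfer β a
    refine ⟨μ * c, mul_ne_zero hμ hc, ?_⟩
    have h3 := H.mul_low a h1
    have h4 := mul_mem_rightIdeal h2 (l.map fun s => F (toLex (β, s))).prod
    simp only [List.map_cons, List.prod_cons]
    set P := (l.map fun s => F (toLex (β, s))).prod
    have : F (toLex (β, a)) * P - (μ * c) • (E β a * (l.map (E β)).prod) =
        (F (toLex (β, a)) - μ • E β a) * P + μ • (E β a * (P - c • (l.map (E β)).prod)) := by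
      simp only [mul_sub, sub_mul, smul_mul_assoc, mul_smul_comm]; module
    rw [this]
    exact Submodule.add_mem _ h4 (Submodule.smul_mem _ _ h3)

theorem prod_mem (H : Straightening E F ht M π q) (l : List (ι ×ₗ ℤ)) :
    (l.map F).prod ∈ M ^ (l.map fun p => ht (ofLex p).1).sum := by
  induction l with
  | nil => simp [Submodule.one_eq_span, Submodule.mem_span_singleton_self]
  | cons p l ih =>
    simp only [List.map_cons, List.prod_cons, List.sum_cons, pow_add]
    exact Submodule.mul_mem_mul (H.memF p) ih

theorem ordSpan_le (H : Straightening E F ht M π q) (k : ℕ) : ordSpan K F ht k ≤ M ^ k := by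
  refine Submodule.span_le.2 ?_
  rintro x ⟨l, -, rfl, rfl⟩
  exact H.prod_mem l

theorem low_mem (H : Straightening E F ht M π q)
    {β : ι} {k : ℕ} (ih : ∀ δ, δ < β → ∀ s, ∀ k', ht δ + k' = k → ∀ y ∈ M ^ k',
    E δ s * y ∈ ordSpan K F ht k) {x : B} (hx : x ∈ lowIdeal K E β) (hxk : x ∈ M ^ k) :
    x ∈ ordSpan K F ht k := by
  rw [← H.proj_self k x hxk]
  clear hxk
  induction hx using Submodule.span_induction with
  | mem x hx =>
    obtain ⟨_, ⟨δ, hδ, s, rfl⟩, b, rfl⟩ := hx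
    rcases lt_or_ge k (ht δ) with hk | hk
    · rw [H.proj_zero _ _ _ _ (H.memE δ s) hk]
      exact Submodule.zero_mem _
    · obtain ⟨k', rfl⟩ := Nat.exists_eq_add_of_le hk
      rw [H.proj_mul _ _ _ _ (H.memE δ s)]
      exact ih δ hδ s k' rfl _ (H.proj_mem _ _)
  | zero => rw [map_zero]; exact Submodule.zero_mem _
  | add x y _ _ hx hy => rw [map_add]; exact Submodule.add_mem _ hx hy
  | smul a x _ hx => rw [map_smul]; exact Submodule.smul_mem _ _ hx

theorem split_sorted (β : ι) (l : List (ι ×ₗ ℤ)) (hl : l.Pairwise (· ≤ ·))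
    (hβ : ∀ p ∈ l, β ≤ (ofLex p).1) : ∃ (ms : List ℤ) (l₂ : List (ι ×ₗ ℤ)),
      l = ms.map (fun s => toLex (β, s)) ++ l₂ ∧ l₂.Pairwise (· ≤ ·) ∧ ∀ p ∈ l₂, β < (ofLex p).1 := by
  induction l with
  | nil => exact ⟨[], [], by simp⟩
  | cons p l ih =>
    obtain ⟨ms, l₂, h1, h2, h3⟩ := ih hl.of_cons fun p hp => hβ p (by simp [hp])
    rcases eq_or_lt_of_le (hβ p (by simp)) with h | h
    · refine ⟨(ofLex p).2 :: ms, l₂, ?_, h2, h3⟩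
      rw [h1]
      simp only [List.map_cons, List.cons_append]
      congr 1
      rw [h]; rfl
    · refine ⟨[], p :: l, rfl, hl, ?_⟩
      intro r hr
      rcases List.mem_cons.1 hr with rfl | hr
      · exact h
      · have hle := List.rel_of_pairwise_cons hl hr
        rw [Prod.Lex.le_iff] at hle
        rcases hle with hle | hle
        · exact h.trans hle
        · exact h.trans_eq hle.1

theorem mul_prod_mem (H : Straightening E F ht M π q)
    {β : ι} {k k' : ℕ} (hk : ht β + k' = k) (s : ℤ) (l : List (ι ×ₗ ℤ))
    (hl : l.Pairwise (· ≤ ·)) (hlk : (l.map fun p => ht (ofLex p).1).sum = k') :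
    E β s * (l.map F).prod ∈ lowIdeal K E β ⊔ ordSpan K F ht k := by
  by_cases hβ : ∀ p ∈ l, β ≤ (ofLex p).1
  · obtain ⟨ms, l₂, rfl, h2, h3⟩ := split_sorted β l hl hβ
    have hright : ∀ x ∈ lowIdeal K E β, ∀ b, x * b ∈ lowIdeal K E β :=
      fun x hx b => mul_mem_rightIdeal hx b
    have hsort := modeSort H.two hright (fun s x hx => H.mul_low s hx) (H.quad β) (s :: ms)
    set P₂ := (l₂.map F).prod with hP₂
    have hS : ∀ x ∈ lowIdeal K E β ⊔ Submodule.span K {x | ∃ l' : List ℤ, l'.Pairwise (· ≤ ·) ∧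
        l'.length = (s :: ms).length ∧ x = (l'.map (E β)).prod},
        x * P₂ ∈ lowIdeal K E β ⊔ ordSpan K F ht k := by
      intro x hx
      obtain ⟨y, hy, z, hz, rfl⟩ := Submodule.mem_sup.1 hx
      rw [add_mul]
      refine Submodule.add_mem _ (Submodule.mem_sup_left (hright _ hy _)) ?_
      clear hx
      induction hz using Submodule.span_induction with
      | mem z hz =>
        obtain ⟨l', h1', hlen, rfl⟩ := hz
        obtain ⟨μ, hμ, hm⟩ := H.prod_transfer β l'
        have e1 : (l'.map (E β)).prod * P₂ =
            μ⁻¹ • ((l'.map fun s => F (toLex (β, s))).prod * P₂) - μ⁻¹ •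
              (((l'.map fun s => F (toLex (β, s))).prod - μ • (l'.map (E β)).prod) * P₂) := by
          simp only [sub_mul, smul_mul_assoc]
          match_scalars <;> field_simp <;> ring
        rw [e1]
        refine Submodule.sub_mem _ (Submodule.mem_sup_right (Submodule.smul_mem _ _ ?_))
          (Submodule.mem_sup_left (Submodule.smul_mem _ _ (hright _ hm _)))
        refine Submodule.subset_span ⟨l'.map (fun s => toLex (β, s)) ++ l₂, ?_, ?_, ?_⟩
        · refine List.pairwise_append.2 ⟨List.pairwise_map.2 (h1'.imp fun h => ?_), h2, ?_⟩
          · exact Prod.Lex.le_iff.2 (Or.inr ⟨rfl, h⟩)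
          · intro a ha b hb
            obtain ⟨s, -, rfl⟩ := List.mem_map.1 ha
            exact Prod.Lex.le_iff.2 (Or.inl (h3 b hb))
        · rw [← hk, ← hlk]
          simp only [List.map_append, List.map_map, List.sum_append]
          have : ∀ m : List ℤ, (m.map ((fun p : ι ×ₗ ℤ => ht (ofLex p).1) ∘ fun s => toLex (β, s))).sum
              = m.length * ht β := by
            intro m
            simp [Function.comp_def, List.map_const', List.sum_replicate]
          rw [this, this, hlen, List.length_cons]; ring
        · simp [hP₂, Function.comp_def]
      | zero => rw [zero_mul]; exact Submodule.zero_mem _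
      | add x y _ _ hx hy => rw [add_mul]; exact Submodule.add_mem _ hx hy
      | smul a x _ hx => rw [smul_mul_assoc]; exact Submodule.smul_mem _ _ hx
    obtain ⟨μ, -, hm⟩ := H.prod_transfer β ms
    have e2 : E β s * ((ms.map (fun s => toLex (β, s)) ++ l₂).map F).prod =
        E β s * ((ms.map fun s => F (toLex (β, s))).prod - μ • (ms.map (E β)).prod) * P₂ +
          μ • (((s :: ms).map (E β)).prod * P₂) := by
      simp only [List.map_append, List.map_map, List.prod_append, List.map_cons, List.prod_cons,
        mul_sub, sub_mul, mul_assoc, smul_mul_assoc, mul_smul_comm, Function.comp_def, hP₂]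
      module
    rw [e2]
    exact Submodule.add_mem _ (Submodule.mem_sup_left (hright _ (H.mul_low s hm) _))
      (Submodule.smul_mem _ _ (hS _ hsort))
  · refine Submodule.mem_sup_left ?_
    cases l with
    | nil => simp at hβ
    | cons p l =>
      have hp : (ofLex p).1 < β := by
        push Not at hβ
        obtain ⟨r, hr, hlt⟩ := hβ
        rcases List.mem_cons.1 hr with rfl | hr
        · exact hlt
        · have hle := List.rel_of_pairwise_cons hl hr
          rw [Prod.Lex.le_iff] at hle
          rcases hle with hle | hle
          · exact hle.trans hlt
          · exact hle.1.trans_lt hlt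
      rw [List.map_cons, List.prod_cons]
      exact H.mul_F (γ := (ofLex p).1) hp s (ofLex p).2 _

theorem pow_le_ordSpan (H : Straightening E F ht M π q)
    [WellFoundedLT ι] (k : ℕ) : M ^ k ≤ ordSpan K F ht k := by
  induction k using Nat.strong_induction_on with
  | _ k IH =>
    have A : ∀ β : ι, ∀ s, ∀ k', ht β + k' = k → ∀ y ∈ M ^ k', E β s * y ∈ ordSpan K F ht k := by
      intro β
      induction β using WellFoundedLT.induction with
      | _ β ih =>
        intro s k' hk y hy
        have hy' := IH k' (by have := H.pos β; omega) hy
        have hmem : ∀ y ∈ ordSpan K F ht k', E β s * y ∈ lowIdeal K E β ⊔ ordSpan K F ht k := by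
          intro y hy
          induction hy using Submodule.span_induction with
          | mem y hy =>
            obtain ⟨l, h1, h2, rfl⟩ := hy
            exact H.mul_prod_mem hk s l h1 h2
          | zero => rw [mul_zero]; exact Submodule.zero_mem _
          | add x y _ _ hx hy => rw [mul_add]; exact Submodule.add_mem _ hx hy
          | smul a x _ hx => rw [mul_smul_comm]; exact Submodule.smul_mem _ _ hx
        obtain ⟨j, hj, w, hw, hjw⟩ := Submodule.mem_sup.1 (hmem y hy')
        have hx : E β s * y ∈ M ^ k := by
          rw [← hk, pow_add]; exact Submodule.mul_mem_mul (H.memE β s) hy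
        have hjk : j ∈ M ^ k := by
          rw [eq_sub_of_add_eq hjw]
          exact Submodule.sub_mem _ hx (H.ordSpan_le k hw)
        rw [← hjw]
        exact Submodule.add_mem _ (H.low_mem ih hj hjk) hw
    cases k with
    | zero =>
      rw [pow_zero, Submodule.one_eq_span, Submodule.span_singleton_le_iff_mem]
      exact Submodule.subset_span ⟨[], by simp⟩
    | succ k =>
      rw [pow_succ', Submodule.mul_le]
      intro m hm y hy
      have hm' := H.gen hm
      clear hm
      induction hm' using Submodule.span_induction with
      | mem x hx =>
        obtain ⟨β, s, rfl, h1⟩ := hx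
        exact A β s k (by omega) y hy
      | zero => rw [zero_mul]; exact Submodule.zero_mem _
      | add x y _ _ hx hy => rw [add_mul]; exact Submodule.add_mem _ hx hy
      | smul a x _ hx => rw [smul_mul_assoc]; exact Submodule.smul_mem _ _ hx

end Straightening
end SortedSpan

section RootIndices

theorem rootIdx_of_root {n : ℕ} (β : PosRootD n) : RootIdx n (riD β) (rtD β) := by
  obtain ⟨h1, h2, h3⟩ := β.2
  have h4 : riD β < n + 1 := (ofLex β.1).1.2
  change 1 ≤ riD β at h1
  change n - 1 ≤ riD β → rtD β = 0 at h2
  change rtD β = 0 ∨ rtD β + 2 * riD β + 1 ≤ 2 * n at h3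
  unfold RootIdx
  omega

/-- The positive root encoded by `(i,t)`. -/
def mkRoot {n i t : ℕ} (h : RootIdx n i t) : PosRootD n :=
  ⟨toLex (⟨i, by unfold RootIdx at h; omega⟩, ⟨t, by unfold RootIdx at h; omega⟩),
    h.1, by
      unfold RootIdx at h
      change n - 1 ≤ i → t = 0
      omega, by
      unfold RootIdx at h
      change t = 0 ∨ t + 2 * i + 1 ≤ 2 * n
      omega⟩

theorem riD_mkRoot {n i t : ℕ} (h : RootIdx n i t) : riD (mkRoot h) = i := rfl
theorem rtD_mkRoot {n i t : ℕ} (h : RootIdx n i t) : rtD (mkRoot h) = t := rfl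

theorem root_lt_iff {n : ℕ} (γ β : PosRootD n) :
    γ < β ↔ riD γ < riD β ∨ (riD γ = riD β ∧ rtD γ < rtD β) := by
  rw [← Subtype.coe_lt_coe, Prod.Lex.lt_iff, Fin.lt_def, Fin.lt_def, Fin.ext_iff]
  rfl

theorem root_ext {n : ℕ} {γ β : PosRootD n} (h1 : riD γ = riD β) (h2 : rtD γ = rtD β) : γ = β := by
  have a := root_lt_iff γ β
  have b := root_lt_iff β γ
  by_contra hne
  rcases lt_or_gt_of_ne hne with h | h
  · have := a.1 h; omega
  · have := b.1 h; omega

end RootIndices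

section Tilde
variable {n : ℕ}

theorem generic_vpow (ε : Bool) : Generic vv (vpow (sgn ε)) := by
  have h : vpow (sgn ε) + (vpow (sgn ε))⁻¹ = vv + vv⁻¹ :=
    vpow_add_inv _ (by cases ε <;> simp [sgn])
  refine ⟨vv_ne_zero, vpow_ne_zero _, two_ne_zero, ?_, h⟩
  intro h0
  apply vv_add_inv_ne_zero
  rw [← h]
  have := vpow_ne_zero (sgn ε)
  field_simp
  linear_combination h0

theorem wordN_eq_cons {i t : ℕ} (h : RootIdx n i t) : wordN n i t = i :: (wordN n i t).tail := by
  refine edge_induction h.1 (P := fun t => wordN n i t = i :: (wordN n i t).tail) ?_ ?_ t h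
  · rw [wordN_zero h.2.1]; rfl
  · intro t c t' he ih
    rw [wordN_edge he, List.tail_append_of_ne_nil (wordN_ne_nil (he.1.rootIdx h.1))]
    rw [← List.cons_append, ← ih]

theorem chainE_replicate (g : ℕ → ℤ → UD n) (u : KK) (T : ℕ → ℤ) (i : ℕ) (w : List ℕ) :
    chainE g (i :: w) ((i :: w).map T) (List.replicate w.length u) =
      (w.map fun c => g c (T c)).foldl (qb u) (g i (T i)) := by
  simp only [chainE, List.map_cons]
  generalize g i (T i) = x
  induction w generalizing x with
  | nil => rfl
  | cons c w ih =>
    simp only [List.map_cons, List.length_cons, List.replicate_succ, List.zip_cons_cons,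
      List.foldl_cons]
    exact ih _

theorem tildeED_eq (ε : Bool) (β : PosRootD n) (T : ℕ → ℤ) :
    tildeED ε β T = vecFrom (vpow (sgn ε)) (fun c => genD n c (T c)) n (riD β) (rtD β)
      (genD n (riD β) (T (riD β))) := by
  unfold tildeED vecFrom
  rw [wordD_eq_wordN]
  have h := wordN_eq_cons (rootIdx_of_root β)
  set w := (wordN n (riD β) (rtD β)).tail
  rw [h, List.length_cons, Nat.add_sub_cancel, chainE_replicate]

/-- The height of a positive root. -/
def htD (β : PosRootD n) : ℕ := (wordN n (riD β) (rtD β)).length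

theorem htD_pos (β : PosRootD n) : 1 ≤ htD β :=
  List.length_pos_iff.2 (wordN_ne_nil (rootIdx_of_root β))

end Tilde

section Grading
variable {K : Type} [Field K] {B : Type} [Ring B] [Algebra K B]

open Polynomial in
theorem LoopRel.monomial {v : K} {n : ℕ} {e : ℕ → ℤ → B} (h : LoopRel v n e) :
    LoopRel v n (fun i r => Polynomial.monomial 1 (e i r)) where
  loop i j r s := by
    simp only [monomial_mul_monomial, smul_monomial, ← map_sub, h.loop]
  comm i j r s h1 h2 := by
    simp only [monomial_mul_monomial, h.comm i j r s h1 h2]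
  serre i j r s t h1 := by
    simp only [monomial_mul_monomial, smul_monomial, ← map_sub, ← map_add]
    rw [← map_zero (Polynomial.monomial (1 + 1 + 1)), ← h.serre i j r s t h1]
  zero i r h1 := by simp only [h.zero i r h1, map_zero]

variable (n : ℕ)

/-- The span of the generators. -/
def genSpan : Submodule KK (UD n) := Submodule.span KK {x | ∃ i r, x = genD n i r}

theorem iSup_genSpan (x : UD n) : x ∈ ⨆ k, genSpan n ^ k := by
  obtain ⟨a, rfl⟩ := RingQuot.mkAlgHom_surjective KK (URel n (aD n) (dD n)) x
  induction a using FreeAlgebra.induction with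
  | grade0 r =>
    refine Submodule.mem_iSup_of_mem 0 ?_
    rw [pow_zero, AlgHom.commutes]
    exact Submodule.algebraMap_mem r
  | grade1 p =>
    refine Submodule.mem_iSup_of_mem 1 ?_
    rw [pow_one]
    refine Submodule.subset_span ⟨p.1.1 + 1, p.2, ?_⟩
    rw [genD, g1_fin]; rfl
  | mul a b ha hb =>
    rw [map_mul]
    have := Submodule.mul_mem_mul ha hb
    rw [Submodule.iSup_mul] at this
    refine (iSup_le fun k => ?_ : (⨆ i, genSpan n ^ i * ⨆ i, genSpan n ^ i) ≤ _) this
    rw [Submodule.mul_iSup]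
    refine iSup_le fun l => ?_
    rw [← pow_add]
    exact le_iSup (fun k => genSpan n ^ k) (k + l)
  | add a b ha hb => rw [map_add]; exact Submodule.add_mem _ ha hb

theorem exists_grading : ∃ π : ℕ → UD n →ₗ[KK] UD n,
    (∀ h k x b, x ∈ genSpan n ^ h → π (h + k) (x * b) = x * π k b) ∧
    (∀ h k x b, x ∈ genSpan n ^ h → k < h → π k (x * b) = 0) ∧
    (∀ k b, π k b ∈ genSpan n ^ k) ∧ (∀ k x, x ∈ genSpan n ^ k → π k x = x) := by
  obtain ⟨φ, hφ⟩ := exists_lift (genD_rel n).monomial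
  have hmono : ∀ h x, x ∈ genSpan n ^ h → φ x = Polynomial.monomial h x := by
    have h1 : ∀ x ∈ genSpan n, φ x = Polynomial.monomial 1 x := by
      intro x hx
      induction hx using Submodule.span_induction with
      | mem x hx => obtain ⟨i, r, rfl⟩ := hx; exact hφ i r
      | zero => simp
      | add x y _ _ hx hy => rw [map_add, map_add, hx, hy]
      | smul a x _ hx => rw [map_smul, hx, Polynomial.smul_monomial]
    intro h
    induction h with
    | zero =>
      intro x hx
      rw [pow_zero, Submodule.mem_one] at hx
      obtain ⟨a, rfl⟩ := hx
      rw [AlgHom.commutes]; rfl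
    | succ h ih =>
      intro x hx
      rw [pow_succ'] at hx
      induction hx using Submodule.mul_induction_on' with
      | mem_mul_mem a ha b hb =>
        rw [map_mul, h1 a ha, ih b hb, Polynomial.monomial_mul_monomial, add_comm]
      | add x _ y _ hx hy => rw [map_add, map_add, hx, hy]
  let π : ℕ → UD n →ₗ[KK] UD n := fun k =>
    { toFun := fun b => (φ b).coeff k
      map_add' := fun a b => by simp
      map_smul' := fun c a => by simp }
  have hπ : ∀ k b, π k b = (φ b).coeff k := fun _ _ => rfl
  have hself : ∀ k x, x ∈ genSpan n ^ k → π k x = x := by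
    intro k x hx
    rw [hπ, hmono k x hx, Polynomial.coeff_monomial_same]
  refine ⟨π, ?_, ?_, ?_, hself⟩
  · intro h k x b hx
    rw [hπ, hπ, map_mul, hmono h x hx, add_comm, Polynomial.coeff_monomial_mul]
  · intro h k x b hx hk
    rw [hπ, map_mul, hmono h x hx, ← Polynomial.C_mul_X_pow_eq_monomial, mul_assoc,
      Polynomial.X_pow_mul, ← mul_assoc, Polynomial.coeff_mul_X_pow', if_neg (by omega)]
  · intro k b
    have hb := iSup_genSpan n b
    induction hb using Submodule.iSup_induction' with
    | mem l x hx =>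
      by_cases hkl : l = k
      · subst hkl; rw [hself _ _ hx]; exact hx
      · rw [hπ, hmono l x hx, Polynomial.coeff_monomial, if_neg hkl]; exact Submodule.zero_mem _
    | zero => rw [map_zero]; exact Submodule.zero_mem _
    | add x y _ _ hx hy => rw [map_add]; exact Submodule.add_mem _ hx hy

variable {n}

theorem foldl_qb_mem_pow (u : KK) {M : Submodule KK (UD n)} (l : List (UD n))
    (hl : ∀ y ∈ l, y ∈ M) {a : ℕ} {x : UD n} (hx : x ∈ M ^ a) :
    l.foldl (qb u) x ∈ M ^ (a + l.length) := by
  induction l generalizing x a with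
  | nil => exact hx
  | cons y l ih =>
    rw [List.foldl_cons, List.length_cons, add_comm l.length, ← add_assoc]
    have hy := hl y (by simp)
    refine ih (fun z hz => hl z (by simp [hz])) (Submodule.sub_mem _ ?_ (Submodule.smul_mem _ u ?_))
    · rw [pow_succ]; exact Submodule.mul_mem_mul hx hy
    · rw [pow_succ']; exact Submodule.mul_mem_mul hy hx

theorem vecFrom_mem_pow (u : KK) (y : ℕ → UD n) (hy : ∀ c, y c ∈ genSpan n) {x : UD n}
    (hx : x ∈ genSpan n) (β : PosRootD n) :
    vecFrom u y n (riD β) (rtD β) x ∈ genSpan n ^ htD β := by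
  have h := wordN_eq_cons (rootIdx_of_root β)
  have := foldl_qb_mem_pow u (M := genSpan n) ((wordN n (riD β) (rtD β)).tail.map y) (by
    intro z hz
    obtain ⟨c, -, rfl⟩ := List.mem_map.1 hz
    exact hy c) (a := 1) (by simpa using hx)
  unfold htD
  rw [h]
  rw [List.length_map] at this
  rwa [List.length_cons, add_comm]

theorem genD_mem_genSpan (i : ℕ) (r : ℤ) : genD n i r ∈ genSpan n :=
  Submodule.subset_span ⟨i, r, rfl⟩

end Grading

section Spanning
variable {n : ℕ}

theorem blockIdeal_le_lowIdeal (u : KK) (β : PosRootD n) :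
    blockIdeal u (genD n) n (riD β) (· < rtD β) ≤
      lowIdeal KK (fun γ s => loopVec u (genD n) n (riD γ) (rtD γ) s) β := by
  refine rightIdeal_mono ?_
  rintro x ⟨t, s, h1, h2, rfl⟩
  exact ⟨mkRoot h2, (root_lt_iff _ _).2 (Or.inr ⟨rfl, h1⟩), s, rfl⟩

theorem blockIdeal_le_lowIdeal' (u : KK) {i : ℕ} (β : PosRootD n) (hi : i < riD β) :
    blockIdeal u (genD n) n i (fun _ => True) ≤
      lowIdeal KK (fun γ s => loopVec u (genD n) n (riD γ) (rtD γ) s) β := by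
  refine rightIdeal_mono ?_
  rintro x ⟨t, s, h1, h2, rfl⟩
  exact ⟨mkRoot h2, (root_lt_iff _ _).2 (Or.inl hi), s, rfl⟩

/-- The products of the root vectors `Ẽ`, in increasing order, span `U_v^>(Lo_{2n})`. -/
theorem mem_span_ordered (ε : Bool) (T : PosRootD n × ℤ → (ℕ → ℤ))
    (hT : ∀ p : PosRootD n × ℤ, sOfD p.1 (T p) = p.2) (x : UD n) :
    x ∈ Submodule.span KK {x | ∃ l : List (PosRootD n ×ₗ ℤ), l.Pairwise (· ≤ ·) ∧
      x = (l.map fun p => tildeED ε (ofLex p).1 (T (ofLex p))).prod} := by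
  obtain ⟨π, p1, p2, p3, p4⟩ := exists_grading n
  have hg := generic_vpow ε
  have h := genD_rel n
  set u := vpow (sgn ε)
  have H : Straightening (K := KK) (fun (β : PosRootD n) s => loopVec u (genD n) n (riD β) (rtD β) s)
      (fun p : PosRootD n ×ₗ ℤ => tildeED ε (ofLex p).1 (T (ofLex p))) htD (genSpan n) π
      (vv * vv) := by
    refine ⟨two_ne_zero, htD_pos, ?_, ?_, p1, p2, p3, p4, ?_, ?_, ?_, ?_⟩
    · intro β s
      exact vecFrom_mem_pow u _ (fun c => genD_mem_genSpan c 0) (genD_mem_genSpan _ s) β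
    · intro p
      rw [tildeED_eq]
      exact vecFrom_mem_pow u _ (fun c => genD_mem_genSpan c _) (genD_mem_genSpan _ _) _
    · refine Submodule.span_le.2 ?_
      rintro _ ⟨i, r, rfl⟩
      by_cases hi : 1 ≤ i ∧ i ≤ n
      · have hr : RootIdx n i 0 := ⟨hi.1, hi.2, Or.inl rfl⟩
        refine Submodule.subset_span ⟨mkRoot hr, r, ?_, ?_⟩
        · rw [riD_mkRoot, rtD_mkRoot, loopVec, vecFrom_zero _ _ hi.2]
        · rw [htD, riD_mkRoot, rtD_mkRoot, wordN_zero hi.2]; rfl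
      · rw [h.zero i r hi]; exact Submodule.zero_mem _
    · intro β γ s s' hlt
      have hβ := rootIdx_of_root β
      have hγ := rootIdx_of_root γ
      rcases (root_lt_iff _ _).1 hlt with h1 | ⟨h1, h2⟩
      · exact blockIdeal_le_lowIdeal' u β h1
          (loopVec_mul_mem_block h hg hγ.1 h1 hβ s (loopVec_mem hγ trivial s'))
      · rw [h1] at hγ ⊢
        exact blockIdeal_le_lowIdeal u β (mul_mem_lt h hg hβ.1 _ hβ _ hγ h2 s s')
    · intro β a b
      have hβ := rootIdx_of_root β
      exact blockIdeal_le_lowIdeal u β (pre_le_lt (quad_rel_mem h hg hβ.1 _ hβ a b))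
    · intro β s
      have hβ := rootIdx_of_root β
      obtain ⟨μ, hμ, hm⟩ := vecFrom_transfer h hg hβ.1 (T (β, s)) _ hβ
      refine ⟨μ, hμ, ?_⟩
      have hs : ((wordN n (riD β) (rtD β)).map (T (β, s))).sum = s := hT (β, s)
      rw [hs, ← tildeED_eq] at hm
      exact blockIdeal_le_lowIdeal u β (pre_le_lt hm)
  have hx := iSup_genSpan n x
  refine (iSup_le fun k => (H.pow_le_ordSpan k).trans (Submodule.span_mono ?_) :
    (⨆ k, genSpan n ^ k) ≤ _) hx
  rintro x ⟨l, h1, -, h2⟩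
  exact ⟨l, h1, h2⟩

end Spanning

section LusztigMembership
variable {n : ℕ}

theorem isQuantumInt_vpow (ε : Bool) : IsQuantumInt (vpow (sgn ε)) (qInt vv) where
  zero := qInt_zero
  one := qInt_one
  add r s := by
    have hv := vv_ne_zero
    have hd := vv_sub_inv_ne_zero
    cases ε
    all_goals
      simp only [qInt, vpow, sgn, zpow_neg, zpow_one, zpow_natCast, Nat.cast_add, zpow_add₀ hv,
        Bool.false_eq_true, if_false, if_true, inv_inv, inv_pow]
      field_simp
      ring
  ne_zero := qInt_succ_ne_zero

theorem tildeEPowD_eq (ε : Bool) (β : PosRootD n) (T : ℕ → ℤ) (k : ℕ) :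
    tildeEPowD ε β T k = dpow (qInt vv) (tildeED ε β T) k := rfl

theorem algebraMap_mem_LusFormD {a : KK} (ha : a ∈ Rint) : algebraMap KK (UD n) a ∈ LusFormD n := by
  have : Rint ≤ (LusFormD n).comap (algebraMap KK (UD n)) := by
    refine Subring.closure_le.2 ?_
    rintro x (rfl | rfl)
    · exact Subring.subset_closure (Or.inl (by simp))
    · exact Subring.subset_closure (Or.inl (by simp))
  exact this ha

theorem smul_mem_LusFormD {a : KK} (ha : a ∈ Rint) {x : UD n} (hx : x ∈ LusFormD n) :
    a • x ∈ LusFormD n := by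
  rw [Algebra.smul_def]
  exact (LusFormD n).mul_mem (algebraMap_mem_LusFormD ha) hx

theorem vv_mem_Rint : vv ∈ Rint := Subring.subset_closure (by simp)
theorem vv_inv_mem_Rint : vv⁻¹ ∈ Rint := Subring.subset_closure (by simp)

theorem vpow_mem_Rint (m : ℤ) : vpow m ∈ Rint := by
  unfold vpow
  obtain ⟨k, rfl | rfl⟩ := m.eq_nat_or_neg
  · rw [zpow_natCast]; exact Rint.pow_mem vv_mem_Rint k
  · rw [zpow_neg, zpow_natCast, ← inv_pow]; exact Rint.pow_mem vv_inv_mem_Rint k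

theorem dpow_genD_mem (i : ℕ) (r : ℤ) (k : ℕ) : dpow (qInt vv) (genD n i r) k ∈ LusFormD n := by
  by_cases hi : 1 ≤ i ∧ i ≤ n
  · obtain ⟨j, rfl⟩ := exists_fin_of_range hi
    rw [genD, g1_fin]
    exact Subring.subset_closure (Or.inr ⟨j, r, k, rfl⟩)
  · rw [(genD_rel n).zero i r hi]
    cases k with
    | zero => rw [dpow_zero]; exact Subring.one_mem _
    | succ k => simp only [dpow, pow_succ, mul_zero, smul_zero]; exact Subring.zero_mem _

theorem tildeEPowD_mem (ε : Bool) (β : PosRootD n) (T : ℕ → ℤ) (k : ℕ) :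
    tildeEPowD ε β T k ∈ LusFormD n := by
  rw [tildeEPowD_eq, tildeED_eq]
  have hβ := rootIdx_of_root β
  revert k
  refine edge_induction hβ.1 (P := fun t => ∀ k, dpow (qInt vv) (vecFrom (vpow (sgn ε))
    (fun c => genD n c (T c)) n (riD β) t (genD n (riD β) (T (riD β)))) k ∈ LusFormD n) ?_ ?_ _ hβ
  · intro k
    rw [vecFrom_zero _ _ hβ.2.1]
    exact dpow_genD_mem _ _ _
  · intro t0 c t he ih k
    rw [vecFrom_edge _ _ hβ.1 he]
    obtain ⟨h1, h2⟩ := vecFrom_ser (genD_rel n) (generic_vpow ε) hβ.1 he.1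
      (y := fun c => genD n c (T c)) (fun c => mem_span_range _ c _)
      (x := genD n (riD β) (T (riD β))) (mem_span_range _ _ _)
    exact dpow_qb_mem (isQuantumInt_vpow ε) (vpow_ne_zero _) h1 h2
      (fun b hb => smul_mem_LusFormD (vpow_mem_Rint _) hb) k ih fun k => dpow_genD_mem _ _ _

theorem lusMonD_mem (ε : Bool) (T : PosRootD n × ℤ → (ℕ → ℤ)) (h : Lex (PosRootD n × ℤ) →₀ ℕ) :
    lusMonD ε T h ∈ LusFormD n := by
  refine Subring.list_prod_mem _ fun x hx => ?_
  obtain ⟨p, -, rfl⟩ := List.mem_map.1 hx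
  exact tildeEPowD_mem _ _ _ _

/-- The increasing list of the indices of an ordered monomial, with multiplicities. -/
def sortedList {ι : Type} [LinearOrder ι] (h : ι →₀ ℕ) : List ι :=
  (Finsupp.toMultiset h).sort (· ≤ ·)

/-- The product of the quantum factorials of the multiplicities. -/
def factProd {ι : Type} (h : ι →₀ ℕ) : KK := h.prod fun _ k => qFact vv k

theorem factProd_ne_zero {ι : Type} (h : ι →₀ ℕ) : factProd h ≠ 0 :=
  Finset.prod_ne_zero_iff.2 fun _ _ => qFact_ne_zero _

theorem sort_toMultiset {ι : Type} [LinearOrder ι] (h : ι →₀ ℕ) :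
    sortedList h = (h.support.sort (· ≤ ·)).flatMap fun p => List.replicate (h p) p := by
  refine List.Perm.eq_of_pairwise (le := (· ≤ ·)) (fun a b _ _ h1 h2 => le_antisymm h1 h2)
    (Multiset.pairwise_sort _ _) ?_ ?_
  · rw [List.pairwise_flatMap]
    refine ⟨fun a _ => List.pairwise_replicate.2 (Or.inr le_rfl), ?_⟩
    refine (Finset.pairwise_sort _ _).imp fun {a b} hab x hx y hy => ?_
    rw [List.eq_of_mem_replicate hx, List.eq_of_mem_replicate hy]
    exact hab
  · rw [List.perm_iff_count]
    intro a
    have : Multiset.count a (Finsupp.toMultiset h) = h a := Finsupp.count_toMultiset h a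
    rw [← Multiset.coe_count, sortedList, Multiset.sort_eq, this, List.count_flatMap]
    have e : ∀ l : List ι, l.Nodup → (l.map (List.count a ∘ fun p => List.replicate (h p) p)).sum =
        if a ∈ l then h a else 0 := by
      intro l hl
      induction l with
      | nil => simp
      | cons b l ih =>
        rw [List.map_cons, List.sum_cons, ih hl.of_cons]
        by_cases hab : b = a
        · subst hab
          simp [(List.nodup_cons.1 hl).1]
        · simp [List.count_replicate, hab, Ne.symm hab]
    rw [e _ (Finset.sort_nodup _ _)]
    by_cases ha : a ∈ h.support
    · simp [ha]
    · simp [Finsupp.notMem_support_iff.1 ha]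

theorem lusMonD_eq (ε : Bool) (T : PosRootD n × ℤ → (ℕ → ℤ)) (h : Lex (PosRootD n × ℤ) →₀ ℕ) :
    lusMonD ε T h = (factProd h)⁻¹ •
      ((sortedList h).map fun p => tildeED ε (ofLex p).1 (T (ofLex p))).prod := by
  have e : factProd h = ((h.support.sort (· ≤ ·)).map fun p => qFact vv (h p)).prod := by
    rw [factProd, Finsupp.prod, Finset.prod_eq_multiset_prod, ← Multiset.prod_coe,
      ← Multiset.map_coe, Finset.sort_eq]
  rw [sort_toMultiset, e, lusMonD]
  generalize h.support.sort (· ≤ ·) = l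
  induction l with
  | nil => simp
  | cons p l ih =>
    rw [List.map_cons, List.prod_cons, ih, List.flatMap_cons, List.map_append, List.prod_append,
      List.map_replicate, List.prod_replicate, List.map_cons, List.prod_cons, mul_inv,
      tildeEPowD, smul_mul_smul_comm]

theorem exists_sortedList {ι : Type} [LinearOrder ι] (l : List ι) (hl : l.Pairwise (· ≤ ·)) :
    ∃ h : ι →₀ ℕ, sortedList h = l := by
  refine ⟨Multiset.toFinsupp (l : Multiset ι), ?_⟩
  rw [sortedList, Multiset.toFinsupp_toMultiset]
  refine List.Perm.eq_of_pairwise (le := (· ≤ ·)) (fun a b _ _ h1 h2 => le_antisymm h1 h2)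
    (Multiset.pairwise_sort _ _) hl ?_
  rw [← Multiset.coe_eq_coe, Multiset.sort_eq]

theorem sortedList_injective {ι : Type} [LinearOrder ι] :
    Function.Injective (sortedList : (ι →₀ ℕ) → List ι) := by
  intro h h' he
  have : Function.Injective (Finsupp.toMultiset : (ι →₀ ℕ) → Multiset ι) :=
    fun a b hab => by rw [← Finsupp.toMultiset_toFinsupp a, hab, Finsupp.toMultiset_toFinsupp]
  apply this
  rw [← Multiset.sort_eq (Finsupp.toMultiset h) (· ≤ ·),
    ← Multiset.sort_eq (Finsupp.toMultiset h') (· ≤ ·)]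
  exact congrArg _ he

theorem mem_span_lusMonD (ε : Bool) (T : PosRootD n × ℤ → (ℕ → ℤ))
    (hT : ∀ p : PosRootD n × ℤ, sOfD p.1 (T p) = p.2) (x : UD n) :
    x ∈ Submodule.span KK (Set.range (lusMonD ε T)) := by
  refine (Submodule.span_le.2 ?_ : _ ≤ _) (mem_span_ordered ε T hT x)
  rintro x ⟨l, hl, rfl⟩
  obtain ⟨h, rfl⟩ := exists_sortedList l hl
  have : ((sortedList h).map fun p => tildeED ε (ofLex p).1 (T (ofLex p))).prod =
      factProd h • lusMonD ε T h := by
    rw [lusMonD_eq, smul_inv_smul₀ (factProd_ne_zero h)]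
  rw [this]
  exact Submodule.smul_mem _ _ (Submodule.subset_span ⟨h, rfl⟩)

end LusztigMembership

section ClusterStates

/-- Color `c` can be removed from the state `b` of a cluster of block `i`; the state `0` is empty
and the state `t+1` is the root `(i,t)`. -/
def CanRem (n i b c : ℕ) : Prop :=
  1 ≤ i ∧ i ≤ n ∧ ((b = 1 ∧ c = i) ∨ (i + 2 ≤ n ∧ b + 2 * i ≤ 2 * n ∧ 2 ≤ b ∧
    ((b + i < n + 1 ∧ c + 1 = b + i) ∨ (c = n ∧ (b + i = n + 1 ∨ b + i = n + 2)) ∨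
      (n + 2 ≤ b + i ∧ c + b + i = 2 * n + 1))))

instance (n i b c : ℕ) : Decidable (CanRem n i b c) := by unfold CanRem; infer_instance

/-- The state obtained by removing the color `c`. -/
def remState (n i b c : ℕ) : ℕ := if c = n ∧ i ≠ n then b - 2 else b - 1

/-- The exponent of the point removed from the state `b`. -/
def remExp (n i b : ℕ) : ℤ :=
  if b + i ≤ n then 1 - b else if b + i = n + 1 then 2 - b else 3 - b

/-- The positions of a cluster which are occupied in the state `b`. -/
def occupied (n i b : ℕ) : Finset ℕ := (Finset.range (b + 1)).filter fun k =>
  1 ≤ k ∧ ((b + i ≤ n ∧ k ≤ b) ∨ (b + i = n + 1 ∧ (k + i < n ∨ k + i = n + 1)) ∨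
    (n + 2 ≤ b + i ∧ k < b))

/-- The color of the `k`-th position of a cluster. -/
def posColor (n i k : ℕ) : ℕ :=
  if k + i ≤ n then i + k - 1 else if k + i = n + 1 then n else 2 * n - i - k

/-- The exponent of the `k`-th position of a cluster. -/
def posExp (n i k : ℕ) : ℤ := if k + i ≤ n then 1 - k else 2 - k

variable {n i b c d : ℕ}

theorem mem_occupied {k : ℕ} : k ∈ occupied n i b ↔
    1 ≤ k ∧ ((b + i ≤ n ∧ k ≤ b) ∨ (b + i = n + 1 ∧ (k + i < n ∨ k + i = n + 1)) ∨
    (n + 2 ≤ b + i ∧ k < b)) := by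
  unfold occupied
  rw [Finset.mem_filter, Finset.mem_range]
  omega

theorem occupied_zero (hi : i ≤ n) : occupied n i 0 = ∅ := by
  ext k; rw [mem_occupied]; simp; omega

theorem occupied_rem (h : CanRem n i b c) : ∃ k, k ∉ occupied n i (remState n i b c) ∧
    occupied n i b = insert k (occupied n i (remState n i b c)) ∧ posColor n i k = c ∧
    posExp n i k = remExp n i b := by
  suffices key : ∃ k, (∀ m, m ∈ occupied n i b ↔ m = k ∨ m ∈ occupied n i (remState n i b c)) ∧
      k ∉ occupied n i (remState n i b c) ∧ posColor n i k = c ∧ posExp n i k = remExp n i b by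
    obtain ⟨k, h1, h2, h3, h4⟩ := key
    exact ⟨k, h2, by ext m; rw [Finset.mem_insert, h1], h3, h4⟩
  simp only [mem_occupied, remState, posColor, posExp, remExp]
  rcases h with ⟨h7, h8, ⟨rfl, rfl⟩ | ⟨h1, h2, h3, ⟨h4, h5⟩ | ⟨rfl, h4 | h4⟩ | ⟨h4, h5⟩⟩⟩
  · exact ⟨1, by split_ifs <;> omega, by split_ifs <;> omega, by split_ifs <;> omega,
      by split_ifs <;> omega⟩
  · exact ⟨b, by split_ifs <;> omega, by split_ifs <;> omega, by split_ifs <;> omega,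
      by split_ifs <;> omega⟩
  · exact ⟨b, by split_ifs <;> omega, by split_ifs <;> omega, by split_ifs <;> omega,
      by split_ifs <;> omega⟩
  · exact ⟨(b - 1), by split_ifs <;> omega, by split_ifs <;> omega, by split_ifs <;> omega,
      by split_ifs <;> omega⟩
  · by_cases h6 : b + i = n + 2
    · exact ⟨(b - 2), by split_ifs <;> omega, by split_ifs <;> omega, by split_ifs <;> omega,
      by split_ifs <;> omega⟩
    · exact ⟨(b - 1), by split_ifs <;> omega, by split_ifs <;> omega, by split_ifs <;> omega,
      by split_ifs <;> omega⟩

theorem rem_ne (h1 : CanRem n i b c) (h2 : CanRem n i (remState n i b c) d) : c ≠ d := by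
  rintro rfl
  unfold CanRem at h1
  unfold CanRem remState at h2
  split_ifs at * <;> omega

theorem rem_rem (h1 : CanRem n i b c) (h2 : CanRem n i (remState n i b c) d) :
    (aD n c d = -1 ∧ remExp n i b = remExp n i (remState n i b c) - 1 ∧
      ¬ (CanRem n i b d ∧ CanRem n i (remState n i b d) c)) ∨
    (aD n c d = 0 ∧ CanRem n i b d ∧ CanRem n i (remState n i b d) c ∧
      remState n i (remState n i b c) d = remState n i (remState n i b d) c ∧
      remExp n i b = remExp n i (remState n i b c) ∧
      remExp n i b = remExp n i (remState n i b d)) := by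
  rw [aD_eq_neg_one_iff, aD_eq_zero_iff]
  have hne := rem_ne h1 h2
  by_cases hsq : b + i = n + 2 ∧ i + 2 ≤ n
  · right
    unfold CanRem at h1
    unfold CanRem remState at h2
    unfold CanRem remState remExp Adj
    split_ifs at * <;> omega
  · left
    obtain ⟨_, _, h1⟩ := h1
    obtain ⟨_, _, h2⟩ := h2
    rw [not_and_or]
    rcases h1 with h1 | ⟨_, _, _, h1 | h1 | h1⟩ <;> rcases h2 with h2 | ⟨_, _, _, h2 | h2 | h2⟩ <;>
    (unfold remState at h2
     split_ifs at h2 <;> first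
      | omega
      | (refine ⟨by unfold Adj; omega, by unfold remExp remState; split_ifs <;> omega,
          Or.inl fun h3 => ?_⟩
         obtain ⟨_, _, h3 | ⟨_, _, _, h3 | h3 | h3⟩⟩ := h3 <;> omega))

theorem rem_rem_rem (h1 : CanRem n i b c) (h2 : CanRem n i (remState n i b c) d) :
    ¬ CanRem n i (remState n i (remState n i b c) d) c := by
  intro h3
  obtain ⟨_, _, h1⟩ := h1
  obtain ⟨_, _, h2⟩ := h2
  obtain ⟨_, _, h3⟩ := h3
  rcases h1 with h1 | ⟨_, _, _, h1 | h1 | h1⟩ <;> rcases h2 with h2 | ⟨_, _, _, h2 | h2 | h2⟩ <;>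
    first
    | (unfold remState at h2; split_ifs at h2 <;> omega)
    | (unfold remState at h2 h3; split_ifs at h2 h3 <;> omega)

end ClusterStates

section Zeta
variable {F : Type} [Field F]

/-- The structure function of the shuffle product. -/
def zeta (v : F) (n c d : ℕ) (z w : F) : F :=
  if c = d then (v ^ 2 * z - w) / (z - w)
  else if c < d then (v ^ aD n c d * z - w) / (z - v ^ aD n c d * w) else 1

variable {v : F} {n c d : ℕ} {z w x : F}

theorem zeta_loop (hv : v ≠ 0) (h : ∀ k : ℤ, z ≠ v ^ k * w) :
    (z - v ^ aD n c d * w) * zeta v n c d z w = (v ^ aD n c d * z - w) * zeta v n d c w z := by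
  have h0 : z - w ≠ 0 := sub_ne_zero.2 (by simpa using h 0)
  have h0' : w - z ≠ 0 := by rw [← neg_sub]; exact neg_ne_zero.2 h0
  rcases lt_trichotomy c d with hcd | rfl | hcd
  · have h1 : z - v ^ aD n c d * w ≠ 0 := sub_ne_zero.2 (h _)
    simp only [zeta, hcd.ne, hcd.ne', hcd, not_lt_of_gt hcd, if_false, if_true]
    field_simp
  · simp only [zeta, if_true, aD_self]
    rw [← neg_sub z w]
    norm_cast
    field_simp
    ring
  · have h1 : w - v ^ aD n c d * z ≠ 0 := by
      intro h'
      apply h (-aD n c d)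
      rw [zpow_neg, eq_inv_mul_iff_mul_eq₀ (zpow_ne_zero _ hv)]
      linear_combination -h'
    simp only [zeta, hcd.ne, hcd.ne', hcd, not_lt_of_gt hcd, if_false, if_true, aD_symm n d c]
    rw [mul_one, mul_div_assoc', eq_div_iff h1]
    ring

theorem zeta_comm (h : z ≠ w) (hcd : c ≠ d) (ha : aD n c d = 0) :
    zeta v n c d z w = zeta v n d c w z := by
  have h0 : z - w ≠ 0 := sub_ne_zero.2 h
  have h0' : w - z ≠ 0 := by rw [← neg_sub]; exact neg_ne_zero.2 h0
  have ha' : aD n d c = 0 := by rw [aD_symm]; exact ha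
  unfold zeta
  rw [if_neg hcd, if_neg (Ne.symm hcd), ha, ha']
  split_ifs <;> simp [div_self, h0, h0']

/-- The two variable values of `zeta` for adjacent colors. -/
theorem zeta_adj (hv : v ≠ 0) (ha : aD n c d = -1) (h : ∀ k : ℤ, z ≠ v ^ k * w) :
    ∃ p : F, zeta v n c d z w = p * (v⁻¹ * z - w) ∧ zeta v n d c w z = p * (z - v⁻¹ * w) := by
  have hl := zeta_loop (n := n) (c := c) (d := d) hv h
  rw [ha, zpow_neg_one] at hl
  have h1 : z - v⁻¹ * w ≠ 0 := sub_ne_zero.2 (by simpa using h (-1))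
  refine ⟨zeta v n d c w z / (z - v⁻¹ * w), ?_, by rw [div_mul_cancel₀ _ h1]⟩
  rw [div_mul_eq_mul_div, eq_div_iff h1]
  linear_combination hl

theorem zeta_self_add (h : z ≠ w) : zeta v n c c z w + zeta v n c c w z = 1 + v ^ 2 := by
  have h0 : z - w ≠ 0 := sub_ne_zero.2 h
  simp only [zeta, if_true]
  rw [← neg_sub z w]
  field_simp
  ring

end Zeta

section Steps
variable {F : Type} [Field F] {J : Type}

/-- Genericity of the spectral parameters of a family of clusters. -/
structure GenericPts (v : F) (w : J → F) : Prop where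
  v_ne : v ≠ 0
  w_ne : ∀ l, w l ≠ 0
  ne : ∀ l l', l ≠ l' → ∀ k : ℤ, w l ≠ v ^ k * w l'

/-- The interaction of a point `z` of color `c` with a cluster in the state `b`. -/
def psi (v : F) (n c : ℕ) (z : F) (i b : ℕ) (x : F) : F :=
  ∏ k ∈ occupied n i b, zeta v n c (posColor n i k) z (v ^ posExp n i k * x)

/-- The point of the cluster `l` which can be removed from the configuration `b`. -/
def zpt (v : F) (n : ℕ) (blk : J → ℕ) (w : J → F) (b : J → ℕ) (l : J) : F :=
  v ^ remExp n (blk l) (b l) * w l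

variable {v : F} {n : ℕ} {blk : J → ℕ} {w : J → F} {b : J → ℕ} {c d : ℕ} {l l' m : J}

theorem zpt_congr {b' : J → ℕ} (h : b' l = b l) : zpt v n blk w b' l = zpt v n blk w b l := by
  simp [zpt, h]

theorem GenericPts.zpt_ne_zero (h : GenericPts v w) : zpt v n blk w b l ≠ 0 :=
  mul_ne_zero (zpow_ne_zero _ h.v_ne) (h.w_ne l)

theorem GenericPts.zpt_ne (h : GenericPts v w) {b' : J → ℕ} (hl : l ≠ l') (k : ℤ) :
    zpt v n blk w b l ≠ v ^ k * zpt v n blk w b' l' := by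
  intro h1
  apply h.ne l l' hl (-remExp n (blk l) (b l) + k + remExp n (blk l') (b' l'))
  unfold zpt at h1
  rw [zpow_add₀ h.v_ne, zpow_add₀ h.v_ne, mul_assoc, mul_assoc, ← h1, ← mul_assoc,
    ← zpow_add₀ h.v_ne]
  simp

variable [DecidableEq J]

/-- The configuration obtained by removing a point of color `c` from the cluster `l`. -/
def strip (n : ℕ) (blk : J → ℕ) (c : ℕ) (b : J → ℕ) (l : J) : J → ℕ :=
  Function.update b l (remState n (blk l) (b l) c)

theorem strip_same : strip n blk c b l l = remState n (blk l) (b l) c := by simp [strip]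

theorem strip_of_ne (h : l' ≠ l) : strip n blk c b l l' = b l' := by simp [strip, h]

theorem strip_comm (h : l ≠ l') :
    strip n blk c (strip n blk d b l') l = strip n blk d (strip n blk c b l) l' := by
  unfold strip
  rw [Function.update_of_ne h, Function.update_of_ne h.symm, Function.update_comm h]

theorem zpt_strip (h : l' ≠ l) : zpt v n blk w (strip n blk c b l) l' = zpt v n blk w b l' :=
  zpt_congr (strip_of_ne h)

theorem cf_mul_same_comm (h1 : CanRem n (blk l) (b l) c)
    (h2 : CanRem n (blk l) (strip n blk c b l l) d) (ha : aD n c d = 0) :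
    CanRem n (blk l) (b l) d ∧ CanRem n (blk l) (strip n blk d b l l) c ∧
    strip n blk d (strip n blk c b l) l = strip n blk c (strip n blk d b l) l ∧
    zpt v n blk w (strip n blk c b l) l = zpt v n blk w b l ∧
    zpt v n blk w (strip n blk d b l) l = zpt v n blk w b l := by
  rw [strip_same] at h2
  rcases rem_rem h1 h2 with ⟨h3, -⟩ | ⟨-, h3, h4, h5, h6, h7⟩
  · omega
  · refine ⟨h3, by rwa [strip_same], ?_, ?_, ?_⟩
    · unfold strip; simp [h5]
    · unfold zpt; rw [strip_same, ← h6]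
    · unfold zpt; rw [strip_same, ← h7]

variable [Fintype J]

/-- The coefficient for removing a point of color `c` from the cluster `l`. -/
def cf (v : F) (n : ℕ) (blk : J → ℕ) (w : J → F) (c : ℕ) (b : J → ℕ) (l : J) : F :=
  if CanRem n (blk l) (b l) c then
    ∏ m ∈ Finset.univ.erase l, psi v n c (zpt v n blk w b l) (blk m) (b m) (w m) else 0

/-- The contribution of the cluster `l` to the action of `e_{c,r}`. -/
def step (v : F) (n : ℕ) (blk : J → ℕ) (w : J → F) (c : ℕ) (r : ℤ) (l : J) :
    Module.End F ((J → ℕ) → F) where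
  toFun G b := cf v n blk w c b l * zpt v n blk w b l ^ r * G (strip n blk c b l)
  map_add' G H := by ext b; simp [mul_add]
  map_smul' a G := by ext b; simp; ring

/-- The action of `e_{c,r}` on functions of configurations. -/
def act (v : F) (n : ℕ) (blk : J → ℕ) (w : J → F) (c : ℕ) (r : ℤ) :
    Module.End F ((J → ℕ) → F) := ∑ l, step v n blk w c r l

theorem cf_of_not (h : ¬ CanRem n (blk l) (b l) c) : cf v n blk w c b l = 0 := by
  rw [cf, if_neg h]

theorem cf_strip (hl : l ≠ l') (h : CanRem n (blk l') (b l') d) :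
    cf v n blk w c b l = zeta v n c d (zpt v n blk w b l) (zpt v n blk w b l') *
      cf v n blk w c (strip n blk d b l') l := by
  unfold cf
  rw [strip_of_ne hl, zpt_strip hl]
  split_ifs
  · have hm : l' ∈ Finset.univ.erase l := by simp [hl.symm]
    rw [← Finset.mul_prod_erase _ _ hm, ← Finset.mul_prod_erase _ _ hm, ← mul_assoc]
    congr 1
    · obtain ⟨k, h1, h2, h3, h4⟩ := occupied_rem h
      unfold psi
      rw [strip_same, h2, Finset.prod_insert h1, h3, h4]
      rfl
    · refine Finset.prod_congr rfl fun m hm' => ?_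
      rw [strip_of_ne (Finset.ne_of_mem_erase hm')]
  · simp

theorem cf_mul_same (hv : v ≠ 0) :
    cf v n blk w c b l * cf v n blk w d (strip n blk c b l) l * (zpt v n blk w b l -
      v ^ aD n c d * zpt v n blk w (strip n blk c b l) l) = 0 := by
  by_cases h1 : CanRem n (blk l) (b l) c
  · by_cases h2 : CanRem n (blk l) (strip n blk c b l l) d
    · rw [strip_same] at h2
      rw [mul_eq_zero]
      right
      unfold zpt
      rw [strip_same]
      rcases rem_rem h1 h2 with ⟨h3, h4, -⟩ | ⟨h3, -, -, -, h4, -⟩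
      · rw [h3, h4, sub_eq_add_neg _ (1 : ℤ), zpow_add₀ hv]; ring
      · rw [h3, h4]; simp
    · rw [cf_of_not h2]; ring
  · rw [cf_of_not h1]; ring

theorem step_apply (r : ℤ) (G : (J → ℕ) → F) : step v n blk w c r l G b =
    cf v n blk w c b l * zpt v n blk w b l ^ r * G (strip n blk c b l) := rfl

theorem step_loop (hg : GenericPts v w) (c d : ℕ) (r s : ℤ) (l l' : J) :
    step v n blk w c (r + 1) l * step v n blk w d s l' -
      v ^ aD n c d • (step v n blk w c r l * step v n blk w d (s + 1) l') =
    v ^ aD n c d • (step v n blk w d s l' * step v n blk w c (r + 1) l) -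
      step v n blk w d (s + 1) l' * step v n blk w c r l := by
  ext1 G
  funext b
  simp only [LinearMap.sub_apply, LinearMap.smul_apply, Module.End.mul_apply, Pi.sub_apply,
    Pi.smul_apply, step_apply, smul_eq_mul]
  simp only [zpow_add_one₀ hg.zpt_ne_zero]
  by_cases hl : l = l'
  · subst hl
    have h1 := cf_mul_same (n := n) (blk := blk) (w := w) (b := b) (c := c) (d := d) (l := l) hg.v_ne
    have h2 := cf_mul_same (n := n) (blk := blk) (w := w) (b := b) (c := d) (d := c) (l := l) hg.v_ne
    rw [aD_symm] at h2
    linear_combination (zpt v n blk w b l ^ r * zpt v n blk w (strip n blk c b l) l ^ s *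
      G (strip n blk d (strip n blk c b l) l)) * h1 + (zpt v n blk w b l ^ s *
      zpt v n blk w (strip n blk d b l) l ^ r * G (strip n blk c (strip n blk d b l) l)) * h2
  · rw [zpt_strip hl, zpt_strip (Ne.symm hl), ← strip_comm hl]
    by_cases h1 : CanRem n (blk l) (b l) c
    · by_cases h2 : CanRem n (blk l') (b l') d
      · rw [cf_strip (c := c) hl h2, cf_strip (c := d) (Ne.symm hl) h1]
        have h3 := zeta_loop (n := n) (c := c) (d := d) hg.v_ne
          (fun k => hg.zpt_ne (n := n) (blk := blk) (b := b) (b' := b) hl k)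
        linear_combination (cf v n blk w c (strip n blk d b l') l *
          cf v n blk w d (strip n blk c b l) l' * zpt v n blk w b l ^ r * zpt v n blk w b l' ^ s *
          G (strip n blk c (strip n blk d b l') l)) * h3
      · rw [cf_of_not h2, cf_of_not (b := strip n blk c b l) (by rwa [strip_of_ne (Ne.symm hl)])]; ring
    · rw [cf_of_not h1, cf_of_not (b := strip n blk d b l') (by rwa [strip_of_ne hl])]; ring

theorem step_comm (hg : GenericPts v w) {c d : ℕ} (hcd : c ≠ d) (ha : aD n c d = 0) (r s : ℤ)
    (l l' : J) : step v n blk w c r l * step v n blk w d s l' =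
      step v n blk w d s l' * step v n blk w c r l := by
  ext1 G
  funext b
  simp only [Module.End.mul_apply, step_apply]
  by_cases hl : l = l'
  · subst hl
    by_cases h1 : CanRem n (blk l) (b l) c ∧ CanRem n (blk l) (strip n blk c b l l) d
    · obtain ⟨h3, h4, h5, h6, h7⟩ := cf_mul_same_comm (v := v) (w := w) h1.1 h1.2 ha
      rw [h5, h6, h7]
      unfold cf
      rw [if_pos h1.1, if_pos h1.2, if_pos h3, if_pos h4, h6, h7]
      have h8 : ∀ a c, ∏ m ∈ Finset.univ.erase l, psi v n a (zpt v n blk w b l) (blk m)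
          (strip n blk c b l m) (w m) = ∏ m ∈ Finset.univ.erase l, psi v n a (zpt v n blk w b l)
          (blk m) (b m) (w m) := fun a c => Finset.prod_congr rfl fun m hm => by
        rw [strip_of_ne (Finset.ne_of_mem_erase hm)]
      rw [h8, h8]
      ring
    · have h2 : ¬ (CanRem n (blk l) (b l) d ∧ CanRem n (blk l) (strip n blk d b l l) c) := by
        rintro ⟨h2, h3⟩
        obtain ⟨h4, h5, -⟩ := cf_mul_same_comm (v := v) (w := w) h2 h3 (by rwa [aD_symm])
        exact h1 ⟨h4, h5⟩
      rw [not_and_or] at h1 h2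
      trans (0 : F)
      · rcases h1 with h1 | h1 <;> rw [cf_of_not h1] <;> ring
      · rcases h2 with h2 | h2 <;> rw [cf_of_not h2] <;> ring
  · rw [zpt_strip hl, zpt_strip (Ne.symm hl), ← strip_comm hl]
    by_cases h1 : CanRem n (blk l) (b l) c
    · by_cases h2 : CanRem n (blk l') (b l') d
      · rw [cf_strip (c := c) hl h2, cf_strip (c := d) (Ne.symm hl) h1, zeta_comm _ hcd ha]
        · ring
        · simpa using hg.zpt_ne (n := n) (blk := blk) (b := b) (b' := b) hl 0
      · rw [cf_of_not h2, cf_of_not (b := strip n blk c b l) (by rwa [strip_of_ne (Ne.symm hl)])]; ring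
    · rw [cf_of_not h1, cf_of_not (b := strip n blk d b l') (by rwa [strip_of_ne hl])]; ring

theorem step_mul_step_self {i : ℕ} (r s : ℤ) (l : J) :
    step v n blk w i r l * step v n blk w i s l = 0 := by
  ext1 G
  funext b
  simp only [Module.End.mul_apply, step_apply, LinearMap.zero_apply, Pi.zero_apply]
  by_cases h1 : CanRem n (blk l) (b l) i
  · rw [cf_of_not (b := strip n blk i b l)]
    · ring
    · rw [strip_same]
      exact fun h2 => rem_ne h1 h2 rfl
  · rw [cf_of_not h1]; ring

theorem step_mul_step_mul_step {i j : ℕ} (r s t : ℤ) (l m : J) :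
    step v n blk w i r l * step v n blk w j t m * step v n blk w i s l = 0 := by
  ext1 G
  funext b
  simp only [Module.End.mul_apply, step_apply, LinearMap.zero_apply, Pi.zero_apply]
  by_cases h1 : CanRem n (blk l) (b l) i
  · by_cases h2 : CanRem n (blk m) (strip n blk i b l m) j
    · rw [cf_of_not (b := strip n blk j _ m)]
      · ring
      · by_cases hm : l = m
        · subst hm
          rw [strip_same] at h2 ⊢
          rw [strip_same]
          exact rem_rem_rem h1 h2
        · rw [strip_of_ne hm, strip_same]
          exact fun h3 => rem_ne h1 h3 rfl
    · rw [cf_of_not h2]; ring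
  · rw [cf_of_not h1]; ring

theorem serre_identity_distinct {i j : ℕ} {x y z : F} (hv : v ≠ 0) (ha : aD n i j = -1)
    (hxy : x ≠ y) (hx : ∀ k : ℤ, x ≠ v ^ k * z) (hy : ∀ k : ℤ, y ≠ v ^ k * z) :
    (zeta v n i i x y + zeta v n i i y x) * zeta v n i j x z * zeta v n i j y z
      - (v + v⁻¹) * (zeta v n i i x y * zeta v n i j x z * zeta v n j i z y +
        zeta v n i i y x * zeta v n i j y z * zeta v n j i z x) +
      (zeta v n i i x y + zeta v n i i y x) * zeta v n j i z x * zeta v n j i z y = 0 := by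
  obtain ⟨p, h1, h2⟩ := zeta_adj hv ha hx
  obtain ⟨q, h3, h4⟩ := zeta_adj hv ha hy
  have h5 : x - y ≠ 0 := sub_ne_zero.2 hxy
  rw [h1, h2, h3, h4]
  simp only [zeta, if_true]
  rw [← neg_sub x y]
  field_simp
  ring

theorem serre_identity_left {i j : ℕ} {x y z : F} (hv : v ≠ 0) (ha : aD n i j = -1)
    (hxy : x ≠ y) (hy : ∀ k : ℤ, y ≠ v ^ k * z) (hx : x = v⁻¹ * z) :
    (zeta v n i i x y + zeta v n i i y x) * zeta v n i j y z =
      (v + v⁻¹) * (zeta v n i i x y * zeta v n j i z y) := by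
  obtain ⟨q, h3, h4⟩ := zeta_adj hv ha hy
  have h5 : x - y ≠ 0 := sub_ne_zero.2 hxy
  rw [h3, h4, zeta_self_add hxy]
  simp only [zeta, if_true]
  obtain rfl : z = v * x := by rw [hx]; field_simp
  field_simp
  ring

theorem serre_identity_right {i j : ℕ} {x y z : F} (hv : v ≠ 0) (ha : aD n i j = -1)
    (hxy : x ≠ y) (hy : ∀ k : ℤ, y ≠ v ^ k * z) (hx : z = v⁻¹ * x) :
    (zeta v n i i x y + zeta v n i i y x) * zeta v n j i z y =
      (v + v⁻¹) * (zeta v n i i y x * zeta v n i j y z) := by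
  obtain ⟨q, h3, h4⟩ := zeta_adj hv ha hy
  have h5 : x - y ≠ 0 := sub_ne_zero.2 hxy
  rw [h3, h4, zeta_self_add hxy]
  simp only [zeta, if_true]
  obtain rfl : x = v * z := by rw [hx]; field_simp
  rw [← neg_sub (v * z) y]
  field_simp
  ring

theorem step_serre_distinct (hg : GenericPts v w) {i j : ℕ} (ha : aD n i j = -1) (r s t : ℤ)
    {l l' m : J} (hl : l ≠ l') (hm : l ≠ m) (hm' : l' ≠ m) :
    (step v n blk w i r l * step v n blk w i s l' + step v n blk w i s l' * step v n blk w i r l) *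
      step v n blk w j t m - (v + v⁻¹) • (step v n blk w i r l * step v n blk w j t m *
        step v n blk w i s l' + step v n blk w i s l' * step v n blk w j t m *
        step v n blk w i r l) + step v n blk w j t m * (step v n blk w i r l * step v n blk w i s l' +
        step v n blk w i s l' * step v n blk w i r l) = 0 := by
  ext1 G
  funext b
  simp only [LinearMap.sub_apply, LinearMap.add_apply, LinearMap.smul_apply, Module.End.mul_apply,
    Pi.sub_apply, Pi.add_apply, Pi.smul_apply, step_apply, smul_eq_mul, LinearMap.zero_apply,
    Pi.zero_apply, zpt_strip hl, zpt_strip hm, zpt_strip hm', zpt_strip hl.symm, zpt_strip hm.symm,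
    zpt_strip hm'.symm]
  have e1 : strip n blk i (strip n blk i b l') l = strip n blk i (strip n blk i b l) l' :=
    strip_comm hl
  have e2 : strip n blk i (strip n blk j b m) l = strip n blk j (strip n blk i b l) m :=
    strip_comm hm
  have e3 : strip n blk i (strip n blk j b m) l' = strip n blk j (strip n blk i b l') m :=
    strip_comm hm'
  have e4 : strip n blk i (strip n blk j (strip n blk i b l) m) l' =
    strip n blk j (strip n blk i (strip n blk i b l) l') m := strip_comm hm'
  have e5 : strip n blk i (strip n blk j (strip n blk i b l') m) l =
    strip n blk j (strip n blk i (strip n blk i b l) l') m := by rw [strip_comm hm, e1]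
  simp only [e1, e2, e3, e4, e5]
  by_cases h1 : CanRem n (blk l) (b l) i
  swap
  · have h : ∀ b' : J → ℕ, b' l = b l → cf v n blk w i b' l = 0 :=
      fun b' hb => cf_of_not (by rwa [hb])
    simp [h, strip_of_ne hl, strip_of_ne hm]
  by_cases h2 : CanRem n (blk l') (b l') i
  swap
  · have h : ∀ b' : J → ℕ, b' l' = b l' → cf v n blk w i b' l' = 0 :=
      fun b' hb => cf_of_not (by rwa [hb])
    simp [h, strip_of_ne hl.symm, strip_of_ne hm']
  by_cases h3 : CanRem n (blk m) (b m) j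
  swap
  · have h : ∀ b' : J → ℕ, b' m = b m → cf v n blk w j b' m = 0 :=
      fun b' hb => cf_of_not (by rwa [hb])
    simp [h, strip_of_ne hm.symm, strip_of_ne hm'.symm]
  have c1' := cf_strip (v := v) (w := w) (c := i) (b := strip n blk i b l') hm
    (by rwa [strip_of_ne hm'.symm])
  have c1 := cf_strip (v := v) (w := w) (c := i) hl h2
  have c1'' := cf_strip (v := v) (w := w) (c := i) (b := strip n blk j b m) hl
    (by rwa [strip_of_ne hm'])
  have c2' := cf_strip (v := v) (w := w) (c := i) (b := strip n blk i b l) hm'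
    (by rwa [strip_of_ne hm.symm])
  have c2 := cf_strip (v := v) (w := w) (c := i) hl.symm h1
  have c2'' := cf_strip (v := v) (w := w) (c := i) (b := strip n blk j b m) hl.symm
    (by rwa [strip_of_ne hm])
  have c3' := cf_strip (v := v) (w := w) (c := j) (b := strip n blk i b l) hm'.symm
    (by rwa [strip_of_ne hl.symm])
  have c3 := cf_strip (v := v) (w := w) (c := j) hm.symm h1
  have c3'' := cf_strip (v := v) (w := w) (c := j) (b := strip n blk i b l') hm.symm
    (by rwa [strip_of_ne hl])
  simp only [zpt_strip hl, zpt_strip hm, zpt_strip hm', zpt_strip hl.symm, zpt_strip hm.symm,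
    zpt_strip hm'.symm, e1, e2, e3] at c1 c1' c1'' c2 c2' c2'' c3 c3' c3''
  rw [c1, c1'', c1', c2, c2'', c2', c3, c3', c3'']
  have key := serre_identity_distinct (n := n) hg.v_ne ha
    (by simpa using hg.zpt_ne (n := n) (blk := blk) (b := b) (b' := b) hl 0)
    (hg.zpt_ne (n := n) (blk := blk) (b := b) (b' := b) hm)
    (hg.zpt_ne (n := n) (blk := blk) (b := b) (b' := b) hm')
  linear_combination (cf v n blk w i (strip n blk j (strip n blk i b l') m) l *
    cf v n blk w i (strip n blk j (strip n blk i b l) m) l' *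
    cf v n blk w j (strip n blk i (strip n blk i b l) l') m * zpt v n blk w b l ^ r *
    zpt v n blk w b l' ^ s * zpt v n blk w b m ^ t *
    G (strip n blk j (strip n blk i (strip n blk i b l) l') m)) * key

theorem step_serre_pair (hg : GenericPts v w) {i j : ℕ} (ha : aD n i j = -1) (r s t : ℤ)
    {l l' : J} (hl : l ≠ l') :
    (step v n blk w i r l * step v n blk w i s l' + step v n blk w i s l' * step v n blk w i r l) *
      step v n blk w j t l - (v + v⁻¹) • (step v n blk w i r l * step v n blk w j t l *
        step v n blk w i s l' + step v n blk w i s l' * step v n blk w j t l *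
        step v n blk w i r l) + step v n blk w j t l * (step v n blk w i r l * step v n blk w i s l' +
        step v n blk w i s l' * step v n blk w i r l) = 0 := by
  ext1 G
  funext b
  simp only [LinearMap.sub_apply, LinearMap.add_apply, LinearMap.smul_apply, Module.End.mul_apply,
    Pi.sub_apply, Pi.add_apply, Pi.smul_apply, step_apply, smul_eq_mul, LinearMap.zero_apply,
    Pi.zero_apply, zpt_strip hl, zpt_strip hl.symm]
  by_cases h2 : CanRem n (blk l') (b l') i
  swap
  · have h : ∀ b' : J → ℕ, b' l' = b l' → cf v n blk w i b' l' = 0 :=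
      fun b' hb => cf_of_not (by rwa [hb])
    simp [h, strip_of_ne hl.symm]
  have hzero : ∀ c d, ¬ (CanRem n (blk l) (b l) c ∧
      CanRem n (blk l) (remState n (blk l) (b l) c) d) →
      (∀ b' : J → ℕ, b' l = b l → cf v n blk w c b' l = 0) ∨
      ∀ b' : J → ℕ, b' l = remState n (blk l) (b l) c → cf v n blk w d b' l = 0 := by
    intro c d h
    rw [not_and_or] at h
    exact h.imp (fun h b' hb => cf_of_not (by rwa [hb])) fun h b' hb => cf_of_not (by rwa [hb])
  have hxy : zpt v n blk w b l ≠ zpt v n blk w b l' := by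
    simpa using hg.zpt_ne (n := n) (blk := blk) (b := b) (b' := b) hl 0
  have hexp : ∀ c, remExp n (blk l) (b l) = remExp n (blk l) (remState n (blk l) (b l) c) - 1 →
      zpt v n blk w b l = v⁻¹ * zpt v n blk w (strip n blk c b l) l := by
    intro c h
    unfold zpt
    rw [strip_same, h, sub_eq_add_neg, zpow_add₀ hg.v_ne, zpow_neg_one]
    ring
  by_cases h1 : CanRem n (blk l) (b l) i ∧ CanRem n (blk l) (remState n (blk l) (b l) i) j
  · rcases rem_rem h1.1 h1.2 with ⟨-, h4, h5⟩ | ⟨h4, -⟩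
    swap
    · omega
    have e1 : strip n blk i (strip n blk i b l') l = strip n blk i (strip n blk i b l) l' :=
      strip_comm hl
    have e2 : strip n blk i (strip n blk j (strip n blk i b l) l) l' =
      strip n blk j (strip n blk i (strip n blk i b l) l') l := strip_comm hl.symm
    have e3 : zpt v n blk w (strip n blk i (strip n blk i b l) l') l =
      zpt v n blk w (strip n blk i b l) l := zpt_strip hl
    have h6 : CanRem n (blk l) (strip n blk i b l l) j := by rw [strip_same]; exact h1.2
    have c1 := cf_strip (v := v) (w := w) (c := i) hl h2
    have c2 := cf_strip (v := v) (w := w) (c := i) hl.symm h1.1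
    have c3 := cf_strip (v := v) (w := w) (c := i) hl.symm h6
    have c4 := cf_strip (v := v) (w := w) (c := j) (b := strip n blk i b l) hl
      (by rw [strip_of_ne hl.symm]; exact h2)
    rw [zpt_strip hl.symm] at c3 c4
    have key := serre_identity_left (n := n) hg.v_ne ha hxy
      (hg.zpt_ne (b' := strip n blk i b l) hl.symm) (hexp _ h4)
    rcases hzero _ _ h5 with h7 | h7
    · simp only [h7, strip_of_ne hl, e1, e2, e3, c1, c2, c3, c4]
      linear_combination (cf v n blk w i (strip n blk i b l') l *
        cf v n blk w i (strip n blk j (strip n blk i b l) l) l' *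
        cf v n blk w j (strip n blk i (strip n blk i b l) l') l * zpt v n blk w b l ^ r *
        zpt v n blk w b l' ^ s * zpt v n blk w (strip n blk i b l) l ^ t *
        G (strip n blk j (strip n blk i (strip n blk i b l) l') l)) * key
    · simp only [h7 (strip n blk j _ l) strip_same,
        h7 (strip n blk i (strip n blk j b l) l') (by rw [strip_of_ne hl, strip_same]),
        h7 (strip n blk j (strip n blk i b l') l) (by rw [strip_same, strip_of_ne hl]),
        e1, e2, e3, c1, c2, c3, c4]
      linear_combination (cf v n blk w i (strip n blk i b l') l *
        cf v n blk w i (strip n blk j (strip n blk i b l) l) l' *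
        cf v n blk w j (strip n blk i (strip n blk i b l) l') l * zpt v n blk w b l ^ r *
        zpt v n blk w b l' ^ s * zpt v n blk w (strip n blk i b l) l ^ t *
        G (strip n blk j (strip n blk i (strip n blk i b l) l') l)) * key
  by_cases h3 : CanRem n (blk l) (b l) j ∧ CanRem n (blk l) (remState n (blk l) (b l) j) i
  · rcases rem_rem h3.1 h3.2 with ⟨-, h4, -⟩ | ⟨h4, -⟩
    swap
    · rw [aD_symm] at h4; omega
    have e1 : strip n blk j (strip n blk i b l') l = strip n blk i (strip n blk j b l) l' :=
      strip_comm hl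
    have e2 : strip n blk i (strip n blk i (strip n blk j b l) l') l =
      strip n blk i (strip n blk i (strip n blk j b l) l) l' := strip_comm hl
    have e3 : zpt v n blk w (strip n blk i (strip n blk j b l) l') l =
      zpt v n blk w (strip n blk j b l) l := zpt_strip hl
    have h6 : CanRem n (blk l) (strip n blk j b l l) i := by rw [strip_same]; exact h3.2
    have c1 := cf_strip (v := v) (w := w) (c := j) hl h2
    have c2 := cf_strip (v := v) (w := w) (c := i) hl.symm h3.1
    have c3 := cf_strip (v := v) (w := w) (c := i) hl.symm h6
    have c4 := cf_strip (v := v) (w := w) (c := i) (b := strip n blk j b l) hl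
      (by rw [strip_of_ne hl.symm]; exact h2)
    rw [zpt_strip hl.symm] at c3 c4
    have key := serre_identity_right (n := n) hg.v_ne ha
      (by simpa using hg.zpt_ne (b := strip n blk j b l) (b' := b) hl 0)
      (hg.zpt_ne (b' := b) hl.symm) (hexp _ h4)
    rcases hzero _ _ h1 with h7 | h7
    · simp only [h7, strip_of_ne hl, e1, e2, e3, c1, c2, c3, c4]
      linear_combination (cf v n blk w j (strip n blk i b l') l *
        cf v n blk w i (strip n blk i (strip n blk j b l) l) l' *
        cf v n blk w i (strip n blk i (strip n blk j b l) l') l *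
        zpt v n blk w (strip n blk j b l) l ^ r *
        zpt v n blk w b l' ^ s * zpt v n blk w b l ^ t *
        G (strip n blk i (strip n blk i (strip n blk j b l) l) l')) * key
    · simp only [h7 (strip n blk i _ l) strip_same,
        h7 (strip n blk i (strip n blk i b l) l') (by rw [strip_of_ne hl, strip_same]),
        h7 (strip n blk i (strip n blk i b l') l) (by rw [strip_same, strip_of_ne hl]),
        e1, e2, e3, c1, c2, c3, c4]
      linear_combination (cf v n blk w j (strip n blk i b l') l *
        cf v n blk w i (strip n blk i (strip n blk j b l) l) l' *
        cf v n blk w i (strip n blk i (strip n blk j b l) l') l *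
        zpt v n blk w (strip n blk j b l) l ^ r *
        zpt v n blk w b l' ^ s * zpt v n blk w b l ^ t *
        G (strip n blk i (strip n blk i (strip n blk j b l) l) l')) * key
  · rcases hzero _ _ h1 with h7 | h7 <;> rcases hzero _ _ h3 with h8 | h8 <;>
      simp [h7, h8, strip_same, strip_of_ne hl]

theorem step_serre (hg : GenericPts v w) {i j : ℕ} (ha : aD n i j = -1) (r s t : ℤ) (l l' m : J) :
    (step v n blk w i r l * step v n blk w i s l' + step v n blk w i s l' * step v n blk w i r l) *
      step v n blk w j t m - (v + v⁻¹) • (step v n blk w i r l * step v n blk w j t m *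
        step v n blk w i s l' + step v n blk w i s l' * step v n blk w j t m *
        step v n blk w i r l) + step v n blk w j t m * (step v n blk w i r l * step v n blk w i s l' +
        step v n blk w i s l' * step v n blk w i r l) = 0 := by
  by_cases hl : l = l'
  · subst hl
    simp [step_mul_step_self, step_mul_step_mul_step]
  by_cases hm : l = m
  · subst hm
    exact step_serre_pair hg ha r s t hl
  by_cases hm' : l' = m
  · subst hm'
    rw [add_comm (step v n blk w i r l * step v n blk w i s l'),
      add_comm (step v n blk w i r l * step v n blk w j t l' * step v n blk w i s l')]
    exact step_serre_pair hg ha s r t (Ne.symm hl)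
  · exact step_serre_distinct hg ha r s t hl hm hm'

/-- The operators `act` satisfy the relations of the quantum loop algebra. -/
theorem act_loopRel (hg : GenericPts v w) (n : ℕ) (blk : J → ℕ) :
    LoopRel v n (act v n blk w) where
  loop c d r s := by
    have h := fun l l' => step_loop (n := n) (blk := blk) hg c d r s l l'
    unfold act
    simp only [Finset.sum_mul_sum, Finset.smul_sum]
    rw [Finset.sum_comm (f := fun l' l => v ^ aD n c d • (step v n blk w d s l' * _)),
      Finset.sum_comm (f := fun l' l => (step v n blk w d (s + 1) l' * _))]
    simp only [← Finset.sum_sub_distrib, h]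
  comm c d r s hcd ha := by
    unfold act
    rw [Finset.sum_mul_sum, Finset.sum_mul_sum, Finset.sum_comm]
    exact Finset.sum_congr rfl fun l' _ => Finset.sum_congr rfl fun l _ =>
      step_comm hg hcd ha r s l l'
  serre i j r s t ha := by
    have h : ∑ l, ∑ l', ∑ m, ((step v n blk w i r l * step v n blk w i s l' +
        step v n blk w i s l' * step v n blk w i r l) *
      step v n blk w j t m - (v + v⁻¹) • (step v n blk w i r l * step v n blk w j t m *
        step v n blk w i s l' + step v n blk w i s l' * step v n blk w j t m *
        step v n blk w i r l) + step v n blk w j t m * (step v n blk w i r l * step v n blk w i s l' +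
        step v n blk w i s l' * step v n blk w i r l)) = 0 :=
      Finset.sum_eq_zero fun l _ => Finset.sum_eq_zero fun l' _ => Finset.sum_eq_zero fun m _ =>
        step_serre hg ha r s t l l' m
    rw [← h]
    unfold act
    simp only [Finset.sum_add_distrib, Finset.sum_sub_distrib, ← Finset.smul_sum,
      ← Finset.mul_sum, ← Finset.sum_mul]
  zero c r hc := by
    unfold act
    refine Finset.sum_eq_zero fun l _ => ?_
    ext1 G
    funext b
    rw [step_apply, cf_of_not]
    · simp
    · unfold CanRem; omega

end Steps

section DividedPowers

/-- The symmetrization identity behind the divided powers. -/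
theorem sum_prod_div_eq_geom {F J : Type} [Field F] [DecidableEq J] (q : F) (hq : q ≠ 0)
    (hq1 : q ≠ 1) (S : Finset J) (z : J → F) (hz : ∀ l, z l ≠ 0) (hinj : Set.InjOn z S) :
    ∑ l ∈ S, ∏ m ∈ S.erase l, (q * z l - z m) / (z l - z m) = ∑ j ∈ Finset.range S.card, q ^ j := by
  open Polynomial in
  set A : F[X] := ∏ m ∈ S, (C q * X - C (z m)) with hA
  set B : F[X] := C (q ^ S.card) * ∏ m ∈ S, (X - C (z m)) with hB
  have hq' : ∀ m, (C q * X - C (z m) : F[X]).leadingCoeff = q := fun m => by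
    rw [sub_eq_add_neg, ← C_neg, leadingCoeff_linear hq]
  have hd : ∀ m, (C q * X - C (z m) : F[X]).degree = 1 := fun m => by
    rw [sub_eq_add_neg, ← C_neg, degree_linear hq]
  have hAl : A.leadingCoeff = q ^ S.card := by
    rw [hA, leadingCoeff_prod]; simp [hq']
  have hAd : A.degree = S.card := by
    rw [hA, degree_prod]; simp [hd]
  have hBl : B.leadingCoeff = q ^ S.card := by
    rw [hB, leadingCoeff_mul, leadingCoeff_prod]; simp
  have hBd : B.degree = S.card := by
    rw [hB, degree_mul, degree_prod, degree_C (pow_ne_zero _ hq)]; simp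
  have hA0 : A ≠ 0 := leadingCoeff_ne_zero.1 (by rw [hAl]; exact pow_ne_zero _ hq)
  have hdeg : (A - B).degree < S.card := by
    rw [← hAd]
    exact degree_sub_lt_left (by rw [hAd, hBd]) hA0 (by rw [hAl, hBl])
  have hint := congrArg (eval 0) (Lagrange.eq_interpolate hinj hdeg)
  rw [Lagrange.interpolate_apply] at hint
  have hval : ∀ l ∈ S, eval (z l) (A - B) = (q - 1) * z l * ∏ m ∈ S.erase l, (q * z l - z m) := by
    intro l hl
    rw [eval_sub, hA, hB, eval_mul, eval_prod, eval_prod, ← Finset.mul_prod_erase _ _ hl,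
      ← Finset.mul_prod_erase S (fun m => eval (z l) (X - C (z m))) hl]
    simp
    left
    ring
  have hzero : eval 0 (A - B) = (-1) ^ S.card * (∏ m ∈ S, z m) * (1 - q ^ S.card) := by
    rw [eval_sub, hA, hB, eval_mul, eval_prod, eval_prod]
    simp [Finset.prod_neg]
    ring
  rw [hzero, eval_finsetSum] at hint
  have hterm : ∀ l ∈ S, eval 0 (C (eval (z l) (A - B)) * Lagrange.basis S z l) =
      (-1) ^ S.card * (∏ m ∈ S, z m) * (1 - q) *
        ∏ m ∈ S.erase l, (q * z l - z m) / (z l - z m) := by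
    intro l hl
    have h1 : ∀ m, eval 0 (Lagrange.basisDivisor (z l) (z m)) = (z l - z m)⁻¹ * (-1 * z m) := by
      intro m; simp [Lagrange.basisDivisor]
    rw [eval_mul, eval_C, hval l hl, Lagrange.basis, eval_prod]
    simp only [h1]
    rw [← Finset.mul_prod_erase S z hl, Finset.prod_mul_distrib, Finset.prod_mul_distrib,
      Finset.prod_div_distrib, Finset.prod_const, Finset.prod_inv_distrib,
      Finset.card_erase_of_mem hl]
    obtain ⟨k, hk⟩ : ∃ k, S.card = k + 1 := ⟨S.card - 1, by have := Finset.card_pos.2 ⟨l, hl⟩; omega⟩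
    rw [hk, Nat.add_sub_cancel, pow_succ]
    ring
  rw [Finset.sum_congr rfl hterm, ← Finset.mul_sum] at hint
  have h0 : (-1 : F) ^ S.card * (∏ m ∈ S, z m) ≠ 0 :=
    mul_ne_zero (pow_ne_zero _ (by simp)) (Finset.prod_ne_zero_iff.2 fun m _ => hz m)
  rw [mul_assoc _ (1 - q)] at hint
  have h2 := mul_left_cancel₀ h0 hint
  rw [geom_sum_eq hq1, eq_div_iff (sub_ne_zero.2 hq1)]
  linear_combination h2

variable {F : Type} [Field F] {J : Type}
variable {v : F} {n : ℕ} {blk : J → ℕ} {w : J → F} {b : J → ℕ} {c : ℕ} {l : J} {S : Finset J}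

/-- A subring over which the structure constants of `act` are defined. -/
structure IntegralPts (v : F) (w : J → F) (R : Subring F) : Prop where
  v_mem : v ∈ R
  v_inv_mem : v⁻¹ ∈ R
  w_mem : ∀ l, w l ∈ R
  w_inv_mem : ∀ l, (w l)⁻¹ ∈ R
  inv_mem : ∀ l l', l ≠ l' → ∀ a b : ℤ, (v ^ a * w l - v ^ b * w l')⁻¹ ∈ R

theorem zpow_mem_of_inv_mem {R : Subring F} {x : F} (h : x ∈ R) (h' : x⁻¹ ∈ R) (k : ℤ) :
    x ^ k ∈ R := by
  rcases k with k | k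
  · simpa using R.pow_mem h k
  · rw [zpow_negSucc, ← inv_pow]
    exact R.pow_mem h' _

variable {R : Subring F}

theorem IntegralPts.zeta_mem (h : IntegralPts v w R) (hv : v ≠ 0) {c d : ℕ} {l l' : J} (hl : l ≠ l')
    (a b : ℤ) : zeta v n c d (v ^ a * w l) (v ^ b * w l') ∈ R := by
  have hp := zpow_mem_of_inv_mem h.v_mem h.v_inv_mem
  have hm : ∀ (k : ℤ) l, v ^ k * w l ∈ R := fun k l => R.mul_mem (hp k) (h.w_mem l)
  unfold zeta
  split_ifs
  · rw [div_eq_mul_inv]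
    exact R.mul_mem (R.sub_mem (R.mul_mem (R.pow_mem h.v_mem 2) (hm _ _)) (hm _ _))
      (h.inv_mem l l' hl a b)
  · rw [div_eq_mul_inv, ← mul_assoc (v ^ aD n c d) (v ^ b), ← zpow_add₀ hv]
    exact R.mul_mem (R.sub_mem (R.mul_mem (hp _) (hm _ _)) (hm _ _)) (h.inv_mem l l' hl _ _)
  · exact R.one_mem

theorem IntegralPts.zpt_mem (h : IntegralPts v w R) (r : ℤ) :
    zpt v n blk w b l ^ r ∈ R := by
  have hp := zpow_mem_of_inv_mem h.v_mem h.v_inv_mem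
  refine zpow_mem_of_inv_mem (R.mul_mem (hp _) (h.w_mem _)) ?_ r
  rw [mul_inv, ← zpow_neg]
  exact R.mul_mem (hp _) (h.w_inv_mem _)

variable [DecidableEq J]

/-- The configuration obtained by removing a point of color `c` from each cluster in `S`. -/
def stripSet (n : ℕ) (blk : J → ℕ) (c : ℕ) (b : J → ℕ) (S : Finset J) : J → ℕ :=
  fun l => if l ∈ S then remState n (blk l) (b l) c else b l

theorem stripSet_of_notMem (h : l ∉ S) : stripSet n blk c b S l = b l := if_neg h

theorem stripSet_empty : stripSet n blk c b ∅ = b := by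
  ext m; simp [stripSet]

theorem stripSet_insert (h : l ∉ S) :
    stripSet n blk c b (insert l S) = strip n blk c (stripSet n blk c b S) l := by
  ext m
  by_cases hm : m = l
  · subst hm; rw [strip_same, stripSet_of_notMem h]; simp [stripSet]
  · rw [strip_of_ne hm]; simp [stripSet, hm]

theorem stripSet_insert' (h : l ∉ S) :
    stripSet n blk c b (insert l S) = stripSet n blk c (strip n blk c b l) S := by
  ext m
  by_cases hm : m = l
  · subst hm; rw [stripSet_of_notMem h, strip_same]; simp [stripSet]
  · simp [stripSet, hm, strip_of_ne hm]

variable [Fintype J]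

theorem cf_stripSet (hl : l ∉ S) (h : ∀ m ∈ S, CanRem n (blk m) (b m) c) :
    cf v n blk w c b l = (∏ m ∈ S, zeta v n c c (zpt v n blk w b l) (zpt v n blk w b m)) *
      cf v n blk w c (stripSet n blk c b S) l := by
  induction S using Finset.induction_on with
  | empty => rw [stripSet_empty]; simp
  | insert m S hm ih =>
    rw [Finset.mem_insert, not_or] at hl
    rw [ih hl.2 fun k hk => h k (Finset.mem_insert_of_mem hk), Finset.prod_insert hm,
      stripSet_insert hm, cf_strip (b := stripSet n blk c b S) hl.1
      (by rw [stripSet_of_notMem hm]; exact h m (Finset.mem_insert_self _ _)),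
      zpt_congr (stripSet_of_notMem hl.2), zpt_congr (stripSet_of_notMem hm)]
    ring

/-- The divided power of `act`, up to a power of `v`. -/
def actDiv (v : F) (n : ℕ) (blk : J → ℕ) (w : J → F) (c : ℕ) (r : ℤ) (k : ℕ)
    (G : (J → ℕ) → F) (b : J → ℕ) : F :=
  ∑ S ∈ Finset.powersetCard k Finset.univ, (∏ l ∈ S, (cf v n blk w c
    (stripSet n blk c b (S.erase l)) l * zpt v n blk w b l ^ r)) * G (stripSet n blk c b S)

theorem sum_powersetCard_succ (k : ℕ) (f : J → Finset J → F) (hf : ∀ l S, l ∈ S → f l S = 0) :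
    ∑ l, ∑ S ∈ Finset.powersetCard k Finset.univ, f l S =
      ∑ S ∈ Finset.powersetCard (k + 1) Finset.univ, ∑ l ∈ S, f l (S.erase l) := by
  have h : ∀ l, ∑ S ∈ Finset.powersetCard k Finset.univ, f l S =
      ∑ S ∈ (Finset.powersetCard k Finset.univ).filter (l ∉ ·), f l S := fun l => by
    rw [Finset.sum_filter]
    refine Finset.sum_congr rfl fun S _ => ?_
    split_ifs with hl
    · exact hf l S hl
    · rfl
  simp only [h]
  rw [Finset.sum_sigma', Finset.sum_sigma']
  refine Finset.sum_bij' (fun p _ => ⟨insert p.1 p.2, p.1⟩) (fun p _ => ⟨p.2, p.1.erase p.2⟩)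
    ?_ ?_ ?_ ?_ ?_
  · rintro ⟨l, S⟩ hp
    simp only [Finset.mem_sigma, Finset.mem_univ, Finset.mem_filter, Finset.mem_powersetCard,
      Finset.subset_univ, true_and] at hp ⊢
    exact ⟨by rw [Finset.card_insert_of_notMem hp.2, hp.1], Finset.mem_insert_self _ _⟩
  · rintro ⟨S, l⟩ hp
    simp only [Finset.mem_sigma, Finset.mem_univ, Finset.mem_filter, Finset.mem_powersetCard,
      Finset.subset_univ, true_and] at hp ⊢
    exact ⟨by rw [Finset.card_erase_of_mem hp.2, hp.1]; rfl, Finset.notMem_erase _ _⟩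
  · rintro ⟨l, S⟩ hp
    simp only [Finset.mem_sigma, Finset.mem_filter] at hp
    simp [Finset.erase_insert hp.2.2]
  · rintro ⟨S, l⟩ hp
    simp only [Finset.mem_sigma] at hp
    simp [Finset.insert_erase hp.2]
  · rintro ⟨l, S⟩ hp
    simp only [Finset.mem_sigma, Finset.mem_filter] at hp
    simp [Finset.erase_insert hp.2.2]

theorem act_apply (r : ℤ) (G : (J → ℕ) → F) : act v n blk w c r G b =
    ∑ l, cf v n blk w c b l * zpt v n blk w b l ^ r * G (strip n blk c b l) := by
  unfold act
  rw [LinearMap.sum_apply, Finset.sum_apply]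
  rfl

theorem act_actDiv (hg : GenericPts v w) (hv : v ^ 2 ≠ 1) (r : ℤ) (k : ℕ) (G : (J → ℕ) → F) :
    act v n blk w c r (actDiv v n blk w c r k G) =
      (∑ j ∈ Finset.range (k + 1), (v ^ 2) ^ j) • actDiv v n blk w c r (k + 1) G := by
  funext b
  rw [act_apply, Pi.smul_apply, smul_eq_mul]
  simp only [actDiv, Finset.mul_sum]
  rw [sum_powersetCard_succ]
  swap
  · intro l S hl
    by_cases h1 : CanRem n (blk l) (b l) c
    · rw [Finset.prod_eq_zero hl]
      · ring
      · rw [cf_of_not, zero_mul]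
        rw [stripSet_of_notMem (Finset.notMem_erase _ _), strip_same]
        exact fun h2 => rem_ne h1 h2 rfl
    · rw [cf_of_not h1]; ring
  refine Finset.sum_congr rfl fun S hS => ?_
  rw [Finset.mem_powersetCard] at hS
  by_cases hrem : ∀ m ∈ S, CanRem n (blk m) (b m) c
  · rw [← hS.2, ← sum_prod_div_eq_geom (v ^ 2) (pow_ne_zero _ hg.v_ne) hv S (zpt v n blk w b)
      (fun l => hg.zpt_ne_zero) (fun l _ l' _ h => by
        by_contra hl
        exact hg.zpt_ne (n := n) (blk := blk) (b := b) (b' := b) hl 0 (by simpa using h)),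
      Finset.sum_mul]
    refine Finset.sum_congr rfl fun l hl => ?_
    have hins : insert l (S.erase l) = S := Finset.insert_erase hl
    rw [← Finset.mul_prod_erase S _ hl, cf_stripSet (Finset.notMem_erase l S)
      fun m hm => hrem m (Finset.mem_of_mem_erase hm), ← stripSet_insert' (Finset.notMem_erase l S),
      hins]
    have h3 : ∀ m ∈ S.erase l, cf v n blk w c (stripSet n blk c (strip n blk c b l)
        ((S.erase l).erase m)) m * zpt v n blk w (strip n blk c b l) m ^ r =
        cf v n blk w c (stripSet n blk c b (S.erase m)) m * zpt v n blk w b m ^ r := by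
      intro m hm
      have hml := Finset.ne_of_mem_erase hm
      rw [zpt_strip hml, ← stripSet_insert', Finset.erase_right_comm,
        Finset.insert_erase (Finset.mem_erase.2 ⟨hml.symm, hl⟩)]
      simp
    rw [Finset.prod_congr rfl h3]
    simp only [zeta, if_true]
    ring
  · push Not at hrem
    obtain ⟨m, hm, hm'⟩ := hrem
    rw [Finset.prod_eq_zero hm]
    · rw [zero_mul, mul_zero]
      refine Finset.sum_eq_zero fun l hl => ?_
      by_cases hml : m = l
      · subst hml; rw [cf_of_not hm']; ring
      · rw [Finset.prod_eq_zero (i := m) (Finset.mem_erase.2 ⟨hml, hm⟩)]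
        · ring
        · rw [cf_of_not, zero_mul]
          rwa [stripSet_of_notMem (Finset.notMem_erase _ _), strip_of_ne hml]
    · rw [cf_of_not, zero_mul]
      rwa [stripSet_of_notMem (Finset.notMem_erase _ _)]

theorem IntegralPts.cf_mem (h : IntegralPts v w R) (hv : v ≠ 0) : cf v n blk w c b l ∈ R := by
  unfold cf
  split_ifs
  · refine R.prod_mem fun m hm => R.prod_mem fun k _ => ?_
    exact h.zeta_mem hv (Finset.ne_of_mem_erase hm).symm _ _
  · exact R.zero_mem

theorem IntegralPts.actDiv_mem (h : IntegralPts v w R) (hv : v ≠ 0) (r : ℤ) (k : ℕ)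
    {G : (J → ℕ) → F} (hG : ∀ b, G b ∈ R) (b : J → ℕ) : actDiv v n blk w c r k G b ∈ R :=
  R.sum_mem fun _ _ => R.mul_mem (R.prod_mem fun _ _ =>
    R.mul_mem (h.cf_mem hv) (h.zpt_mem r)) (hG _)

theorem act_pow (hg : GenericPts v w) (hv : v ^ 2 ≠ 1) (r : ℤ) (k : ℕ) (G : (J → ℕ) → F) :
    (act v n blk w c r ^ k) G =
      (∏ m ∈ Finset.range k, ∑ j ∈ Finset.range (m + 1), (v ^ 2) ^ j) •
        actDiv v n blk w c r k G := by
  induction k with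
  | zero => funext b; simp [actDiv, stripSet_empty]
  | succ k ih =>
    rw [pow_succ', Module.End.mul_apply, ih, map_smul, act_actDiv hg hv, smul_smul,
      Finset.prod_range_succ]

end DividedPowers

section Removal

variable {n i t t' c b : ℕ}

theorem canRem_edge (hi : 1 ≤ i) (h : Edge n i t c t') :
    CanRem n i (t' + 1) c ∧ remState n i (t' + 1) c = t + 1 := by
  obtain ⟨⟨h1, h2, h3⟩, h4⟩ := h
  unfold CanRem remState
  rcases h3 with h3 | h3 | h3 | h3 <;> refine ⟨by omega, ?_⟩ <;> split_ifs <;> omega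

theorem lt_remState_of_edge (h : Edge n i t c t') (hc : CanRem n i b c) (hb : t' + 1 ≤ b)
    (hne : b ≠ t' + 1) : t + 1 < remState n i b c := by
  obtain ⟨⟨h1, h2, h3⟩, h4⟩ := h
  obtain ⟨h5, h6, h7⟩ := hc
  unfold remState
  rcases h7 with h7 | ⟨_, _, _, h7 | h7 | h7⟩ <;> rcases h3 with h3 | h3 | h3 | h3 <;>
    split_ifs <;> omega

theorem canRem_zero_color {j : ℕ} (hj : i ≤ j) (hc : CanRem n j b i) :
    j = i ∧ b = 1 ∧ remState n j b i = 0 := by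
  unfold CanRem at hc
  unfold remState
  split_ifs <;> omega

theorem CanRem.pos {j : ℕ} (hc : CanRem n j b c) : b ≠ 0 := by unfold CanRem at hc; omega

theorem canRem_zero (hi : 1 ≤ i) (hn : i ≤ n) : CanRem n i 1 i := ⟨hi, hn, Or.inl ⟨rfl, rfl⟩⟩

variable {F : Type} [Field F] {J : Type}

/-- The interaction of a whole root `(i,t)` placed at `x` with a cluster in the state `b`. -/
def rootPsi (v : F) (n i t : ℕ) (x : F) (j b : ℕ) (y : F) : F :=
  ∏ k ∈ occupied n i (t + 1), psi v n (posColor n i k) (v ^ posExp n i k * x) j b y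

variable [DecidableEq J]
variable {v : F} {blk : J → ℕ} {w : J → F}

theorem update_strip (b : J → ℕ) (l : J) (c : ℕ) :
    Function.update (strip n blk c b l) l 0 = Function.update b l 0 := by
  simp [strip]

variable [Fintype J]

/-- The action of a quantum root vector. -/
def actVec (v : F) (n : ℕ) (blk : J → ℕ) (w : J → F) (u : F) (T : ℕ → ℤ) (i t : ℕ) :
    Module.End F ((J → ℕ) → F) :=
  vecFrom u (fun c => act v n blk w c (T c)) n i t (act v n blk w i (T i))

/-- The configurations from which the root `(i,t)` is to be removed as a whole. -/
def Removable (blk : J → ℕ) (b : J → ℕ) (i t : ℕ) : Prop :=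
  ∀ l, b l ≠ 0 → i ≤ blk l ∧ (blk l = i → t + 1 ≤ b l)

theorem rootPsi_edge (hi : 1 ≤ i) (h : Edge n i t c t') (x : F) (j b : ℕ) (y : F) :
    rootPsi v n i t' x j b y =
      psi v n c (v ^ remExp n i (t' + 1) * x) j b y * rootPsi v n i t x j b y := by
  obtain ⟨h1, h2⟩ := canRem_edge hi h
  obtain ⟨k, h3, h4, h5, h6⟩ := occupied_rem h1
  unfold rootPsi
  rw [h4, Finset.prod_insert h3, h5, h6, h2]

theorem rootPsi_zero (hi : 1 ≤ i) (hn : i ≤ n) (x : F) (j b : ℕ) (y : F) :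
    rootPsi v n i 0 x j b y = psi v n i (v ^ remExp n i 1 * x) j b y := by
  obtain ⟨k, h3, h4, h5, h6⟩ := occupied_rem (canRem_zero hi hn)
  unfold rootPsi
  rw [h4, Finset.prod_insert h3, h5, h6, (canRem_zero_color le_rfl (canRem_zero hi hn)).2.2,
    occupied_zero hn]
  simp

theorem actVec_apply (hg : GenericPts v w) (a : ℤ) (T : ℕ → ℤ) (hi : 1 ≤ i) (t : ℕ) (ht : RootIdx n i t) :
    ∃ (N : ℕ) (M : ℤ), ∀ (G : (J → ℕ) → F) (b : J → ℕ), Removable blk b i t →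
      actVec v n blk w (v ^ a) T i t G b = ∑ l with (blk l = i ∧ b l = t + 1),
        (-1) ^ N * v ^ M * w l ^ ((wordN n i t).map T).sum *
        (∏ m ∈ Finset.univ.erase l, rootPsi v n i t (w l) (blk m) (b m) (w m)) *
        G (Function.update b l 0) := by
  have hn := ht.2.1
  have hv := hg.v_ne
  refine edge_induction (P := fun t => ∃ (N : ℕ) (M : ℤ), ∀ (G : (J → ℕ) → F) (b : J → ℕ),
      Removable blk b i t → actVec v n blk w (v ^ a) T i t G b =
        ∑ l with (blk l = i ∧ b l = t + 1),
        (-1) ^ N * v ^ M * w l ^ ((wordN n i t).map T).sum *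
        (∏ m ∈ Finset.univ.erase l, rootPsi v n i t (w l) (blk m) (b m) (w m)) *
        G (Function.update b l 0)) hi ?_ ?_ t ht
  · refine ⟨0, remExp n i 1 * T i, fun G b hb => ?_⟩
    unfold actVec
    rw [vecFrom_zero _ _ hn, act_apply, wordN_zero hn, Finset.sum_filter]
    refine Finset.sum_congr rfl fun l _ => ?_
    split_ifs with hl
    · obtain ⟨rfl, h2⟩ := hl
      have h1 := canRem_zero hi hn
      have h3 := (canRem_zero_color le_rfl h1).2.2
      rw [zero_add] at h2
      unfold cf
      rw [h2, if_pos h1]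
      simp only [rootPsi_zero hi hn, zpt, h2, strip, h3, mul_zpow, zpow_mul]
      simp [mul_comm]
    · rw [cf_of_not]
      · ring
      · intro h
        obtain ⟨h1, h2, -⟩ := canRem_zero_color (hb l h.pos).1 h
        exact hl ⟨h1, h2⟩
  · rintro t c t' he ⟨N, M, ih⟩
    refine ⟨N + 1, M + a + remExp n i (t' + 1) * T c, fun G b hb => ?_⟩
    have hlt := he.1.lt
    unfold actVec at ih ⊢
    rw [vecFrom_edge _ _ hi he]
    set E := vecFrom (v ^ a) (fun c => act v n blk w c (T c)) n i t (act v n blk w i (T i))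
    have hb' : Removable blk b i t := fun l hl =>
      ⟨(hb l hl).1, fun h => by have := (hb l hl).2 h; omega⟩
    have h0 : E (act v n blk w c (T c) G) b = 0 := by
      rw [ih _ _ hb']
      refine Finset.sum_eq_zero fun l hl => ?_
      obtain ⟨-, h1, h2⟩ := Finset.mem_filter.1 hl
      have := (hb l (by omega)).2 h1
      omega
    simp only [qb, LinearMap.sub_apply, Module.End.mul_apply, Pi.sub_apply, LinearMap.smul_apply,
      Pi.smul_apply, smul_eq_mul]
    rw [h0, act_apply, zero_sub, Finset.mul_sum, ← Finset.sum_neg_distrib, Finset.sum_filter]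
    refine Finset.sum_congr rfl fun l _ => ?_
    by_cases hc : CanRem n (blk l) (b l) c
    swap
    · rw [cf_of_not hc, if_neg]
      · ring
      · rintro ⟨rfl, h2⟩
        exact hc (h2 ▸ (canRem_edge hi he).1)
    have hl0 := hb l hc.pos
    have hrem : Removable blk (strip n blk c b l) i t := by
      intro m hm
      by_cases hml : m = l
      · subst hml
        refine ⟨hl0.1, fun h => ?_⟩
        subst h
        rw [strip_same]
        by_cases h1 : b m = t' + 1
        · rw [h1, (canRem_edge hi he).2]
        · exact (lt_remState_of_edge he hc (hl0.2 rfl) h1).le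
      · rw [strip_of_ne hml] at hm ⊢
        exact hb' m hm
    rw [ih _ _ hrem]
    have hfil : ∀ m, m ≠ l → ¬ (blk m = i ∧ strip n blk c b l m = t + 1) := by
      rintro m hm ⟨h1, h2⟩
      rw [strip_of_ne hm] at h2
      have := (hb m (by omega)).2 h1
      omega
    split_ifs with hl
    · obtain ⟨rfl, h2⟩ := hl
      obtain ⟨h3, h4⟩ := canRem_edge hi he
      have h5 : strip n blk c b l l = t + 1 := by rw [strip_same, h2, h4]
      have hS : (Finset.univ.filter fun m => blk m = blk l ∧ strip n blk c b l m = t + 1) = {l} := by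
        ext m
        simp only [Finset.mem_filter, Finset.mem_univ, true_and, Finset.mem_singleton]
        refine ⟨fun h => by_contra fun h' => hfil m h' h, ?_⟩
        rintro rfl
        exact ⟨rfl, h5⟩
      rw [hS, Finset.sum_singleton, update_strip, wordN_edge he, cf, if_pos hc]
      have hP : ∏ m ∈ Finset.univ.erase l, rootPsi v n (blk l) t (w l) (blk m)
          (strip n blk c b l m) (w m) = ∏ m ∈ Finset.univ.erase l, rootPsi v n (blk l) t (w l) (blk m)
          (b m) (w m) := Finset.prod_congr rfl fun m hm => by
        rw [strip_of_ne (Finset.ne_of_mem_erase hm)]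
      simp only [rootPsi_edge hi he, Finset.prod_mul_distrib, zpt, h2, mul_zpow, ← zpow_mul,
        List.map_append, List.sum_append, List.map_cons, List.map_nil, List.sum_singleton]
      rw [hP, zpow_add₀ hv, zpow_add₀ hv]
      rw [zpow_add₀ (hg.w_ne l)]
      ring
    · rw [Finset.sum_eq_zero]
      · ring
      · intro m hm
        obtain ⟨-, h1, h2⟩ := Finset.mem_filter.1 hm
        by_cases hml : m = l
        · subst hml
          subst h1
          rw [strip_same] at h2
          have := lt_remState_of_edge he hc (hl0.2 rfl) fun h => hl ⟨rfl, h⟩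
          omega
        · exact absurd ⟨h1, h2⟩ (hfil m hml)

end Removal

section Representation
variable {F : Type} [Field F] [Algebra KK F] {J : Type} [DecidableEq J] [Fintype J]
variable {n : ℕ} {blk : J → ℕ} {w : J → F}

/-- The image of `v` in an extension of the base field. -/
def vIn (F : Type) [Field F] [Algebra KK F] : F := algebraMap KK F vv

theorem LoopRel.restrict {B : Type} [Ring B] [Algebra F B] [Algebra KK B] [IsScalarTower KK F B]
    {e : ℕ → ℤ → B} (h : LoopRel (vIn F) n e) : LoopRel vv n e where
  loop i j r s := by
    have := h.loop i j r s
    simpa only [vIn, ← map_zpow₀, algebraMap_smul] using this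
  comm := h.comm
  serre i j r s t hij := by
    have := h.serre i j r s t hij
    simpa only [vIn, ← map_inv₀, ← map_add, algebraMap_smul] using this
  zero := h.zero

theorem exists_rep (hg : GenericPts (vIn F) w) (n : ℕ) (blk : J → ℕ) :
    ∃ ρ : UD n →ₐ[KK] Module.End F ((J → ℕ) → F),
      ∀ i r, ρ (genD n i r) = act (vIn F) n blk w i r :=
  exists_lift (act_loopRel hg n blk).restrict

variable {ρ : UD n →ₐ[KK] Module.End F ((J → ℕ) → F)}

theorem rep_tildeED (hρ : ∀ i r, ρ (genD n i r) = act (vIn F) n blk w i r) (ε : Bool)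
    (β : PosRootD n) (T : ℕ → ℤ) :
    ρ (tildeED ε β T) = actVec (vIn F) n blk w (vIn F ^ sgn ε) T (riD β) (rtD β) := by
  have hβ := rootIdx_of_root β
  rw [tildeED_eq]
  unfold actVec
  refine edge_induction (P := fun t => ρ (vecFrom (vpow (sgn ε)) (fun c => genD n c (T c)) n (riD β)
    t (genD n (riD β) (T (riD β)))) = vecFrom (vIn F ^ sgn ε) (fun c => act (vIn F) n blk w c (T c))
    n (riD β) t (act (vIn F) n blk w (riD β) (T (riD β)))) hβ.1 ?_ ?_ _ hβ
  · rw [vecFrom_zero _ _ hβ.2.1, vecFrom_zero _ _ hβ.2.1, hρ]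
  · intro t0 c t he ih
    rw [vecFrom_edge _ _ hβ.1 he, vecFrom_edge _ _ hβ.1 he, ← ih]
    simp only [qb, map_sub, map_mul, map_smul, hρ, vIn, vpow, ← map_zpow₀, algebraMap_smul]

theorem sum_vv_sq_pow (k : ℕ) :
    ∑ j ∈ Finset.range (k + 1), (vv ^ 2) ^ j = vv ^ k * qInt vv (k + 1) := by
  induction k with
  | zero => simp [qInt_one]
  | succ k ih =>
    rw [Finset.sum_range_succ, ih]
    have hv := vv_ne_zero
    have hd := vv_sub_inv_ne_zero
    simp only [qInt, zpow_neg, zpow_natCast]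
    have hd' : vv ^ 2 - 1 ≠ 0 := by
      intro h
      apply hd
      field_simp
      rw [h, mul_zero]
    field_simp
    ring

theorem exists_prod_sum_eq (k : ℕ) : ∃ N : ℕ,
    ∏ m ∈ Finset.range k, ∑ j ∈ Finset.range (m + 1), (vv ^ 2) ^ j = vv ^ N * qFact vv k := by
  induction k with
  | zero => exact ⟨0, by simp [qFact]⟩
  | succ k ih =>
    obtain ⟨N, hN⟩ := ih
    refine ⟨N + k, ?_⟩
    rw [Finset.prod_range_succ, hN, sum_vv_sq_pow, qFact_succ]
    ring

theorem rep_dpow (hg : GenericPts (vIn F) w)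
    (hρ : ∀ i r, ρ (genD n i r) = act (vIn F) n blk w i r) (c : ℕ) (r : ℤ) (k : ℕ) :
    ∃ N : ℕ, ∀ G b, ρ ((qFact vv k)⁻¹ • genD n c r ^ k) G b =
      vIn F ^ N * actDiv (vIn F) n blk w c r k G b := by
  obtain ⟨N, hN⟩ := exists_prod_sum_eq k
  refine ⟨N, fun G b => ?_⟩
  have hv : vIn F ^ 2 ≠ 1 := by
    intro h
    rw [vIn, ← map_pow, ← map_one (algebraMap KK F)] at h
    apply vv_sub_inv_ne_zero
    have hv := vv_ne_zero
    have := (algebraMap KK F).injective h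
    field_simp
    rw [this, sub_self, mul_zero]
  rw [map_smul, map_pow, hρ, LinearMap.smul_apply, act_pow hg hv]
  simp only [vIn, ← map_pow, ← map_sum, ← map_prod]
  rw [hN, Pi.smul_apply, Pi.smul_apply, map_mul, Algebra.smul_def, smul_eq_mul, map_inv₀,
    map_pow]
  have : algebraMap KK F (qFact vv k) ≠ 0 := by
    rw [Ne, map_eq_zero]; exact qFact_ne_zero k
  field_simp

theorem rep_mem {R : Subring F} (hg : GenericPts (vIn F) w) (h : IntegralPts (vIn F) w R)
    (hρ : ∀ i r, ρ (genD n i r) = act (vIn F) n blk w i r) {x : UD n} (hx : x ∈ LusFormD n)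
    {G : (J → ℕ) → F} (hG : ∀ b, G b ∈ R) (b : J → ℕ) : ρ x G b ∈ R := by
  unfold LusFormD zvForm at hx
  induction hx using Subring.closure_induction generalizing G b with
  | mem x hx =>
    rcases hx with (rfl | rfl) | ⟨i, r, k, rfl⟩
    · simp only [AlgHom.commutes, Module.algebraMap_end_apply, Pi.smul_apply, Algebra.smul_def]
      exact R.mul_mem h.v_mem (hG b)
    · simp only [AlgHom.commutes, Module.algebraMap_end_apply, Pi.smul_apply, Algebra.smul_def,
        map_inv₀]
      exact R.mul_mem h.v_inv_mem (hG b)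
    · obtain ⟨N, hN⟩ := rep_dpow hg hρ (i.1 + 1) r k
      rw [genD, g1_fin] at hN
      rw [hN]
      exact R.mul_mem (R.pow_mem h.v_mem N) (h.actDiv_mem hg.v_ne r k hG b)
  | zero => simp
  | one => simpa using hG b
  | add x y _ _ hx hy =>
    rw [map_add]
    exact R.add_mem (hx hG b) (hy hG b)
  | neg x _ hx =>
    rw [map_neg]
    exact R.neg_mem (hx hG b)
  | mul x y _ _ hx hy =>
    rw [map_mul]
    exact hx (fun b => hy hG b) b

end Representation

section Lead
variable {Γ K : Type} [LinearOrder Γ] [Field K]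
variable {f g : HahnSeries Γ K} {γ δ : Γ} {c d : K}

/-- `f` is `c` times the monomial of exponent `γ`, up to terms of larger exponent. -/
def Lead (f : HahnSeries Γ K) (γ : Γ) (c : K) : Prop := (∀ δ < γ, f.coeff δ = 0) ∧ f.coeff γ = c

theorem Lead.mono (h : Lead f γ c) (hδ : δ < γ) : Lead f δ 0 :=
  ⟨fun _ h' => h.1 _ (h'.trans hδ), h.1 _ hδ⟩

theorem Lead.unique (h : Lead f γ c) (h' : Lead f δ d) (hc : c ≠ 0) (hd : d ≠ 0) :
    γ = δ ∧ c = d := by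
  have h1 : γ = δ := by
    rcases lt_trichotomy γ δ with h1 | h1 | h1
    · exact absurd (h.2.symm.trans (h'.1 _ h1)) hc
    · exact h1
    · exact absurd (h'.2.symm.trans (h.1 _ h1)) hd
  subst h1
  exact ⟨rfl, h.2.symm.trans h'.2⟩

theorem lead_zero (γ : Γ) : Lead (0 : HahnSeries Γ K) γ 0 := ⟨fun _ _ => rfl, rfl⟩

theorem lead_single (γ : Γ) (c : K) : Lead (HahnSeries.single γ c) γ c :=
  ⟨fun _ h => HahnSeries.coeff_single_of_ne h.ne, HahnSeries.coeff_single_same _ _⟩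

theorem Lead.neg (h : Lead f γ c) : Lead (-f) γ (-c) :=
  ⟨fun δ hδ => by simp [h.1 δ hδ], by simp [h.2]⟩

theorem Lead.sub (h : Lead f γ c) (h' : Lead g γ d) : Lead (f - g) γ (c - d) :=
  ⟨fun δ hδ => by simp [h.1 δ hδ, h'.1 δ hδ], by simp [h.2, h'.2]⟩

theorem Lead.sum {ι : Type} (s : Finset ι) {f : ι → HahnSeries Γ K} {c : ι → K}
    (h : ∀ i ∈ s, Lead (f i) γ (c i)) : Lead (∑ i ∈ s, f i) γ (∑ i ∈ s, c i) := by
  refine ⟨fun δ hδ => ?_, ?_⟩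
  · rw [HahnSeries.coeff_sum]
    exact Finset.sum_eq_zero fun i hi => (h i hi).1 δ hδ
  · rw [HahnSeries.coeff_sum]
    exact Finset.sum_congr rfl fun i hi => (h i hi).2

theorem Lead.ne_zero (h : Lead f γ c) (hc : c ≠ 0) : f ≠ 0 := by
  rintro rfl
  exact hc (h.2.symm.trans rfl)

variable [AddCommGroup Γ]

theorem lead_one : Lead (1 : HahnSeries Γ K) 0 1 := lead_single 0 1

variable [IsOrderedAddMonoid Γ]

theorem Lead.mul (h : Lead f γ c) (h' : Lead g δ d) : Lead (f * g) (γ + δ) (c * d) := by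
  refine ⟨fun a ha => ?_, ?_⟩
  · rw [HahnSeries.coeff_mul]
    refine Finset.sum_eq_zero fun p hp => ?_
    rw [Finset.mem_antidiagonal] at hp
    by_cases h1 : p.1 < γ
    · rw [h.1 _ h1, zero_mul]
    by_cases h2 : p.2 < δ
    · rw [h'.1 _ h2, mul_zero]
    · exact absurd (hp.2.2 ▸ add_le_add (not_lt.1 h1) (not_lt.1 h2)) ha.not_ge
  · rw [HahnSeries.coeff_mul, Finset.sum_eq_single (γ, δ), h.2, h'.2]
    · intro p hp hne
      rw [Finset.mem_antidiagonal] at hp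
      by_cases h1 : p.1 < γ
      · rw [h.1 _ h1, zero_mul]
      by_cases h2 : p.2 < δ
      · rw [h'.1 _ h2, mul_zero]
      · refine absurd ?_ hne
        have h3 : p.1 = γ := le_antisymm (le_of_add_le_add_right
          (hp.2.2.le.trans (add_le_add le_rfl (not_lt.1 h2)))) (not_lt.1 h1)
        refine Prod.ext h3 (add_left_cancel (a := γ) ?_)
        rw [← h3, hp.2.2, h3]
    · intro hn
      rw [Finset.mem_antidiagonal] at hn
      by_cases h1 : f.coeff γ = 0
      · rw [h1, zero_mul]
      by_cases h2 : g.coeff δ = 0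
      · rw [h2, mul_zero]
      · exact absurd ⟨h1, h2, rfl⟩ hn

theorem Lead.prod {ι : Type} (s : Finset ι) {f : ι → HahnSeries Γ K} {c : ι → K}
    (h : ∀ i ∈ s, Lead (f i) 0 (c i)) : Lead (∏ i ∈ s, f i) 0 (∏ i ∈ s, c i) := by
  classical
  induction s using Finset.induction_on with
  | empty => simpa using lead_one
  | insert a s ha ih =>
    rw [Finset.prod_insert ha, Finset.prod_insert ha, ← zero_add (0 : Γ)]
    exact (h a (Finset.mem_insert_self a s)).mul (ih fun i hi => h i (Finset.mem_insert_of_mem hi))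

theorem Lead.list_prod {ι : Type} (s : List ι) {f : ι → HahnSeries Γ K} {c : ι → K}
    (h : ∀ i ∈ s, Lead (f i) 0 (c i)) : Lead (s.map f).prod 0 (s.map c).prod := by
  induction s with
  | nil => simpa using lead_one
  | cons a s ih =>
    rw [List.map_cons, List.map_cons, List.prod_cons, List.prod_cons, ← zero_add (0 : Γ)]
    exact (h a List.mem_cons_self).mul (ih fun i hi => h i (List.mem_cons_of_mem a hi))

theorem Lead.inv (h : Lead f γ c) (hc : c ≠ 0) : Lead f⁻¹ (-γ) c⁻¹ := by
  have hf := h.ne_zero hc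
  have h1 : Lead f⁻¹ f⁻¹.order (f⁻¹.coeff f⁻¹.order) :=
    ⟨fun δ hδ => HahnSeries.coeff_eq_zero_of_lt_order hδ, rfl⟩
  have h2 : f⁻¹.coeff f⁻¹.order ≠ 0 := HahnSeries.coeff_order_eq_zero.not.2 (inv_ne_zero hf)
  have h3 := h.mul h1
  rw [mul_inv_cancel₀ hf] at h3
  obtain ⟨h4, h5⟩ := h3.unique lead_one (mul_ne_zero hc h2) one_ne_zero
  rwa [← eq_inv_of_mul_eq_one_right h5, ← eq_neg_of_add_eq_zero_right h4]

theorem Lead.div (h : Lead f γ c) (h' : Lead g δ d) (hd : d ≠ 0) :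
    Lead (f / g) (γ - δ) (c / d) := by
  rw [div_eq_mul_inv, div_eq_mul_inv, sub_eq_add_neg]
  exact h.mul (h'.inv hd)

theorem single_zpow (γ : Γ) (c : K) (k : ℤ) :
    (HahnSeries.single γ c : HahnSeries Γ K) ^ k = HahnSeries.single (k • γ) (c ^ k) := by
  cases k with
  | ofNat k => simp
  | negSucc k => rw [zpow_negSucc, zpow_negSucc, HahnSeries.single_pow, HahnSeries.inv_single,
      negSucc_zsmul]

/-- The series with all coefficients in `S`. -/
def coeffSubring (Γ : Type) [AddCommGroup Γ] [LinearOrder Γ] [IsOrderedAddMonoid Γ]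
    (S : Subring K) : Subring (HahnSeries Γ K) where
  carrier := {f | ∀ γ, f.coeff γ ∈ S}
  zero_mem' _ := S.zero_mem
  one_mem' γ := by
    rw [HahnSeries.coeff_one]
    split_ifs
    exacts [S.one_mem, S.zero_mem]
  add_mem' h h' γ := S.add_mem (h γ) (h' γ)
  neg_mem' h γ := S.neg_mem (h γ)
  mul_mem' h h' γ := by
    rw [HahnSeries.coeff_mul]
    exact S.sum_mem fun p _ => S.mul_mem (h _) (h' _)

theorem mem_coeffSubring {S : Subring K} : f ∈ coeffSubring Γ S ↔ ∀ γ, f.coeff γ ∈ S := Iff.rfl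

theorem single_mem_coeffSubring {S : Subring K} (hc : c ∈ S) :
    HahnSeries.single γ c ∈ coeffSubring Γ S := by
  intro δ
  by_cases h : δ = γ
  · rw [h, HahnSeries.coeff_single_same]; exact hc
  · rw [HahnSeries.coeff_single_of_ne h]; exact S.zero_mem

theorem inv_single_sub_single_mem {S : Subring K} (hδ : γ < δ) (hc : c ≠ 0) (hc' : c⁻¹ ∈ S)
    (hd : d ∈ S) : (HahnSeries.single γ c - HahnSeries.single δ d)⁻¹ ∈ coeffSubring Γ S := by
  have hl := (lead_single γ c).sub ((lead_single δ d).mono hδ)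
  rw [sub_zero] at hl
  set f := HahnSeries.single γ c - HahnSeries.single δ d with hf
  have hmul := mul_inv_cancel₀ (hl.ne_zero hc)
  set g := f⁻¹
  have hrec : ∀ a, g.coeff a = c⁻¹ * (d * g.coeff (a - (δ - γ)) +
      (1 : HahnSeries Γ K).coeff (γ + a)) := by
    intro a
    have h1 := congrArg (fun x => HahnSeries.coeff x (γ + a)) hmul
    simp only [hf, sub_mul, HahnSeries.coeff_sub, HahnSeries.coeff_single_mul] at h1
    rw [← h1, show γ + a - γ = a by abel, show γ + a - δ = a - (δ - γ) by abel]
    field_simp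
    ring
  by_contra hbad
  rw [mem_coeffSubring] at hbad
  push Not at hbad
  have hsub : {a | g.coeff a ∉ S} ⊆ g.support := fun a ha h0 => ha (h0 ▸ S.zero_mem)
  have hwf := g.isWF_support.mono hsub
  have h2 := hwf.min_mem hbad
  apply h2
  rw [hrec]
  refine S.mul_mem hc' (S.add_mem (S.mul_mem hd ?_) ?_)
  · by_contra h3
    exact hwf.not_lt_min hbad h3 (sub_lt_self _ (sub_pos.2 hδ))
  · exact (coeffSubring Γ S).one_mem _

end Lead

section Points
variable {Γ K J : Type} [AddCommGroup Γ] [LinearOrder Γ] [IsOrderedAddMonoid Γ] [Field K]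
variable {v : K} {e : J → Γ}

theorem zpow_single_mul_single (γ : Γ) (a : ℤ) :
    (HahnSeries.single 0 v : HahnSeries Γ K) ^ a * HahnSeries.single γ 1 =
      HahnSeries.single γ (v ^ a) := by
  rw [single_zpow, HahnSeries.single_mul_single]; simp

theorem genericPts_single (hv : v ≠ 0) (he : Function.Injective e) :
    GenericPts (HahnSeries.single 0 v : HahnSeries Γ K) (fun l => HahnSeries.single (e l) 1) where
  v_ne := (lead_single 0 v).ne_zero hv
  w_ne l := (lead_single (e l) 1).ne_zero one_ne_zero
  ne l l' hl k h := by
    rw [zpow_single_mul_single] at h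
    have h1 := lead_single (e l) (1 : K)
    rw [h] at h1
    exact hl (he (h1.unique (lead_single (e l') (v ^ k)) one_ne_zero (zpow_ne_zero k hv)).1)

theorem integralPts_single {S : Subring K} (hv0 : v ≠ 0) (hv : v ∈ S) (hv' : v⁻¹ ∈ S)
    (he : Function.Injective e) :
    IntegralPts (HahnSeries.single 0 v : HahnSeries Γ K) (fun l => HahnSeries.single (e l) 1)
      (coeffSubring Γ S) where
  v_mem := single_mem_coeffSubring hv
  v_inv_mem := by rw [HahnSeries.inv_single]; exact single_mem_coeffSubring hv'
  w_mem l := single_mem_coeffSubring S.one_mem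
  w_inv_mem l := by
    rw [HahnSeries.inv_single, inv_one]; exact single_mem_coeffSubring S.one_mem
  inv_mem l l' hl a b := by
    have h := fun k => zpow_mem_of_inv_mem hv hv' k
    rw [zpow_single_mul_single, zpow_single_mul_single]
    rcases lt_or_gt_of_ne (he.ne hl) with h1 | h1
    · exact inv_single_sub_single_mem h1 (zpow_ne_zero a hv0) (by rw [← zpow_neg]; exact h _) (h _)
    · rw [← neg_sub, inv_neg]
      exact neg_mem (inv_single_sub_single_mem h1 (zpow_ne_zero b hv0)
        (by rw [← zpow_neg]; exact h _) (h _))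

end Points

section ZetaLimits
variable {K : Type} [Field K]

/-- The limit of `zeta v n c d z w` as `w / z` tends to zero. -/
def zetaZero (v : K) (n c d : ℕ) : K :=
  if c = d then v ^ 2 else if c < d then v ^ aD n c d else 1

/-- The limit of `zeta v n c d z w` as `w / z` tends to infinity. -/
def zetaInf (v : K) (n c d : ℕ) : K :=
  if c = d then 1 else if c < d then v ^ (-aD n c d) else 1

theorem exists_zetaInf (v : K) (n c d : ℕ) : ∃ k : ℤ, zetaInf v n c d = v ^ k := by
  unfold zetaInf
  split_ifs
  exacts [⟨0, by simp⟩, ⟨_, rfl⟩, ⟨0, by simp⟩]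

variable {Γ : Type} [AddCommGroup Γ] [LinearOrder Γ] [IsOrderedAddMonoid Γ] {v : K} {γ δ : Γ}

theorem lead_zetaZero (hv : v ≠ 0) (h : γ < δ) (n c d : ℕ) (a b : ℤ) :
    Lead (zeta (HahnSeries.single 0 v : HahnSeries Γ K) n c d
      (HahnSeries.single γ (v ^ a)) (HahnSeries.single δ (v ^ b))) 0 (zetaZero v n c d) := by
  have key : ∀ (k m : ℤ) (x y : K), x ≠ 0 → Lead ((HahnSeries.single 0 v : HahnSeries Γ K) ^ k *
      HahnSeries.single γ x - HahnSeries.single 0 v ^ m * HahnSeries.single δ y) γ (v ^ k * x) := by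
    intro k m x y hx
    simp only [single_zpow, HahnSeries.single_mul_single, smul_zero, zero_add]
    have := (lead_single γ (v ^ k * x)).sub ((lead_single δ (v ^ m * y)).mono h)
    rwa [sub_zero] at this
  have ha := zpow_ne_zero a hv
  unfold zeta zetaZero
  split_ifs with h1 h2
  · have h3 := (key 2 0 (v ^ a) (v ^ b) ha).div (key 0 0 (v ^ a) (v ^ b) ha) (by simpa using ha)
    simpa [ha] using h3
  · have h3 := (key (aD n c d) 0 (v ^ a) (v ^ b) ha).div (key 0 (aD n c d) (v ^ a) (v ^ b) ha)
      (by simpa using ha)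
    simpa [ha] using h3
  · exact lead_one

theorem lead_zetaInf (hv : v ≠ 0) (h : δ < γ) (n c d : ℕ) (a b : ℤ) :
    Lead (zeta (HahnSeries.single 0 v : HahnSeries Γ K) n c d
      (HahnSeries.single γ (v ^ a)) (HahnSeries.single δ (v ^ b))) 0 (zetaInf v n c d) := by
  have key : ∀ (k m : ℤ) (x y : K), y ≠ 0 → Lead ((HahnSeries.single 0 v : HahnSeries Γ K) ^ k *
      HahnSeries.single γ x - HahnSeries.single 0 v ^ m * HahnSeries.single δ y) δ
      (-(v ^ m * y)) := by
    intro k m x y hx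
    simp only [single_zpow, HahnSeries.single_mul_single, smul_zero, zero_add]
    have := ((lead_single γ (v ^ k * x)).mono h).sub (lead_single δ (v ^ m * y))
    rwa [zero_sub] at this
  have hb := zpow_ne_zero b hv
  unfold zeta zetaInf
  split_ifs with h1 h2
  · have h3 := (key 2 0 (v ^ a) (v ^ b) hb).div (key 0 0 (v ^ a) (v ^ b) hb) (by simpa using hb)
    simpa [hb] using h3
  · have hd := zpow_ne_zero (aD n c d) hv
    have h3 := (key (aD n c d) 0 (v ^ a) (v ^ b) hb).div (key 0 (aD n c d) (v ^ a) (v ^ b) hb)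
      (neg_ne_zero.2 (mul_ne_zero hd hb))
    rw [neg_div_neg_eq, mul_div_mul_right _ _ hb, zpow_zero, zpow_zero, one_div, ← zpow_neg] at h3
    simpa using h3
  · exact lead_one

end ZetaLimits

section Pairing

variable {n i : ℕ}

/-- The pairing of the root `(i,t)` with the simple root `α_c`. -/
def rootPair (n i t c : ℕ) : ℤ := ∑ k ∈ occupied n i (t + 1), aD n c (posColor n i k)

/-- The pairing of the `x`-th vector of the orthonormal basis with the simple root `α_c`. -/
def epsPair (n x c : ℕ) : ℤ :=
  if c = n then (if x + 1 = n ∨ x = n then 1 else 0)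
  else if x = c then 1 else if x = c + 1 then -1 else 0

theorem rootPair_edge (hi : 1 ≤ i) {t c t' : ℕ} (h : Edge n i t c t') (d : ℕ) :
    rootPair n i t' d = aD n d c + rootPair n i t d := by
  obtain ⟨h1, h2⟩ := canRem_edge hi h
  obtain ⟨k, h3, h4, h5, -⟩ := occupied_rem h1
  unfold rootPair
  rw [h4, Finset.sum_insert h3, h5, h2]

theorem rootPair_zero (hi : 1 ≤ i) (hn : i ≤ n) (d : ℕ) : rootPair n i 0 d = aD n d i := by
  obtain ⟨k, h3, h4, h5, -⟩ := occupied_rem (canRem_zero hi hn)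
  unfold rootPair
  rw [h4, Finset.sum_insert h3, h5, (canRem_zero_color le_rfl (canRem_zero hi hn)).2.2,
    occupied_zero hn]
  simp

theorem aD_eq_epsPair {c d : ℕ} (hd : d < n) (hc : c ≤ n) :
    aD n c d = epsPair n d c - epsPair n (d + 1) c := by
  unfold aD epsPair
  split_ifs <;> omega

theorem aD_eq_epsPair_last {c : ℕ} (hc : c ≤ n) (hn : 2 ≤ n) :
    aD n c n = epsPair n (n - 1) c + epsPair n n c := by
  unfold aD epsPair
  split_ifs <;> omega

theorem rootPair_eq (hi : 1 ≤ i) (hin : i + 2 ≤ n) (t : ℕ) (ht : RootIdx n i t) {c : ℕ}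
    (hc : c ≤ n) : rootPair n i t c = epsPair n i c +
      if i + t < n then -epsPair n (i + t + 1) c else epsPair n (2 * n - i - t) c := by
  refine edge_induction (P := fun t => rootPair n i t c = epsPair n i c +
      if i + t < n then -epsPair n (i + t + 1) c else epsPair n (2 * n - i - t) c) hi ?_ ?_ t ht
  · rw [rootPair_zero hi (by omega), aD_eq_epsPair (by omega) hc, if_pos (by omega)]
    rfl
  · intro t d t' he ih
    rw [rootPair_edge hi he, ih]
    obtain ⟨⟨h1, h2, h3⟩, h4⟩ := he
    rcases h3 with ⟨h5, rfl, rfl⟩ | ⟨h5, rfl, rfl⟩ | ⟨h5, rfl, rfl⟩ | ⟨h5, h6, rfl⟩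
    · rw [aD_eq_epsPair (by omega) hc, if_pos (by omega), if_pos (by omega)]
      ring_nf
    · rw [aD_eq_epsPair_last hc (by omega), if_pos (by omega), if_neg (by omega),
        show d - 1 = i + t + 1 by omega, show 2 * d - i - (t + 2) = d by omega]
      ring
    · omega
    · rw [aD_eq_epsPair (by omega) hc, if_neg (by omega), if_neg (by omega),
        show d + 1 = 2 * n - i - t by omega, show 2 * n - i - (t + 1) = d by omega]
      ring

theorem rootPair_of_edge (hi : 1 ≤ i) {t c t' : ℕ} (h : Edge n i t c t') :
    rootPair n i t c = -1 := by
  have h0 := h.1.color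
  rw [rootPair_eq hi h.1.1 t (h.1.rootIdx hi) h0.2]
  obtain ⟨⟨h1, h2, h3⟩, h4⟩ := h
  unfold epsPair
  rcases h3 with h3 | h3 | h3 | h3 <;> split_ifs <;> omega

theorem rootPair_self (hi : 1 ≤ i) (t : ℕ) (ht : RootIdx n i t) :
    ∑ k ∈ occupied n i (t + 1), rootPair n i t (posColor n i k) = 2 := by
  have hn := ht.2.1
  refine edge_induction (P := fun t =>
    ∑ k ∈ occupied n i (t + 1), rootPair n i t (posColor n i k) = 2) hi ?_ ?_ t ht
  · obtain ⟨k, h3, h4, h5, -⟩ := occupied_rem (canRem_zero hi hn)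
    simp only [rootPair_zero hi hn]
    rw [h4, Finset.sum_insert h3, h5, (canRem_zero_color le_rfl (canRem_zero hi hn)).2.2,
      occupied_zero hn, aD_self]
    simp
  · intro t c t' he ih
    obtain ⟨h1, h2⟩ := canRem_edge hi he
    obtain ⟨k, h3, h4, h5, -⟩ := occupied_rem h1
    simp only [rootPair_edge hi he]
    rw [h4, Finset.sum_insert h3, h5, h2, Finset.sum_add_distrib, ih, rootPair_of_edge hi he,
      aD_self, Finset.sum_congr rfl fun k _ => aD_symm n (posColor n i k) c]
    have := rootPair_of_edge hi he
    unfold rootPair at this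
    rw [this]
    norm_num

variable {K : Type} [Field K]

/-- The limit of `rootPsi` obtained from the limit `z` of `zeta`. -/
def rootLim (z : ℕ → ℕ → K) (n i t j b : ℕ) : K :=
  ∏ k ∈ occupied n i (t + 1), ∏ k' ∈ occupied n j b, z (posColor n i k) (posColor n j k')

theorem rootLim_zero_inf {v : K} (hv : v ≠ 0) (hi : 1 ≤ i) {t : ℕ} (ht : RootIdx n i t) :
    rootLim (zetaZero v n) n i t i (t + 1) = v ^ 2 * rootLim (zetaInf v n) n i t i (t + 1) := by
  let s : ℕ → ℕ → ℤ := fun c d => if c = d then 2 else if c < d then 2 * aD n c d else 0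
  have hs : ∀ c d, s c d + s d c = 2 * aD n c d := by
    intro c d
    rcases lt_trichotomy c d with h | rfl | h
    · simp only [s]
      rw [if_neg h.ne, if_pos h, if_neg h.ne', if_neg h.not_gt, add_zero]
    · simp only [s]
      rw [aD_self]; simp
    · simp only [s]
      rw [if_neg h.ne, if_pos h, if_neg h.ne', if_neg h.not_gt, zero_add, aD_symm]
  have hz : ∀ c d, zetaZero v n c d = v ^ s c d * zetaInf v n c d := by
    intro c d
    simp only [s, zetaZero, zetaInf]
    split_ifs
    · simp
    · rw [← zpow_add₀ hv]; congr 1; ring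
    · simp
  have hsum : ∑ k ∈ occupied n i (t + 1), ∑ k' ∈ occupied n i (t + 1),
      s (posColor n i k) (posColor n i k') = 2 := by
    have h1 := rootPair_self hi t ht
    unfold rootPair at h1
    have h2 : ∑ k ∈ occupied n i (t + 1), ∑ k' ∈ occupied n i (t + 1),
        (s (posColor n i k) (posColor n i k') + s (posColor n i k') (posColor n i k)) =
        2 * ∑ k ∈ occupied n i (t + 1), ∑ k' ∈ occupied n i (t + 1),
          aD n (posColor n i k) (posColor n i k') := by
      rw [Finset.mul_sum]
      exact Finset.sum_congr rfl fun k _ => by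
        rw [Finset.mul_sum]; exact Finset.sum_congr rfl fun k' _ => hs _ _
    rw [h1] at h2
    simp only [Finset.sum_add_distrib] at h2
    rw [Finset.sum_comm (f := fun k k' => s (posColor n i k') (posColor n i k))] at h2
    omega
  have hp : ∀ (S : Finset ℕ) (f : ℕ → ℤ), ∏ k ∈ S, v ^ f k = v ^ ∑ k ∈ S, f k := by
    intro S f
    induction S using Finset.induction_on with
    | empty => simp
    | insert a S ha ih => rw [Finset.prod_insert ha, Finset.sum_insert ha, ih, zpow_add₀ hv]
  unfold rootLim
  simp only [hz, Finset.prod_mul_distrib, hp]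
  rw [hsum]
  norm_cast

theorem exists_prod_zpow {ι : Type} (S : Finset ι) {v : K} (hv : v ≠ 0) {f : ι → K}
    (hf : ∀ k ∈ S, ∃ m : ℤ, f k = v ^ m) : ∃ m : ℤ, ∏ k ∈ S, f k = v ^ m := by
  classical
  induction S using Finset.induction_on with
  | empty => exact ⟨0, by simp⟩
  | insert a S ha ih =>
    obtain ⟨m, hm⟩ := hf a (Finset.mem_insert_self a S)
    obtain ⟨m', hm'⟩ := ih fun k hk => hf k (Finset.mem_insert_of_mem hk)
    exact ⟨m + m', by rw [Finset.prod_insert ha, hm, hm', zpow_add₀ hv]⟩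

theorem exists_rootLim_zetaInf {v : K} (hv : v ≠ 0) (n i t j b : ℕ) :
    ∃ k : ℤ, rootLim (zetaInf v n) n i t j b = v ^ k :=
  exists_prod_zpow _ hv fun _ _ => exists_prod_zpow _ hv fun _ _ => exists_zetaInf _ _ _ _

variable {Γ : Type} [AddCommGroup Γ] [LinearOrder Γ] [IsOrderedAddMonoid Γ] {v : K} {γ δ : Γ}

theorem lead_rootPsi_zero (hv : v ≠ 0) (h : γ < δ) (n i t j b : ℕ) :
    Lead (rootPsi (HahnSeries.single 0 v : HahnSeries Γ K) n i t (HahnSeries.single γ 1) j b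
      (HahnSeries.single δ 1)) 0 (rootLim (zetaZero v n) n i t j b) := by
  unfold rootPsi rootLim psi
  simp only [zpow_single_mul_single]
  exact Lead.prod _ fun _ _ => Lead.prod _ fun _ _ => lead_zetaZero hv h _ _ _ _ _

theorem lead_rootPsi_inf (hv : v ≠ 0) (h : δ < γ) (n i t j b : ℕ) :
    Lead (rootPsi (HahnSeries.single 0 v : HahnSeries Γ K) n i t (HahnSeries.single γ 1) j b
      (HahnSeries.single δ 1)) 0 (rootLim (zetaInf v n) n i t j b) := by
  unfold rootPsi rootLim psi
  simp only [zpow_single_mul_single]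
  exact Lead.prod _ fun _ _ => Lead.prod _ fun _ _ => lead_zetaInf hv h _ _ _ _ _

end Pairing

section ListLemmas

theorem map_erase_of_sorted {J R : Type} [DecidableEq J] [LinearOrder R] {τ : J → R} {l x : J}
    {xs : List J} (hs : ((x :: xs).map τ).Pairwise (· ≤ ·)) (hl : l ∈ x :: xs) (h : τ l = τ x) :
    ((x :: xs).erase l).map τ = xs.map τ := by
  induction xs generalizing x with
  | nil =>
    obtain rfl := List.mem_singleton.1 hl
    simp
  | cons y ys ih =>
    by_cases hlx : x = l
    · subst hlx; simp
    · have h1 : l ∈ y :: ys := (List.mem_cons.1 hl).resolve_left (Ne.symm hlx)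
      rw [List.map_cons, List.pairwise_cons] at hs
      have h2 : τ l = τ y := by
        refine le_antisymm (h ▸ hs.1 _ (List.mem_map_of_mem List.mem_cons_self)) ?_
        rw [List.map_cons, List.pairwise_cons] at hs
        rcases List.mem_cons.1 h1 with rfl | h3
        · exact le_rfl
        · exact hs.2.1 _ (List.mem_map_of_mem h3)
      rw [List.erase_cons_tail (by simpa using hlx), List.map_cons, List.map_cons, ih hs.2 h1 h2,
        ← h, h2]

theorem sum_pow_of_sorted {R K : Type} [LinearOrder R] [Field K] (x : K) {q : R} (A : List R)
    (hs : A.Pairwise (· ≤ ·)) (hq : ∀ a ∈ A, q ≤ a) :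
    ∑ j ∈ Finset.range A.length, (if A[j]? = some q then x ^ j else 0) =
      ∑ j ∈ Finset.range (A.count q), x ^ j := by
  induction A with
  | nil => simp
  | cons a A ih =>
    rw [List.pairwise_cons] at hs
    rw [List.length_cons, Finset.sum_range_succ']
    simp only [List.getElem?_cons_succ, List.getElem?_cons_zero, Option.some.injEq]
    by_cases haq : a = q
    · subst haq
      have ih' := ih hs.2 hs.1
      rw [List.count_cons_self, Finset.sum_range_succ']
      simp only [pow_succ, if_true, pow_zero]
      rw [← Finset.sum_mul, ← ih', Finset.sum_mul]
      simp only [ite_mul, zero_mul]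
    · have hlt : q < a := lt_of_le_of_ne (hq a List.mem_cons_self) (Ne.symm haq)
      have hn : q ∉ A := fun h => (hs.1 q h).not_gt hlt
      rw [List.count_cons_of_ne haq, List.count_eq_zero_of_not_mem hn, if_neg haq, add_zero,
        Finset.range_zero, Finset.sum_empty]
      refine Finset.sum_eq_zero fun j _ => if_neg fun h => hn (List.mem_of_getElem? h)

variable {Γ J : Type} [AddCommGroup Γ] (e : J → Γ)

/-- The sum of the `e l`, weighted by the integers of a list. -/
def expSum (A : List ℤ) (L : List J) : Γ := (List.zipWith (fun a l => a • e l) A L).sum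

theorem expSum_cons (a : ℤ) (A : List ℤ) (l : J) (L : List J) :
    expSum e (a :: A) (l :: L) = a • e l + expSum e A L := by simp [expSum]

variable [LinearOrder Γ] [IsOrderedAddMonoid Γ]

theorem expSum_erase {l : J} {post : List J} (pre : List J)
    (hpre : (pre ++ [l]).Pairwise fun m m' => e m' < e m) {a z : ℤ} {A : List ℤ}
    (hs : (a :: A.take pre.length).Pairwise (· ≤ ·)) (hz : (a :: A)[pre.length]? = some z) :
    a ≤ z ∧ (z = a → expSum e (a :: A) (pre ++ l :: post) = a • e l + expSum e A (pre ++ post)) ∧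
      (z ≠ a → expSum e (a :: A) (pre ++ l :: post) < a • e l + expSum e A (pre ++ post)) := by
  induction pre generalizing a A with
  | nil =>
    obtain rfl : a = z := by simpa using hz
    exact ⟨le_rfl, fun _ => expSum_cons e a A l post, fun h => absurd rfl h⟩
  | cons p pre ih =>
    cases A with
    | nil => simp at hz
    | cons b B =>
      rw [List.cons_append, List.pairwise_cons] at hpre
      simp only [List.length_cons, List.take_succ_cons, List.getElem?_cons_succ] at hs hz
      obtain ⟨hs1, hs2⟩ := List.pairwise_cons.1 hs
      obtain ⟨h1, h2, h3⟩ := ih hpre.2 hs2 hz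
      have hab : a ≤ b := hs1 b List.mem_cons_self
      have hl : e l < e p := hpre.1 l (by simp)
      simp only [List.cons_append, expSum_cons] at h2 h3 ⊢
      have hd : a • e l + (b • e p + expSum e B (pre ++ post)) =
          a • e p + (b • e l + expSum e B (pre ++ post)) + (b - a) • (e p - e l) := by
        simp only [sub_smul, smul_sub]; abel
      refine ⟨hab.trans h1, ?_, ?_⟩
      · rintro rfl
        obtain rfl := le_antisymm h1 hab
        rw [h2 rfl]
        abel
      · intro hza
        rw [hd]
        by_cases hzb : z = b
        · subst hzb
          rw [h2 rfl]
          exact lt_add_of_pos_right _ (zsmul_pos (sub_pos.2 hl)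
            (sub_pos.2 (lt_of_le_of_ne hab (Ne.symm hza))))
        · exact (add_lt_add_right (h3 hzb) _).trans_le
            (le_add_of_nonneg_right (zsmul_nonneg (sub_pos.2 hl).le (sub_nonneg.2 hab)))

end ListLemmas

section Configurations
variable {n : ℕ} {J : Type} [DecidableEq J] {τ : J → PosRootD n}

/-- The configuration in which exactly the clusters in the list are occupied, each by the
whole root assigned to it. -/
def conf (τ : J → PosRootD n) (L : List J) (l : J) : ℕ := if l ∈ L then rtD (τ l) + 1 else 0

theorem update_conf {L : List J} (hL : L.Nodup) (l : J) :
    Function.update (conf τ L) l 0 = conf τ (L.erase l) := by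
  ext m
  by_cases h : m = l
  · subst h; simp [conf, hL.not_mem_erase]
  · simp [conf, h, List.mem_erase_of_ne h]

variable {F : Type} [Field F] [Fintype J] {v : F} {w : J → F}

theorem actVec_conf (hg : GenericPts v w) (a : ℤ) (T : ℕ → ℤ) (β : PosRootD n) :
    ∃ (N : ℕ) (M : ℤ), ∀ (G : (J → ℕ) → F) (L : List J), L.Nodup → (∀ l ∈ L, β ≤ τ l) →
      actVec v n (fun l => riD (τ l)) w (v ^ a) T (riD β) (rtD β) G (conf τ L) =
        (L.map fun l => if τ l = β then (-1) ^ N * v ^ M * w l ^ sOfD β T *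
          ((L.erase l).map fun m => rootPsi v n (riD β) (rtD β) (w l) (riD (τ m)) (rtD (τ m) + 1)
            (w m)).prod * G (conf τ (L.erase l)) else 0).sum := by
  have hβ := rootIdx_of_root β
  obtain ⟨N, M, h⟩ := actVec_apply (n := n) (blk := fun l => riD (τ l)) hg a T hβ.1 (rtD β) hβ
  refine ⟨N, M, fun G L hL hle => ?_⟩
  rw [h, ← List.sum_toFinset _ hL, ← Finset.sum_filter]
  · refine Finset.sum_congr ?_ fun l hl => ?_
    · ext l
      rw [Finset.mem_filter_univ, Finset.mem_filter, List.mem_toFinset]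
      unfold conf
      constructor
      · rintro ⟨h1, h2⟩
        split_ifs at h2 with h3
        exact ⟨h3, root_ext h1 (by omega)⟩
      · rintro ⟨h1, rfl⟩
        exact ⟨rfl, if_pos h1⟩
    · rw [update_conf hL]
      congr 2
      rw [← List.prod_toFinset _ (hL.erase l)]
      symm
      refine Finset.prod_subset_one_on_sdiff ?_ ?_ ?_
      · intro m hm
        rw [List.mem_toFinset, hL.mem_erase_iff] at hm
        exact Finset.mem_erase.2 ⟨hm.1, Finset.mem_univ m⟩
      · intro m hm
        rw [Finset.mem_sdiff, List.mem_toFinset, hL.mem_erase_iff, Finset.mem_erase] at hm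
        have h1 : m ∉ L := fun h1 => hm.2 ⟨hm.1.1, h1⟩
        have hn : riD (τ m) ≤ n := (rootIdx_of_root (τ m)).2.1
        simp [rootPsi, psi, conf, h1, occupied_zero hn]
      · intro m hm
        rw [List.mem_toFinset, hL.mem_erase_iff] at hm
        simp [conf, hm.2]
  · intro l hl
    have h1 : l ∈ L := by
      by_contra h1
      exact hl (if_neg h1)
    have h2 := (hle l h1).not_gt
    rw [root_lt_iff] at h2
    simp only [conf, if_pos h1]
    omega

/-- The product of the operators of the quantum root vectors in the list, applied to the vacuum. -/
def vacVec (v : F) (w : J → F) (τ : J → PosRootD n) (a : ℤ) (T : PosRootD n × ℤ → ℕ → ℤ) :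
    List (Lex (PosRootD n × ℤ)) → (J → ℕ) → F
  | [] => fun b => if b = 0 then 1 else 0
  | q :: Q => actVec v n (fun l => riD (τ l)) w (v ^ a) (T (ofLex q)) (riD (ofLex q).1)
      (rtD (ofLex q).1) (vacVec v w τ a T Q)

theorem vacVec_eq_zero (hg : GenericPts v w) (a : ℤ) (T : PosRootD n × ℤ → ℕ → ℤ)
    (Q : List (Lex (PosRootD n × ℤ))) (L : List J) (hL : L.Nodup)
    (hs : (L.map τ).Pairwise (· ≤ ·)) (h : (Q.map fun q => (ofLex q).1) < L.map τ) :
    vacVec v w τ a T Q (conf τ L) = 0 := by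
  induction Q generalizing L with
  | nil =>
    cases L with
    | nil => exact absurd h (List.not_lt_nil _)
    | cons x xs =>
      refine if_neg fun h0 => ?_
      have := congrFun h0 x
      simp [conf] at this
  | cons q Q ih =>
    cases L with
    | nil => exact absurd h (List.not_lt_nil _)
    | cons x xs =>
      obtain ⟨N, M, hv⟩ := actVec_conf (τ := τ) hg a (T (ofLex q)) (ofLex q).1
      rw [List.map_cons, List.map_cons, List.cons_lt_cons_iff] at h
      have hle : (ofLex q).1 ≤ τ x := by
        rcases h with h | h
        exacts [h.le, h.1.le]
      have hs' := hs
      rw [List.map_cons, List.pairwise_cons] at hs'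
      unfold vacVec
      rw [hv _ _ hL]
      · refine List.sum_eq_zero fun y hy => ?_
        obtain ⟨l, hl, rfl⟩ := List.mem_map.1 hy
        refine ite_eq_right_iff.2 fun h1 => ?_
        have h3 : τ x ≤ τ l := by
          rcases List.mem_cons.1 hl with rfl | hl
          exacts [le_rfl, hs'.1 _ (List.mem_map_of_mem hl)]
        have h4 : τ l = τ x := le_antisymm (h1 ▸ hle) h3
        rw [ih _ (hL.erase l), mul_zero]
        · exact hs.sublist ((List.erase_sublist).map τ)
        · rw [map_erase_of_sorted hs hl h4]
          rcases h with h | h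
          · exact absurd (h4 ▸ h1) h.ne'
          · exact h.2
      · intro l hl
        rcases List.mem_cons.1 hl with rfl | hl
        exacts [hle, hle.trans (hs'.1 _ (List.mem_map_of_mem hl))]

end Configurations

section LeadingTerms

/-- The product, over the tails of a list, of the `x`-integers attached to the multiplicities of
their heads. -/
def listGeom {K R : Type} [Field K] [LinearOrder R] (x : K) : List R → K
  | [] => 1
  | q :: Q => (∑ j ∈ Finset.range ((q :: Q).count q), x ^ j) * listGeom x Q

variable {n : ℕ} {J : Type} {τ : J → PosRootD n}
variable {Γ K : Type} [AddCommGroup Γ] [LinearOrder Γ] [IsOrderedAddMonoid Γ] [Field K]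
variable {v : K} {e : J → Γ}

/-- The coefficient with which a root ending at a cluster of type `β` interacts with a list of
other roots, in the limit at infinity. -/
def limProd (v : K) (n : ℕ) (β : PosRootD n) (A : List (PosRootD n)) : K :=
  (A.map fun β' => rootLim (zetaInf v n) n (riD β) (rtD β) (riD β') (rtD β' + 1)).prod

theorem exists_limProd (hv : v ≠ 0) (β : PosRootD n) (A : List (PosRootD n)) :
    ∃ m : ℤ, limProd v n β A = v ^ m := by
  induction A with
  | nil => exact ⟨0, by simp [limProd]⟩
  | cons b A ih =>
    obtain ⟨m, hm⟩ := ih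
    obtain ⟨m', hm'⟩ := exists_rootLim_zetaInf hv n (riD β) (rtD β) (riD b) (rtD b + 1)
    refine ⟨m' + m, ?_⟩
    unfold limProd at hm ⊢
    rw [List.map_cons, List.prod_cons, hm, hm', zpow_add₀ hv]

theorem lead_prod_rootPsi (hv : v ≠ 0) {β : PosRootD n} {pre post : List J} {l : J}
    (hL : (pre ++ l :: post).Pairwise fun m m' => e m' < e m) (hpre : ∀ m ∈ pre, τ m = β) :
    Lead ((pre ++ post).map fun m => rootPsi (HahnSeries.single 0 v) n (riD β)
      (rtD β) (HahnSeries.single (e l) 1) (riD (τ m)) (rtD (τ m) + 1)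
      (HahnSeries.single (e m) 1)).prod 0
      ((v ^ 2) ^ pre.length * limProd v n β ((pre ++ post).map τ)) := by
  obtain ⟨h1, h2, h3⟩ := List.pairwise_append.1 hL
  have hidx := rootIdx_of_root β
  have h4 := Lead.list_prod pre (fun m hm => lead_rootPsi_zero hv (h3 m hm l List.mem_cons_self)
    n (riD β) (rtD β) (riD (τ m)) (rtD (τ m) + 1))
  have h5 := Lead.list_prod post (fun m hm => lead_rootPsi_inf hv
    ((List.pairwise_cons.1 h2).1 m hm) n (riD β) (rtD β) (riD (τ m)) (rtD (τ m) + 1))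
  have h6 : (pre.map fun m => rootLim (zetaZero v n) n (riD β) (rtD β) (riD (τ m))
      (rtD (τ m) + 1)).prod = (v ^ 2) ^ pre.length * (pre.map fun m =>
      rootLim (zetaInf v n) n (riD β) (rtD β) (riD (τ m)) (rtD (τ m) + 1)).prod := by
    rw [← List.prod_replicate, ← List.map_const', ← List.prod_map_mul]
    refine congrArg _ (List.map_congr_left fun m hm => ?_)
    rw [hpre m hm, rootLim_zero_inf hv hidx.1 hidx]
  have h7 := h4.mul h5
  have h8 : limProd v n β ((pre ++ post).map τ) = (pre.map fun m =>
      rootLim (zetaInf v n) n (riD β) (rtD β) (riD (τ m)) (rtD (τ m) + 1)).prod *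
      (post.map fun m =>
      rootLim (zetaInf v n) n (riD β) (rtD β) (riD (τ m)) (rtD (τ m) + 1)).prod := by
    unfold limProd
    rw [List.map_append, List.map_append, List.prod_append, List.map_map, List.map_map]
    rfl
  rw [add_zero, h6, mul_assoc, ← h8] at h7
  rw [List.map_append, List.prod_append]
  exact h7

theorem lead_vacVec_term (hv : v ≠ 0) {q : Lex (PosRootD n × ℤ)} {Q : List (Lex (PosRootD n × ℤ))}
    (hQ : (q :: Q).Pairwise (· ≤ ·)) {pre post : List J} {l : J}
    (hL : (pre ++ l :: post).Pairwise fun m m' => e m' < e m)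
    (hτ : (pre ++ l :: post).map τ = (q :: Q).map fun q => (ofLex q).1) (hl : τ l = (ofLex q).1)
    {g : HahnSeries Γ K} {c : K}
    (hg : Lead g (expSum e (Q.map fun q => (ofLex q).2) (pre ++ post)) c) :
    Lead (HahnSeries.single (e l) 1 ^ (ofLex q).2 *
      ((pre ++ post).map fun m => rootPsi (HahnSeries.single 0 v) n (riD (ofLex q).1)
        (rtD (ofLex q).1) (HahnSeries.single (e l) 1) (riD (τ m)) (rtD (τ m) + 1)
        (HahnSeries.single (e m) 1)).prod * g)
      (expSum e ((q :: Q).map fun q => (ofLex q).2) (pre ++ l :: post))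
      (if (q :: Q)[pre.length]? = some q then (v ^ 2) ^ pre.length *
        limProd v n (ofLex q).1 ((pre ++ post).map τ) * c else 0) := by
  set β := (ofLex q).1 with hβ
  have hLs : (pre ++ l :: post).Pairwise fun m m' => τ m ≤ τ m' := by
    have h1 : ((pre ++ l :: post).map τ).Pairwise (· ≤ ·) := by
      rw [hτ]
      exact (hQ.imp fun h => Prod.Lex.monotone_fst _ _ h).map _ fun _ _ h => h
    exact (List.pairwise_map.1 h1)
  have hpre : ∀ m ∈ pre, τ m = β := by
    intro m hm
    refine le_antisymm (hl ▸ (List.pairwise_append.1 hLs).2.2 m hm l List.mem_cons_self) ?_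
    obtain ⟨r, hr, hr'⟩ := List.mem_map.1
      (hτ ▸ List.mem_map_of_mem (f := τ) (List.mem_append_left (l :: post) hm))
    rw [← hr']
    rcases List.mem_cons.1 hr with rfl | hr
    · exact le_rfl
    · exact Prod.Lex.monotone_fst _ _ ((List.pairwise_cons.1 hQ).1 r hr)
  have htake : ∀ r ∈ (q :: Q).take (pre.length + 1), (ofLex r).1 = β := by
    intro r hr
    have h1 : ((q :: Q).take (pre.length + 1)).map (fun q => (ofLex q).1) =
        (pre ++ [l]).map τ := by
      rw [List.map_take, ← hτ, ← List.map_take, List.append_cons, List.take_left' (by simp)]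
    obtain ⟨m, hm, hm'⟩ := List.mem_map.1 (h1 ▸ List.mem_map_of_mem hr)
    rw [← hm']
    rcases List.mem_append.1 hm with hm | hm
    · exact hpre m hm
    · rw [List.mem_singleton.1 hm, hl]
  have hmode : ((ofLex q).2 :: (Q.map fun q => (ofLex q).2).take pre.length).Pairwise (· ≤ ·) := by
    have h1 : (((q :: Q).take (pre.length + 1)).map fun q => (ofLex q).2).Pairwise (· ≤ ·) := by
      rw [List.pairwise_map]
      refine (hQ.sublist (List.take_sublist _ _)).imp_of_mem fun {a b} ha hb hab => ?_
      rw [Prod.Lex.le_iff, htake a ha, htake b hb] at hab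
      exact (hab.resolve_left (lt_irrefl _)).2
    simpa [List.map_take] using h1
  have hlen : pre.length < (q :: Q).length := by
    have := congrArg List.length hτ
    simp only [List.length_map, List.length_append, List.length_cons] at this ⊢
    omega
  have hz : ((ofLex q).2 :: Q.map fun q => (ofLex q).2)[pre.length]? =
      some (ofLex (q :: Q)[pre.length]).2 := by
    rw [← List.map_cons (f := fun q : Lex (PosRootD n × ℤ) => (ofLex q).2), List.getElem?_map,
      List.getElem?_eq_getElem hlen]
    rfl
  have hL' : (pre ++ [l]).Pairwise fun m m' => e m' < e m :=
    hL.sublist (List.Sublist.append_left (List.singleton_sublist.2 List.mem_cons_self) _)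
  obtain ⟨-, heq, hne⟩ := expSum_erase e (post := post) pre hL' hmode hz
  have hlead := lead_prod_rootPsi (n := n) hv hL hpre
  have hmain := ((by simpa [single_zpow] using lead_single ((ofLex q).2 • e l) (1 : K) :
    Lead (HahnSeries.single (e l) (1 : K) ^ (ofLex q).2) ((ofLex q).2 • e l) 1).mul hlead).mul hg
  rw [one_mul, add_zero] at hmain
  split_ifs with h
  · have h1 : (q :: Q)[pre.length] = q := by
      rwa [List.getElem?_eq_getElem hlen, Option.some_inj] at h
    have := heq (by rw [h1])
    rw [List.map_cons, this]
    exact hmain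
  · refine hmain.mono (hne fun h1 => h ?_)
    have h2 := htake (q :: Q)[pre.length]
      (List.mem_take_iff_getElem.2 ⟨pre.length, by simpa using hlen, rfl⟩)
    rw [List.getElem?_eq_getElem hlen, Option.some_inj]
    exact Prod.ext h2 h1

variable [DecidableEq J] [Fintype J]

variable (τ) in
theorem lead_vacVec (hv : v ≠ 0) (he : Function.Injective e) (a : ℤ) {T : PosRootD n × ℤ → ℕ → ℤ}
    (hT : ∀ p, sOfD p.1 (T p) = p.2) (Q : List (Lex (PosRootD n × ℤ)))
    (hQ : Q.Pairwise (· ≤ ·)) : ∃ (s : ℕ) (k : ℤ), ∀ L : List J,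
      L.Pairwise (fun m m' => e m' < e m) → L.map τ = (Q.map fun q => (ofLex q).1) →
      Lead (vacVec (HahnSeries.single 0 v : HahnSeries Γ K) (fun l => HahnSeries.single (e l) 1)
        τ a T Q (conf τ L)) (expSum e (Q.map fun q => (ofLex q).2) L)
        ((-1) ^ s * v ^ k * listGeom (v ^ 2) Q) := by
  induction Q with
  | nil =>
    refine ⟨0, 0, fun L _ hL => ?_⟩
    obtain rfl : L = [] := by simpa using hL
    have h0 : conf τ [] = 0 := by ext l; simp [conf]
    simpa [vacVec, h0, listGeom, expSum] using lead_one
  | cons q Q ih =>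
    obtain ⟨s, k, ih⟩ := ih (List.pairwise_cons.1 hQ).2
    obtain ⟨N, M, hact⟩ := actVec_conf (τ := τ) (genericPts_single (Γ := Γ) hv he) a
      (T (ofLex q)) (ofLex q).1
    obtain ⟨W, hW⟩ := exists_limProd hv (ofLex q).1 (Q.map fun q => (ofLex q).1)
    refine ⟨N + s, M + W + k, fun L hL hτ => ?_⟩
    have hnd : L.Nodup := hL.imp fun h h' => h.ne' (congrArg e h')
    have hroots : ((q :: Q).map fun q => (ofLex q).1).Pairwise (· ≤ ·) :=
      (hQ.imp fun h => Prod.Lex.monotone_fst _ _ h).map _ fun _ _ h => h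
    have hle : ∀ r ∈ q :: Q, q ≤ r := by
      intro r hr
      rcases List.mem_cons.1 hr with rfl | hr
      exacts [le_rfl, (List.pairwise_cons.1 hQ).1 r hr]
    have hle' : ∀ l ∈ L, (ofLex q).1 ≤ τ l := by
      intro l hl
      obtain ⟨r, hr, hr'⟩ := List.mem_map.1 (hτ ▸ List.mem_map_of_mem (f := τ) hl)
      rw [← hr']
      exact Prod.Lex.monotone_fst _ _ (hle r hr)
    unfold vacVec
    rw [hact _ _ hnd hle', ← Fin.sum_univ_fun_getElem]
    have hlen : L.length = (q :: Q).length := by simpa using congrArg List.length hτ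
    have hcoef : (-1) ^ (N + s) * v ^ (M + W + k) * listGeom (v ^ 2) (q :: Q) =
        ∑ j : Fin L.length, if (q :: Q)[(j : ℕ)]? = some q then (-1) ^ N * v ^ M *
          ((v ^ 2) ^ (j : ℕ) * v ^ W * ((-1) ^ s * v ^ k * listGeom (v ^ 2) Q)) else 0 := by
      rw [← Finset.sum_range (fun j => if (q :: Q)[j]? = some q then (-1) ^ N * v ^ M *
          ((v ^ 2) ^ j * v ^ W * ((-1) ^ s * v ^ k * listGeom (v ^ 2) Q)) else 0), hlen, listGeom,
        ← sum_pow_of_sorted _ _ hQ hle, Finset.sum_mul, Finset.mul_sum]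
      refine Finset.sum_congr rfl fun j _ => ?_
      split_ifs
      · rw [zpow_add₀ hv, zpow_add₀ hv, pow_add]; ring
      · simp
    rw [hcoef]
    refine Lead.sum _ fun j _ => ?_
    have hsplit : L = L.take j ++ L[(j : ℕ)] :: L.drop (j + 1) := by
      rw [← List.drop_eq_getElem_cons j.2, List.take_append_drop]
    have hjlen : (L.take j).length = j := by simp [j.2.le]
    generalize L.take j = pre at hsplit hjlen
    generalize L.drop (j + 1) = post at hsplit
    generalize L[(j : ℕ)] = l at hsplit
    rw [← hjlen]
    clear hcoef hjlen
    subst hsplit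
    have hx : (pre ++ l :: post).erase l = pre ++ post := by
      rw [List.erase_append_right, List.erase_cons_head]
      intro h
      exact (List.nodup_append.1 hnd).2.2 l h l List.mem_cons_self rfl
    have hlen' : pre.length < (q :: Q).length := by
      rw [← hlen]; simp
    have hroot : τ l = (ofLex (q :: Q)[pre.length]).1 := by
      have h1 := congrArg (fun A => A[pre.length]?) hτ
      simp only [List.map_append, List.map_cons, List.getElem?_append_right, List.length_map,
        le_refl, Nat.sub_self, List.getElem?_cons_zero] at h1
      rw [← List.map_cons (f := fun q : Lex (PosRootD n × ℤ) => (ofLex q).1), List.getElem?_map,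
        List.getElem?_eq_getElem hlen'] at h1
      exact Option.some_inj.1 h1
    by_cases hl : τ l = (ofLex q).1
    · have hmap : (pre ++ post).map τ = Q.map fun q => (ofLex q).1 := by
        cases hc : pre ++ l :: post with
        | nil => simp at hc
        | cons x xs =>
          rw [hc, List.map_cons, List.map_cons, List.cons.injEq] at hτ
          rw [← hx, hc, ← hτ.2]
          refine map_erase_of_sorted ?_ (hc ▸ by simp) (hl.trans hτ.1.symm)
          rw [List.map_cons, hτ.1, hτ.2]
          exact hroots
      have hsub : (pre ++ post).Sublist (pre ++ l :: post) :=
        List.Sublist.append_left (List.sublist_cons_self _ _) _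
      have hterm := lead_vacVec_term hv hQ hL hτ hl (ih (pre ++ post) (hL.sublist hsub) hmap)
      have hpow : Lead ((-1) ^ N * (HahnSeries.single 0 v : HahnSeries Γ K) ^ M) 0
          ((-1) ^ N * v ^ M) := by
        have h1 := (Lead.prod (Finset.range N) fun _ _ => (lead_one (Γ := Γ) (K := K)).neg).mul
          (lead_single (M • (0 : Γ)) (v ^ M))
        rwa [Finset.prod_const, Finset.prod_const, Finset.card_range, ← single_zpow, smul_zero,
          add_zero] at h1
      have hmul := hpow.mul hterm
      rw [zero_add, mul_ite, mul_zero, hmap, hW] at hmul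
      have hgoal : Lead ((-1) ^ N * (HahnSeries.single 0 v : HahnSeries Γ K) ^ M *
          HahnSeries.single (e l) 1 ^ sOfD (ofLex q).1 (T (ofLex q)) *
          (((pre ++ l :: post).erase l).map fun m => rootPsi (HahnSeries.single 0 v) n
            (riD (ofLex q).1) (rtD (ofLex q).1) (HahnSeries.single (e l) 1) (riD (τ m))
            (rtD (τ m) + 1) (HahnSeries.single (e m) 1)).prod *
          vacVec (HahnSeries.single 0 v) (fun l => HahnSeries.single (e l) 1) τ a T Q
            (conf τ ((pre ++ l :: post).erase l)))
          (expSum e ((q :: Q).map fun q => (ofLex q).2) (pre ++ l :: post))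
          (if (q :: Q)[pre.length]? = some q then (-1) ^ N * v ^ M * ((v ^ 2) ^ pre.length * v ^ W *
            ((-1) ^ s * v ^ k * listGeom (v ^ 2) Q)) else 0) := by
        rw [hx, hT, mul_assoc, mul_assoc, ← mul_assoc (HahnSeries.single (e l) 1 ^ _)]
        exact hmul
      rw [if_pos hl]
      exact hgoal
    · rw [if_neg hl, if_neg]
      · exact lead_zero _
      · rw [List.getElem?_eq_getElem hlen', Option.some_inj]
        intro h
        exact hl (by rw [hroot, h])

end LeadingTerms

section Multiplicities
variable {ι : Type} [LinearOrder ι]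

theorem listGeom_eq (S : Finset ι) (Q : List ι) (hQ : ∀ q ∈ Q, q ∈ S) :
    ∃ k : ℕ, listGeom (vv ^ 2) Q = vv ^ k * ∏ x ∈ S, qFact vv (Q.count x) := by
  induction Q with
  | nil => exact ⟨0, by simp [listGeom, qFact_zero]⟩
  | cons q Q ih =>
    obtain ⟨k, hk⟩ := ih fun r hr => hQ r (List.mem_cons_of_mem q hr)
    have h1 : ∏ x ∈ S, qFact vv ((q :: Q).count x) =
        (∏ x ∈ S, qFact vv (Q.count x)) * qInt vv (Q.count q + 1) := by
      rw [← Finset.prod_erase_mul S _ (hQ q List.mem_cons_self),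
        ← Finset.prod_erase_mul S _ (hQ q List.mem_cons_self), List.count_cons_self, qFact_succ,
        mul_assoc]
      refine congrArg (· * _) (Finset.prod_congr rfl fun x hx => ?_)
      rw [List.count_cons_of_ne (Finset.ne_of_mem_erase hx).symm]
    refine ⟨Q.count q + k, ?_⟩
    rw [listGeom, List.count_cons_self, sum_vv_sq_pow, hk, h1, pow_add]
    ring

theorem listGeom_sortedList (h : ι →₀ ℕ) :
    ∃ k : ℕ, listGeom (vv ^ 2) (sortedList h) = vv ^ k * factProd h := by
  have hc : ∀ x, (sortedList h).count x = h x := by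
    intro x
    rw [sortedList, ← Multiset.coe_count, Multiset.sort_eq, Finsupp.count_toMultiset]
  obtain ⟨k, hk⟩ := listGeom_eq h.support (sortedList h) fun q hq => by
    rw [Finsupp.mem_support_iff, ← hc]
    exact (List.count_pos_iff.2 hq).ne'
  refine ⟨k, hk.trans ?_⟩
  simp only [hc]
  rfl

end Multiplicities

section Exponents

/-- The standard basis of the lexicographically ordered lattice. -/
def lexUnit {m : ℕ} (l : Fin m) : Lex (Fin m → ℤ) := toLex (Pi.single l 1)

theorem lexUnit_injective {m : ℕ} : Function.Injective (lexUnit : Fin m → Lex (Fin m → ℤ)) :=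
  fun l l' h => by
    by_contra hne
    have := congrFun (toLex.injective h) l
    simp [hne] at this

theorem lexUnit_lt {m : ℕ} {l l' : Fin m} (h : l < l') : lexUnit l' < lexUnit l := by
  refine ⟨l, fun j hj => ?_, ?_⟩
  · simp [lexUnit, hj.ne, (hj.trans h).ne]
  · simp [lexUnit, h.ne]

theorem expSum_lexUnit {m : ℕ} (A : List ℤ) (hA : A.length = m) :
    expSum lexUnit A (List.finRange m) = toLex fun j : Fin m => A[(j : ℕ)] := by
  subst hA
  have h1 : ∀ (f : Fin A.length → ℤ) (L : List (Fin A.length)),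
      expSum lexUnit (L.map f) L = (L.map fun l => f l • lexUnit l).sum := by
    intro f L
    induction L with
    | nil => rfl
    | cons l L ih => rw [List.map_cons, expSum_cons, ih, List.map_cons, List.sum_cons]
  have h2 := h1 (fun j => A[(j : ℕ)]) (List.finRange A.length)
  rw [← List.ofFn_eq_map, List.ofFn_getElem, ← List.ofFn_eq_map, List.sum_ofFn] at h2
  rw [h2]
  apply ofLex.injective
  ext j
  have h3 : ∀ x : Fin A.length, (ofLex (A[(x : ℕ)] • lexUnit x)) = Pi.single x A[(x : ℕ)] := by
    intro x
    change A[(x : ℕ)] • (Pi.single x 1 : Fin A.length → ℤ) = _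
    rw [← Pi.single_smul]
    simp
  change (∑ x : Fin A.length, ofLex (A[(x : ℕ)] • lexUnit x)) j = A[(j : ℕ)]
  simp only [h3]
  exact congrFun (Finset.univ_sum_single fun x : Fin A.length => A[(x : ℕ)]) j

theorem expSum_lexUnit_lt {m : ℕ} {A B : List ℤ} (hA : A.length = m) (hB : B.length = m)
    (h : A < B) : expSum lexUnit A (List.finRange m) < expSum lexUnit B (List.finRange m) := by
  rw [expSum_lexUnit A hA, expSum_lexUnit B hB]
  rcases List.lt_iff_exists.1 h with ⟨-, h⟩ | ⟨i, h1, h2, h3, h4⟩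
  · omega
  · refine ⟨⟨i, by omega⟩, fun j hj => ?_, h4⟩
    have := h3 j hj
    simpa using this

end Exponents

section Functionals
variable {n : ℕ}

/-- The roots of an ordered monomial, then its loop degrees in the reversed order. -/
def monKey (h : Lex (PosRootD n × ℤ) →₀ ℕ) : List (PosRootD n) ×ₗ (List ℤ)ᵒᵈ :=
  toLex ((sortedList h).map fun q => (ofLex q).1,
    OrderDual.toDual ((sortedList h).map fun q => (ofLex q).2))

theorem monKey_injective : Function.Injective (monKey (n := n)) := by
  intro h h' he
  have h1 := congrArg (fun x => (ofLex x).1) he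
  have h2 := congrArg (fun x => OrderDual.ofDual (ofLex x).2) he
  refine sortedList_injective (List.ext_getElem? fun i => ?_)
  have h3 := congrArg (fun A => A[i]?) h1
  have h4 := congrArg (fun A => A[i]?) h2
  simp only [monKey, ofLex_toLex, OrderDual.ofDual_toDual, List.getElem?_map] at h3 h4
  cases h5 : (sortedList h)[i]? <;> cases h6 : (sortedList h')[i]? <;>
    simp only [h5, h6, Option.map_none, Option.map_some, Option.some.injEq, reduceCtorEq] at h3 h4 ⊢
  exact Prod.ext h3 h4

theorem rep_prod_tildeED {F : Type} [Field F] [Algebra KK F] {J : Type} [DecidableEq J] [Fintype J]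
    {τ : J → PosRootD n} {w : J → F} {ρ : UD n →ₐ[KK] Module.End F ((J → ℕ) → F)}
    (hρ : ∀ i r, ρ (genD n i r) = act (vIn F) n (fun l => riD (τ l)) w i r) (ε : Bool)
    (T : PosRootD n × ℤ → ℕ → ℤ) (Q : List (Lex (PosRootD n × ℤ))) :
    ρ (Q.map fun p => tildeED ε (ofLex p).1 (T (ofLex p))).prod
      (fun b => if b = 0 then 1 else 0) = vacVec (vIn F) w τ (sgn ε) T Q := by
  induction Q with
  | nil => simp [vacVec]
  | cons q Q ih =>
    rw [List.map_cons, List.prod_cons, map_mul, Module.End.mul_apply, ih, rep_tildeED hρ, vacVec]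

theorem exists_functional (ε : Bool) (T : PosRootD n × ℤ → ℕ → ℤ)
    (hT : ∀ p, sOfD p.1 (T p) = p.2) (P : Lex (PosRootD n × ℤ) →₀ ℕ) :
    ∃ φ : UD n →ₗ[KK] KK, (∀ x ∈ LusFormD n, φ x ∈ Rint) ∧
      (∀ Q, monKey Q < monKey P → φ (lusMonD ε T Q) = 0) ∧
      ∃ (s : ℕ) (k : ℤ), φ (lusMonD ε T P) = (-1) ^ s * vv ^ k := by
  set m := (sortedList P).length with hm
  let τ : Fin m → PosRootD n := fun l => (ofLex (sortedList P)[(l : ℕ)]).1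
  let Γ := Lex (Fin m → ℤ)
  let F := HahnSeries Γ KK
  have hv : vIn F = HahnSeries.single 0 vv := rfl
  let w : Fin m → F := fun l => HahnSeries.single (lexUnit l) 1
  have hg : GenericPts (vIn F) w := genericPts_single vv_ne_zero lexUnit_injective
  have hi : IntegralPts (vIn F) w (coeffSubring Γ Rint) :=
    integralPts_single vv_ne_zero vv_mem_Rint vv_inv_mem_Rint lexUnit_injective
  obtain ⟨ρ, hρ⟩ := exists_rep hg n fun l => riD (τ l)
  let L := List.finRange m
  let γ : Γ := expSum lexUnit ((sortedList P).map fun q => (ofLex q).2) L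
  let vac : (Fin m → ℕ) → F := fun b => if b = 0 then 1 else 0
  have hL : L.Pairwise fun l l' => lexUnit l' < lexUnit l :=
    (List.pairwise_lt_finRange m).imp lexUnit_lt
  have hτ : L.map τ = (sortedList P).map fun q => (ofLex q).1 := by
    rw [← List.ofFn_eq_map]
    have := congrArg (List.map fun q : Lex (PosRootD n × ℤ) => (ofLex q).1)
      (List.ofFn_getElem (xs := sortedList P))
    rwa [List.map_ofFn] at this
  have hsort : ∀ Q : Lex (PosRootD n × ℤ) →₀ ℕ, (sortedList Q).Pairwise (· ≤ ·) :=
    fun Q => Multiset.pairwise_sort _ _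
  let φ : UD n →ₗ[KK] KK :=
    { toFun := fun x => (ρ x vac (conf τ L)).coeff γ
      map_add' := fun x y => by rw [map_add]; rfl
      map_smul' := fun a x => by rw [map_smul]; rfl }
  have hφ : ∀ Q, φ (lusMonD ε T Q) = (factProd Q)⁻¹ *
      (vacVec (vIn F) w τ (sgn ε) T (sortedList Q) (conf τ L)).coeff γ := by
    intro Q
    rw [lusMonD_eq, map_smul, smul_eq_mul, ← rep_prod_tildeED hρ]
    rfl
  refine ⟨φ, fun x hx => ?_, fun Q hQ => ?_, ?_⟩
  · refine rep_mem hg hi hρ hx (fun b => ?_) (conf τ L) γ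
    by_cases hb : b = 0
    · rw [show vac b = 1 from if_pos hb]; exact Subring.one_mem _
    · rw [show vac b = 0 from if_neg hb]; exact Subring.zero_mem _
  · rw [hφ]
    rcases Prod.Lex.lt_iff.1 hQ with h | ⟨h1, h2⟩
    · rw [vacVec_eq_zero hg _ T _ L (List.nodup_finRange m)]
      · simp
      · rw [hτ]
        exact ((hsort P).imp fun h => Prod.Lex.monotone_fst _ _ h).map _ fun _ _ h => h
      · rw [hτ]; exact h
    · obtain ⟨s, k, h⟩ := lead_vacVec τ (Γ := Γ) vv_ne_zero lexUnit_injective (sgn ε) hT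
        (sortedList Q) (hsort Q)
      have h3 := (h L hL (hτ.trans h1.symm)).1 γ ?_
      · change (vacVec (vIn F) w τ (sgn ε) T (sortedList Q) (conf τ L)).coeff γ = 0 at h3
        rw [h3, mul_zero]
      · refine expSum_lexUnit_lt (by simp [hm]) ?_ h2
        have := congrArg List.length h1
        simpa [monKey] using this
  · obtain ⟨s, k, h⟩ := lead_vacVec τ (Γ := Γ) vv_ne_zero lexUnit_injective (sgn ε) hT
      (sortedList P) (hsort P)
    obtain ⟨k', h'⟩ := listGeom_sortedList P
    refine ⟨s, k + k', ?_⟩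
    have h2 := (h L hL hτ).2
    change (vacVec (vIn F) w τ (sgn ε) T (sortedList P) (conf τ L)).coeff γ = _ at h2
    rw [hφ, h2, h', zpow_add₀ vv_ne_zero, zpow_natCast]
    have := factProd_ne_zero P
    field_simp

end Functionals

section Triangularity
variable {k B H X : Type} [Field k] [AddCommGroup B] [Module k B] [LinearOrder X]

/-- A nonzero combination of vectors that are triangular for a family of functionals has a
nonzero value on one of them. -/
theorem exists_triangular {E : H → B} {φ : H → B →ₗ[k] k} {key : H → X}
    (hkey : Function.Injective key) (hzero : ∀ P Q, key Q < key P → φ P (E Q) = 0)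
    {c : H →₀ k} (hc : c ≠ 0) :
    ∃ P, c P ≠ 0 ∧ φ P (c.sum fun h a => a • E h) = c P * φ P (E P) := by
  obtain ⟨P, hP, hmax⟩ := c.support.exists_max_image key (Finsupp.support_nonempty_iff.2 hc)
  refine ⟨P, Finsupp.mem_support_iff.1 hP, ?_⟩
  rw [Finsupp.sum, map_sum, Finset.sum_eq_single P]
  · rw [map_smul, smul_eq_mul]
  · intro Q hQ hne
    rw [map_smul, hzero P Q (lt_of_le_of_ne (hmax Q hQ) fun h => hne (hkey h)), smul_zero]
  · exact fun h => absurd hP h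

end Triangularity

section Integrality
variable {k B H X : Type} [Field k] [Ring B] [Algebra k B] [LinearOrder X]

theorem coeff_mem_of_triangular {E : H → B} {φ : H → B →ₗ[k] k} {key : H → X} {S : Subring k}
    {U : Subring B} (hkey : Function.Injective key) (hzero : ∀ P Q, key Q < key P → φ P (E Q) = 0)
    (hunit : ∀ P, φ P (E P) ≠ 0 ∧ (φ P (E P))⁻¹ ∈ S) (hφ : ∀ P, ∀ x ∈ U, φ P x ∈ S)
    (hE : ∀ h, E h ∈ U) (hS : ∀ a ∈ S, ∀ x ∈ U, a • x ∈ U) {c : H →₀ k}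
    (hx : (c.sum fun h a => a • E h) ∈ U) (h : H) : c h ∈ S := by
  classical
  by_contra hh
  let d := c.filter fun h => c h ∉ S
  let d' := c.filter fun h => ¬ c h ∉ S
  have hd : d ≠ 0 := fun h0 => hh <| by
    have h1 : d h = c h := Finsupp.filter_apply_pos _ c hh
    rw [← h1, h0]
    exact S.zero_mem
  have hsum : (d.sum fun h a => a • E h) + (d'.sum fun h a => a • E h) =
      c.sum fun h a => a • E h := by
    rw [← Finsupp.sum_add_index' (h := fun h a => a • E h) (fun _ => zero_smul k _)
      (fun _ _ _ => add_smul _ _ _), Finsupp.filter_add_filter_not]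
  have hd' : (d'.sum fun h a => a • E h) ∈ U := by
    refine U.sum_mem fun P hP => hS _ ?_ _ (hE P)
    rw [Finsupp.support_filter, Finset.mem_filter, not_not] at hP
    rw [Finsupp.filter_apply_pos _ c (not_not.2 hP.2)]
    exact hP.2
  obtain ⟨P, hP, hP'⟩ := exists_triangular hkey hzero hd
  have h1 : (d.sum fun h a => a • E h) ∈ U := by
    rw [eq_sub_of_add_eq hsum]
    exact U.sub_mem hx hd'
  have h2 : c P ∉ S := by
    by_contra h3
    exact hP (Finsupp.filter_apply_neg _ c (not_not.2 h3))
  rw [show d P = c P from Finsupp.filter_apply_pos _ c h2] at hP'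
  refine h2 ?_
  rw [← mul_inv_cancel_right₀ (hunit P).1 (c P), ← hP']
  exact S.mul_mem (hφ P _ h1) (hunit P).2

end Integrality

/-- **PBWD basis of the Lusztig form (type `D_n`)**: for a fixed sign `ε` and fixed
decompositions, the ordered monomials `{Ẽ^ε_h}_{h∈H}` form a `ℤ[v,v⁻¹]`-basis of
`𝐔_v^>(Lo_{2n})`: they are `ℤ[v,v⁻¹]`-linearly independent, and the elements of
`𝐔_v^>(Lo_{2n})` are exactly their `ℤ[v,v⁻¹]`-linear combinations. -/
theorem lusztig_basis_typeD (n : ℕ) (hn : 4 ≤ n) (ε : Bool)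
    (T : PosRootD n × ℤ → (ℕ → ℤ)) (hT : ∀ p, sOfD p.1 (T p) = p.2) :
    (∀ c : (Lex (PosRootD n × ℤ) →₀ ℕ) →₀ KK, (∀ h, c h ∈ Rint) →
      (c.sum fun h a => a • lusMonD ε T h) = 0 → c = 0) ∧
    (∀ x : UD n, x ∈ LusFormD n ↔
      ∃ c : (Lex (PosRootD n × ℤ) →₀ ℕ) →₀ KK, (∀ h, c h ∈ Rint) ∧
        x = c.sum fun h a => a • lusMonD ε T h) := by
  choose φ hφ hzero hlead using exists_functional ε T hT
  have hunit : ∀ P, φ P (lusMonD ε T P) ≠ 0 ∧ (φ P (lusMonD ε T P))⁻¹ ∈ Rint := by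
    intro P
    obtain ⟨s, k, h⟩ := hlead P
    rw [h]
    refine ⟨mul_ne_zero (pow_ne_zero _ (neg_ne_zero.2 one_ne_zero))
      (zpow_ne_zero _ vv_ne_zero), ?_⟩
    rw [mul_inv, ← inv_pow, inv_neg_one, ← zpow_neg]
    exact Rint.mul_mem (Rint.pow_mem (Rint.neg_mem Rint.one_mem) _)
      (zpow_mem_of_inv_mem vv_mem_Rint vv_inv_mem_Rint _)
  refine ⟨fun c _ h0 => ?_, fun x => ⟨fun hx => ?_, ?_⟩⟩
  · by_contra hc
    obtain ⟨P, hP, h⟩ := exists_triangular monKey_injective hzero hc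
    rw [h0, map_zero] at h
    exact mul_ne_zero hP (hunit P).1 h.symm
  · obtain ⟨c, rfl⟩ := (Finsupp.mem_span_range_iff_exists_finsupp).1 (mem_span_lusMonD ε T hT x)
    exact ⟨c, coeff_mem_of_triangular monKey_injective hzero hunit hφ (lusMonD_mem ε T)
      (fun a ha x hx => smul_mem_LusFormD ha hx) hx, rfl⟩
  · rintro ⟨c, hc, rfl⟩
    exact Subring.sum_mem _ fun h _ => smul_mem_LusFormD (hc h) (lusMonD_mem ε T h)
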